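/- Let Z ⊂ P^5 be a smooth complete intersection of two quadrics over ℂ, let X ∈ |O_Z(d)| be a smooth surface with d ≥ 8, and let φ : X ⇢ P^2 be a dominant rational map with deg(φ) ≤ 2d. Then deg(φ) ≥ 2d − 2, and the fiber of φ over a general point of P^2 is contained in a smooth plane conic C ⊂ P^5 that lies inside Z. -/

import Mathlib

open MvPolynomial

noncomputable section

/-- Points of the complex projective space whose homogeneous coordinates are
indexed by `ι` (so for `ι = Fin (N+1)` this is `ℙ^N`). -/
abbrev PPt (ι : Type) : Type := Projectivization ℂ (ι → ℂ)

/-- A polynomial vanishes at a projective point if it vanishes at every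
representative vector of the point. -/
def PVanish {ι : Type} (f : MvPolynomial ι ℂ) (x : PPt ι) : Prop :=
  ∀ (v : ι → ℂ) (hv : v ≠ 0), Projectivization.mk ℂ v hv = x → eval v f = 0

/-- The zero locus of a polynomial in projective space. -/
def ZeroSet {ι : Type} (f : MvPolynomial ι ℂ) : Set (PPt ι) :=
  {x | PVanish f x}

/-- Zariski-closed subsets of projective space: common zero loci of families of
homogeneous polynomials. -/
def IsZClosed {ι : Type} (Y : Set (PPt ι)) : Prop :=
  ∃ fs : Set (MvPolynomial ι ℂ),
    (∀ f ∈ fs, ∃ e, f.IsHomogeneous e) ∧ Y = {x | ∀ f ∈ fs, PVanish f x}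

/-- `U` contains a dense (Zariski-)open subset of `X`: there is a Zariski-closed
set `Y` not containing `X` with `X \ Y ⊆ U`.  Taking `X = Set.univ` this is the
notion of a set containing "the general point" of the ambient projective space. -/
def ContainsDenseOpenOf {ι : Type} (X U : Set (PPt ι)) : Prop :=
  ∃ Y : Set (PPt ι), IsZClosed Y ∧ ¬ X ⊆ Y ∧ X \ Y ⊆ U

/-- The set of projective points lying in (the projectivization of) a linear
subspace `W`. -/
def LinSet {ι : Type} (W : Submodule ℂ (ι → ℂ)) : Set (PPt ι) :=
  {x | x.submodule ≤ W}

/-- A line in projective space: the projectivization of a 2-dimensional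
linear subspace. -/
def IsLine {ι : Type} (L : Set (PPt ι)) : Prop :=
  ∃ W : Submodule ℂ (ι → ℂ), Module.finrank ℂ W = 2 ∧ L = LinSet W

/-- A smooth plane conic with supporting plane `P(W)`: the zero locus, inside the
projective plane `P(W)`, of a quadric which does not vanish identically on `W`
and whose restriction to `W` has no singular points. -/
def IsConicIn {ι : Type} [Fintype ι] (W : Submodule ℂ (ι → ℂ))
    (C : Set (PPt ι)) : Prop :=
  Module.finrank ℂ W = 3 ∧
  ∃ f : MvPolynomial ι ℂ, f.IsHomogeneous 2 ∧
    C = {x | x.submodule ≤ W ∧ PVanish f x} ∧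
    (∃ v ∈ W, eval v f ≠ 0) ∧
    (∀ v ∈ W, v ≠ 0 → eval v f = 0 →
      ∃ w ∈ W, (∑ i, eval v (pderiv i f) * w i) ≠ 0)

/-- A smooth plane conic in projective space. -/
def IsSmoothConic {ι : Type} [Fintype ι] (C : Set (PPt ι)) : Prop :=
  ∃ W, IsConicIn W C

/-- The Cayley–Bacharach condition `CB(m)`: every degree-`m` hypersurface
containing all points of `S` but one contains all of `S`. -/
def SatisfiesCB {ι : Type} (m : ℕ) (S : Finset (PPt ι)) : Prop :=
  ∀ f : MvPolynomial ι ℂ, f.IsHomogeneous m →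
    ∀ p ∈ S, (∀ q ∈ S, q ≠ p → PVanish f q) → PVanish f p

/-- A smooth projective hypersurface of degree `e`: the partial derivatives of
its (homogeneous) equation have no common nontrivial zero. -/
def IsSmoothHyp {ι : Type} [Fintype ι] (f : MvPolynomial ι ℂ) (e : ℕ) : Prop :=
  f.IsHomogeneous e ∧ f ≠ 0 ∧
    ∀ v : ι → ℂ, v ≠ 0 → ¬ (∀ i, eval v (pderiv i f) = 0)

/-- `{f = g = 0}` is a smooth complete intersection: at every common nontrivial
zero the two gradients are linearly independent. -/
def IsSmoothCI2 {ι : Type} [Fintype ι] (f g : MvPolynomial ι ℂ) : Prop :=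
  ∀ v : ι → ℂ, v ≠ 0 → eval v f = 0 → eval v g = 0 →
    ∀ a b : ℂ, (∀ i, a * eval v (pderiv i f) + b * eval v (pderiv i g) = 0) →
      a = 0 ∧ b = 0

/-- `{f = g = h = 0}` is a smooth complete intersection: at every common
nontrivial zero the three gradients are linearly independent. -/
def IsSmoothCI3 {ι : Type} [Fintype ι] (f g h : MvPolynomial ι ℂ) : Prop :=
  ∀ v : ι → ℂ, v ≠ 0 → eval v f = 0 → eval v g = 0 → eval v h = 0 →
    ∀ a b c : ℂ,
      (∀ i, a * eval v (pderiv i f) + b * eval v (pderiv i g)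
        + c * eval v (pderiv i h) = 0) →
      a = 0 ∧ b = 0 ∧ c = 0

/-- A rational map from (a subvariety of) the projective space with coordinates
`ι` to `ℙ^n`, given by an `(n+1)`-tuple of homogeneous polynomials of a common
degree `e`. -/
structure RatMapTo (ι : Type) (n : ℕ) where
  F : Fin (n + 1) → MvPolynomial ι ℂ
  e : ℕ
  homog : ∀ j, (F j).IsHomogeneous e

namespace RatMapTo

variable {ι : Type} {n : ℕ}

def evalVec (φ : RatMapTo ι n) (v : ι → ℂ) : Fin (n + 1) → ℂ :=
  fun j => eval v (φ.F j)

/-- `φ` is defined at `x` and sends `x` to `y`. -/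
def mapsTo (φ : RatMapTo ι n) (x : PPt ι) (y : PPt (Fin (n + 1))) : Prop :=
  ∀ (v : ι → ℂ) (hv : v ≠ 0), Projectivization.mk ℂ v hv = x →
    ∃ hw : φ.evalVec v ≠ 0, Projectivization.mk ℂ (φ.evalVec v) hw = y

/-- The fiber over `y` of the restriction of `φ` to `X`. -/
def fiber (φ : RatMapTo ι n) (X : Set (PPt ι)) (y : PPt (Fin (n + 1))) :
    Set (PPt ι) :=
  {x ∈ X | φ.mapsTo x y}

/-- The restriction of `φ` to `X` is a dominant rational map of degree `δ`:
the fiber over a general point of `ℙ^n` consists of exactly `δ` points. -/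
def DominantOfDegree (φ : RatMapTo ι n) (X : Set (PPt ι)) (δ : ℕ) : Prop :=
  0 < δ ∧
  ∃ V : Set (PPt (Fin (n + 1))), ContainsDenseOpenOf Set.univ V ∧
    ∀ y ∈ V, (φ.fiber X y).Finite ∧ (φ.fiber X y).ncard = δ

end RatMapTo

/-- The degree of irrationality of `X`: the minimal degree of a dominant
rational map `X ⇢ ℙ^n`. -/
def irr {ι : Type} (n : ℕ) (X : Set (PPt ι)) : ℕ :=
  sInf {δ : ℕ | ∃ φ : RatMapTo ι n, φ.DominantOfDegree X δ}

/-- `ψ` is the linear projection away from the linear subspace `P(W)`: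
it is given by linear forms whose common kernel is exactly `W`. -/
def IsLinearProjectionFrom {ι : Type} {n : ℕ} (ψ : RatMapTo ι n)
    (W : Submodule ℂ (ι → ℂ)) : Prop :=
  ψ.e = 1 ∧ ∀ v : ι → ℂ, ψ.evalVec v = 0 ↔ v ∈ W

/-- The rational maps `φ` and `ψ` on `X` are birationally equivalent: they
differ by composition with a birational automorphism `τ` of the target `ℙ^n`. -/
def BirEquivTo {ι : Type} {n : ℕ} (X : Set (PPt ι)) (φ ψ : RatMapTo ι n) : Prop :=
  ∃ τ : RatMapTo (Fin (n + 1)) n, τ.DominantOfDegree Set.univ 1 ∧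
    ∃ U : Set (PPt ι), ContainsDenseOpenOf X U ∧
      ∀ x ∈ U, ∃ y z, φ.mapsTo x y ∧ ψ.mapsTo x z ∧ τ.mapsTo z y

/-- `A` is contained in a proper Zariski-closed subset of the (projective) space
of degree-`d` forms: it is cut out by a polynomial in the coefficients which is
not identically zero on degree-`d` forms. -/
def CoeffPolyProperClosed {ι : Type} (d : ℕ) (A : Set (MvPolynomial ι ℂ)) : Prop :=
  ∃ (κ : ℕ) (mons : Fin κ → (ι →₀ ℕ)) (Q : MvPolynomial (Fin κ) ℂ),
    (∀ g ∈ A, eval (fun j => coeff (mons j) g) Q = 0) ∧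
    (∃ g : MvPolynomial ι ℂ, g.IsHomogeneous d ∧
      eval (fun j => coeff (mons j) g) Q ≠ 0)

end

set_option linter.all false

namespace CI22
open MvPolynomial
open Polynomial

/-- Setup valuation: basic facts -/
theorem place_basic {Ω k1 : Type*} [Field Ω] [Field k1] [Algebra k1 Ω] (p : Ω)
    (hp : Transcendental k1 p) :
    ∃ O : ValuationSubring Ω, (∀ f : k1[X], O.valuation (aeval p f) ≤ 1) ∧ O.valuation p < 1 ∧
      (∀ f : k1[X], f.coeff 0 ≠ 0 → O.valuation (aeval p f) = 1) ∧
      (∀ f : k1[X], f ≠ 0 → ∃ j : ℕ, O.valuation (aeval p f) = O.valuation p ^ j) := by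
  have hinj : Function.Injective (aeval (R := k1) p) := transcendental_iff_injective.mp hp
  let A : Subring Ω := (aeval (R := k1) p).range.toSubring
  let pA : A := ⟨p, ⟨X, by simp⟩⟩
  have hI : Ideal.span {pA} ≠ ⊤ := by
    intro h
    rw [Ideal.eq_top_iff_one, Ideal.mem_span_singleton'] at h
    obtain ⟨⟨a, ⟨f, hf⟩⟩, ha⟩ := h
    have h2 : a * p = 1 := congrArg Subtype.val ha
    have h3 : aeval p (f * Polynomial.X) = aeval (R := k1) p 1 := by
      simp only [map_mul, Polynomial.aeval_X, map_one]
      exact (congrArg (· * p) hf).trans h2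
    have h4 := hinj h3
    have := congrArg (fun f => Polynomial.coeff f 0) h4
    simp at this
  obtain ⟨O, hO, hO2⟩ := Ideal.image_subset_nonunits_valuationSubring (Ideal.span {pA}) hI
  have h1 : ∀ f : k1[X], O.valuation (aeval p f) ≤ 1 := fun f => by
    rw [ValuationSubring.valuation_le_one_iff]
    exact hO ⟨f, rfl⟩
  have h2 : O.valuation p < 1 := by
    have : p ∈ O.nonunits := hO2 ⟨pA, Ideal.subset_span rfl, rfl⟩
    exact this
  have hc : ∀ r : k1, r ≠ 0 → O.valuation (algebraMap k1 Ω r) = 1 := fun r hr => by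
    have a1 := h1 (C r)
    have a2 := h1 (C r⁻¹)
    simp only [Polynomial.aeval_C, map_inv₀] at a1 a2
    refine le_antisymm a1 ?_
    have hne : O.valuation (algebraMap k1 Ω r) ≠ 0 := by simpa using hr
    exact (inv_le_one₀ (zero_lt_iff.mpr hne)).mp a2
  have h3 : ∀ f : k1[X], f.coeff 0 ≠ 0 → O.valuation (aeval p f) = 1 := fun f hf => by
    have e : aeval p f = aeval p (f.divX) * p + algebraMap k1 Ω (f.coeff 0) := by
      conv_lhs => rw [← f.divX_mul_X_add]
      simp
    rw [e, add_comm, Valuation.map_add_eq_of_lt_left, hc _ hf]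
    rw [hc _ hf, map_mul]
    calc _ ≤ 1 * O.valuation p := mul_le_mul_left (h1 _) _
      _ < 1 := by simpa using h2
  refine ⟨O, h1, h2, h3, ?_⟩
  intro f hf
  obtain ⟨g, hg, hg2⟩ := Polynomial.exists_eq_pow_rootMultiplicity_mul_and_not_dvd f hf 0
  refine ⟨f.rootMultiplicity 0, ?_⟩
  generalize f.rootMultiplicity 0 = j at hg
  have h5 := h3 g (by rw [Ne, ← X_dvd_iff]; simpa using hg2)
  rw [hg, map_mul, map_mul, h5]
  simp

theorem place_arch {Ω k1 : Type*} [Field Ω] [Field k1] [Algebra k1 Ω] (p : Ω)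
    [Algebra k1[X] Ω] (halg : ∀ f : k1[X], algebraMap k1[X] Ω f = aeval p f)
    [Algebra.IsAlgebraic k1[X] Ω] (hinj : Function.Injective (algebraMap k1[X] Ω))
    (O : ValuationSubring Ω) (h1 : ∀ f : k1[X], O.valuation (aeval p f) ≤ 1)
    (h4 : ∀ f : k1[X], f ≠ 0 → ∃ j : ℕ, O.valuation (aeval p f) = O.valuation p ^ j) :
    (∀ z : Ω, IsIntegral k1[X] z → O.valuation z ≤ 1) ∧
    ∀ z : Ω, ∃ c : ℕ, O.valuation (p ^ c * z) ≤ 1 := by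
  have hintg : (∀ z : Ω, IsIntegral k1[X] z → O.valuation z ≤ 1) := by
    rintro z ⟨f, hf, hz⟩
    by_contra hcon
    push Not at hcon
    rw [eval₂_eq_sum_range, Finset.sum_range_succ, hf.coeff_natDegree, map_one, one_mul] at hz
    have hlt : O.valuation (∑ i ∈ Finset.range f.natDegree, (algebraMap k1[X] Ω) (f.coeff i) * z ^ i)
        < O.valuation z ^ f.natDegree := by
      apply Valuation.map_sum_lt
      · exact pow_ne_zero _ (by rintro h; rw [h] at hcon; simp at hcon)
      · intro i hi
        rw [map_mul, map_pow, halg]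
        calc _ ≤ 1 * O.valuation z ^ i := mul_le_mul_left (h1 _) _
          _ < _ := by
            rw [one_mul]; exact pow_lt_pow_right₀ hcon (Finset.mem_range.mp hi)
    have := Valuation.map_add_eq_of_lt_left O.valuation (x := z ^ f.natDegree)
      (y := ∑ i ∈ Finset.range f.natDegree, (algebraMap k1[X] Ω) (f.coeff i) * z ^ i)
      (by rwa [map_pow])
    rw [add_comm, hz, map_zero, map_pow] at this
    rw [← this] at hlt
    simp at hlt
  refine ⟨hintg, fun z => ?_⟩
  obtain ⟨y, hy0, hy⟩ := (Algebra.IsAlgebraic.isAlgebraic (R := k1[X]) z).exists_integral_multiple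
  obtain ⟨j, hj⟩ := h4 y hy0
  refine ⟨j, ?_⟩
  have := hintg _ hy
  rw [Algebra.smul_def, halg, map_mul, hj] at this
  rwa [map_mul, map_pow]
end CI22

namespace CI22
open MvPolynomial
open Polynomial

theorem place_descent {Ω Γ R : Type*} [Field Ω] [Algebra ℂ Ω] [LinearOrderedCommGroupWithZero Γ]
    (v : Valuation Ω Γ) [CommRing R] (ψ : R →+* Ω) (Δ : Derivation ℂ Ω Ω) (t u : R) (e : ℕ) (p c : Ω)
    (hR : ∀ y, v (ψ y) ≤ 1) (ht0 : ψ t ≠ 0) (ht : v (ψ t) < 1)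
    (hm : ∀ y, v (ψ y) < 1 → ∃ z, y = t * z) (hu : v (ψ u) = 1) (he1 : e ≠ 0)
    (hv : v (e : Ω) = 1) (hp : ψ t ^ e * ψ u = p) (hc : v c ≤ 1) (hΔ : Δ p = c * p)
    (hres : ∀ y : R, ∃ (r : Ω) (z : R), v (Δ r) ≤ 1 ∧ ψ y = r + ψ t * ψ z)
    (hb : ∃ n : ℕ, ∀ y, v (ψ t ^ n * Δ (ψ y)) ≤ 1) :
    (∀ y, v (Δ (ψ y)) ≤ 1) ∧ ∀ y, v (ψ y) < 1 → v (Δ (ψ y)) < 1 := by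
  have key : (e : Ω) * ψ u * Δ (ψ t) = ψ t * (c * ψ u - Δ (ψ u)) := by
    obtain ⟨k, rfl⟩ := Nat.exists_eq_succ_of_ne_zero he1
    have := hΔ
    rw [← hp, Derivation.leibniz, Derivation.leibniz_pow] at this
    simp only [smul_eq_mul, Nat.succ_eq_add_one, Nat.add_sub_cancel, nsmul_eq_mul] at this
    apply mul_left_cancel₀ (pow_ne_zero k ht0)
    push_cast at this ⊢
    linear_combination this
  have mul1 : ∀ a b : Ω, v a ≤ 1 → v b ≤ 1 → v (a * b) ≤ 1 := fun a b ha hb => by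
    rw [map_mul]; exact mul_le_one' ha hb
  have mul2 : ∀ a b : Ω, v a < 1 → v b ≤ 1 → v (a * b) < 1 := fun a b ha hb => by
    rw [map_mul]
    calc _ ≤ v a * 1 := by gcongr
      _ < 1 := by simpa using ha
  have vk : v (Δ (ψ t)) = v (ψ t * (c * ψ u - Δ (ψ u))) := by
    rw [← key, map_mul, map_mul, hv, hu]; simp
  have P0 : ∀ y, v (Δ (ψ y)) ≤ 1 := by
    obtain ⟨n, hn⟩ := hb
    induction n with
    | zero => simpa using hn
    | succ n ih =>
      apply ih
      have h1 : v (ψ t ^ n * Δ (ψ t)) ≤ 1 := by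
        rw [map_mul, vk, ← map_mul]
        have : ψ t ^ n * (ψ t * (c * ψ u - Δ (ψ u))) =
          ψ t ^ (n+1) * (c * ψ u) - ψ t ^ (n+1) * Δ (ψ u) := by ring
        rw [this]
        refine (v.map_sub _ _).trans (max_le ?_ (hn u))
        refine mul1 _ _ ?_ (mul1 _ _ hc hu.le)
        rw [map_pow]; exact pow_le_one' ht.le _
      intro y
      obtain ⟨r, z, hr, hy⟩ := hres y
      have : ψ t ^ n * Δ (ψ y) = ψ t ^ n * Δ r + (ψ t ^ n * Δ (ψ t)) * ψ z + ψ t ^ (n+1) * Δ (ψ z) := by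
        rw [hy, map_add, Derivation.leibniz, smul_eq_mul, smul_eq_mul]; ring
      rw [this]
      refine (v.map_add _ _).trans (max_le ((v.map_add _ _).trans (max_le ?_ ?_)) (hn z))
      · refine mul1 _ _ ?_ hr
        rw [map_pow]; exact pow_le_one' ht.le _
      · exact mul1 _ _ h1 (hR _)
  refine ⟨P0, fun y hy => ?_⟩
  have h1 : v (Δ (ψ t)) < 1 := by
    rw [vk]
    exact mul2 _ _ ht ((v.map_sub _ _).trans (max_le (mul1 _ _ hc hu.le) (P0 u)))
  obtain ⟨z, rfl⟩ := hm y hy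
  rw [map_mul, Derivation.leibniz, smul_eq_mul, smul_eq_mul]
  refine (v.map_add _ _).trans_lt (max_lt (mul2 _ _ ht (P0 z)) ?_)
  rw [mul_comm]; exact mul2 _ _ h1 (hR z)
end CI22

namespace CI22
open MvPolynomial
open Polynomial

theorem res_integral {Ω k1 : Type*} [Field Ω] [Field k1] [IsAlgClosed k1] [Algebra k1 Ω] (p : Ω)
    [Algebra k1[X] Ω] (halg : ∀ f : k1[X], algebraMap k1[X] Ω f = aeval p f)
    (O : ValuationSubring Ω) (h1 : ∀ f : k1[X], O.valuation (aeval p f) ≤ 1)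
    (h2 : O.valuation p < 1) (b : Ω) (hb : IsIntegral k1[X] b) (hb1 : O.valuation b ≤ 1) :
    ∃ r : k1, O.valuation (b - algebraMap k1 Ω r) < 1 := by
  obtain ⟨f, hf, hz⟩ := hb
  set v := O.valuation
  let g : k1[X] := f.map Polynomial.constantCoeff
  have hg : g.Monic := hf.map _
  have e1 : v (aeval b g) < 1 := by
    have e2 : aeval b g = aeval b g - eval₂ (algebraMap k1[X] Ω) b f := by rw [hz, sub_zero]
    rw [e2, aeval_eq_sum_range' (n := f.natDegree + 1) (by
      exact Nat.lt_succ_of_le natDegree_map_le),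
      eval₂_eq_sum_range, ← Finset.sum_sub_distrib]
    apply Valuation.map_sum_lt _ one_ne_zero
    intro i hi
    have e3 : f.coeff i = Polynomial.X * (f.coeff i).divX + Polynomial.C ((f.coeff i).coeff 0) := (Polynomial.X_mul_divX_add _).symm
    have e4 : (algebraMap k1[X] Ω (f.coeff i)) = p * aeval p (f.coeff i).divX + algebraMap k1 Ω ((f.coeff i).coeff 0) := by
      rw [halg]
      have := congrArg (Polynomial.aeval p) e3
      rw [this]; simp only [map_add, map_mul, Polynomial.aeval_X, Polynomial.aeval_C]
    have e5 : g.coeff i = (f.coeff i).coeff 0 := by simp [g, Polynomial.coeff_map, constantCoeff_apply]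
    rw [e4, e5, Algebra.smul_def]
    have : (algebraMap k1 Ω) ((f.coeff i).coeff 0) * b ^ i -
        (p * (Polynomial.aeval p) (f.coeff i).divX + (algebraMap k1 Ω) ((f.coeff i).coeff 0)) * b ^ i
        = - (p * ((Polynomial.aeval p) (f.coeff i).divX * b ^ i)) := by ring
    rw [this, Valuation.map_neg, map_mul, map_mul, map_pow]
    calc _ ≤ v p * (1 * 1) := by
          gcongr
          · exact h1 _
          · exact pow_le_one' hb1 _
      _ < 1 := by simpa using h2
  have hsp := (IsAlgClosed.splits g).eq_prod_roots_of_monic hg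
  rw [hsp] at e1
  by_contra hcon
  push Not at hcon
  have : ∀ m : Multiset k1, 1 ≤ v (aeval b (m.map (fun a => Polynomial.X - Polynomial.C a)).prod) := by
    intro m
    induction m using Multiset.induction with
    | empty => simp
    | cons a m ih =>
      simp only [Multiset.map_cons, Multiset.prod_cons, map_mul, map_sub, Polynomial.aeval_X, Polynomial.aeval_C]
      exact one_le_mul (hcon a) ih
  exact absurd e1 (not_lt.mpr (this _))

theorem place_K_core {Ω k1 B : Type*} [Field Ω] [Field k1] [CharZero k1] [Algebra k1 Ω] (p : Ω)
    (O : ValuationSubring Ω) (h1 : ∀ f : k1[X], O.valuation (aeval p f) ≤ 1)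
    (h2 : O.valuation p < 1) (hp0 : p ≠ 0)
    (h3 : ∀ f : k1[X], f.coeff 0 ≠ 0 → O.valuation (aeval p f) = 1)
    (harch : ∀ z : Ω, ∃ c : ℕ, O.valuation (p ^ c * z) ≤ 1)
    [CommRing B] [IsDedekindDomain B] [Algebra k1[X] B] [hfinB : Module.Finite k1[X] B]
    (j : B →+* Ω) (hj : Function.Injective j) (hj1 : ∀ b, O.valuation (j b) ≤ 1)
    (hjres : ∀ b, ∃ r : k1, O.valuation (j b - algebraMap k1 Ω r) < 1)
    (hjX : ∀ f : k1[X], j (algebraMap k1[X] B f) = aeval p f)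
    (x : Ω) (hx : O.valuation x ≤ 1) (hxB : ∃ b c : B, j c ≠ 0 ∧ x * j c = j b) :
    (∃ r : k1, O.valuation (x - algebraMap k1 Ω r) < 1) ∧
    ∀ [Algebra ℂ Ω] (Δ : Derivation ℂ Ω Ω), (∀ r : k1, ∃ r' : k1, Δ (algebraMap k1 Ω r) = algebraMap k1 Ω r') →
      (∃ c : k1, Δ p = algebraMap k1 Ω c * p) → O.valuation (Δ x) ≤ 1 ∧
        (O.valuation x < 1 → O.valuation (Δ x) < 1) := by
  set v := O.valuation with hv
  let P : Ideal B :=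
    { carrier := {b | v (j b) < 1}
      add_mem' := fun {a b} ha hb => by
        simp only [Set.mem_setOf_eq, map_add] at *
        exact (v.map_add _ _).trans_lt (max_lt ha hb)
      zero_mem' := by simp
      smul_mem' := fun c b hb => by
        simp only [Set.mem_setOf_eq, smul_eq_mul, map_mul] at *
        calc _ ≤ 1 * v (j b) := by gcongr; exact hj1 c
          _ < 1 := by simpa using hb }
  have hPmem : ∀ b, b ∈ P ↔ v (j b) < 1 := fun b => Iff.rfl
  have hPp : P.IsPrime := by
    constructor
    · rw [Ne, Ideal.eq_top_iff_one, hPmem]; simp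
    · intro a b hab
      rw [hPmem, map_mul, map_mul] at hab
      by_contra! hcon
      simp only [hPmem, not_lt] at hcon
      exact absurd hab (not_lt.mpr (one_le_mul hcon.1 hcon.2))
  let pB : B := algebraMap k1[X] B X
  have hjp : j pB = p := by rw [hjX]; simp
  have hP0 : P ≠ ⊥ := by
    intro h
    have : pB ∈ P := by rw [hPmem, hjp]; exact h2
    rw [h, Ideal.mem_bot] at this
    rw [this, map_zero] at hjp
    exact hp0 hjp.symm
  let R := Localization.AtPrime P
  have hDVR : IsDiscreteValuationRing R := 
    IsLocalization.AtPrime.isDiscreteValuationRing_of_dedekind_domain B hP0 R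
  have hunit : ∀ y : P.primeCompl, IsUnit (j y) := fun y => by
    rw [isUnit_iff_ne_zero]
    intro h
    apply y.2
    show _ ∈ P
    rw [hPmem, h]; simp
  let ψ : R →+* Ω := IsLocalization.lift hunit
  have hψj : ∀ b, ψ (algebraMap B R b) = j b := fun b => IsLocalization.lift_eq hunit b
  have hψinj : Function.Injective ψ := by
    rw [IsLocalization.lift_injective_iff]
    intro a b
    rw [hj.eq_iff]
    exact (IsLocalization.injective R P.primeCompl_le_nonZeroDivisors).eq_iff
  have hform : ∀ y : R, ∃ b c : B, v (j c) = 1 ∧ ψ y * j c = j b := fun y => by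
    obtain ⟨⟨b, c⟩, hbc⟩ := IsLocalization.surj P.primeCompl y
    refine ⟨b, c, le_antisymm (hj1 _) (not_lt.mp (fun h => c.2 h)), ?_⟩
    rw [← hψj, ← hψj, ← map_mul, hbc]
  have hR : ∀ y, v (ψ y) ≤ 1 := fun y => by
    obtain ⟨b, c, hc, h⟩ := hform y
    have := congrArg v h
    rw [map_mul, hc, mul_one] at this
    rw [this]; exact hj1 _
  have hRmem : ∀ y, y ∈ IsLocalRing.maximalIdeal R ↔ v (ψ y) < 1 := by
    intro y
    rw [IsLocalRing.mem_maximalIdeal, mem_nonunits_iff]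
    constructor
    · intro hy
      by_contra hcon
      apply hy
      obtain ⟨⟨b, c⟩, hbc⟩ := IsLocalization.surj P.primeCompl y
      have h5 : ψ y * j c = j b := by rw [← hψj, ← hψj, ← map_mul, hbc]
      have hb : b ∈ P.primeCompl := by
        intro hb
        have hb' : v (j b) < 1 := hb
        rw [← h5, map_mul] at hb'
        have : 1 ≤ v (j c) := not_lt.mp (fun h => c.2 h)
        exact absurd hb' (not_lt.mpr (one_le_mul (not_lt.mp hcon) this))
      have : IsUnit (algebraMap B R b) := IsLocalization.map_units R (⟨b, hb⟩ : P.primeCompl)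
      rw [← hbc] at this
      exact isUnit_of_mul_isUnit_left this
    · intro hy hu
      obtain ⟨w, hw⟩ := hu.exists_right_inv
      have h6 := congrArg (fun z => v (ψ z)) hw
      simp only [map_mul, map_one] at h6
      have : v (ψ y) * v (ψ w) < 1 := by
        calc _ ≤ v (ψ y) * 1 := by gcongr; exact hR w
          _ < 1 := by simpa using hy
      rw [h6] at this
      exact lt_irrefl _ this
  have hsurj : ∃ y, ψ y = x := by
    obtain ⟨b, c, hc0, hx1⟩ := hxB
    rcases ValuationRing.dvd_total (algebraMap B R c) (algebraMap B R b) with ⟨y, hy⟩ | ⟨y, hy⟩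
    · refine ⟨y, ?_⟩
      have := congrArg ψ hy
      rw [map_mul, hψj, hψj, ← hx1] at this
      apply mul_left_cancel₀ hc0
      rw [← this, mul_comm]
    · have := congrArg ψ hy
      rw [map_mul, hψj, hψj, ← hx1] at this
      have h7 : x * ψ y = 1 := by
        apply mul_left_cancel₀ hc0
        linear_combination -this
      have hyu : IsUnit y := by
        by_contra hcon
        have h8 := (hRmem y).mp hcon
        have h9 := congrArg v h7
        rw [map_mul, map_one] at h9
        have : v x * v (ψ y) < 1 := by
          calc _ ≤ 1 * v (ψ y) := by gcongr
            _ < 1 := by simpa using h8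
        rw [h9] at this
        exact lt_irrefl _ this
      obtain ⟨w, hw⟩ := hyu.exists_right_inv
      refine ⟨w, ?_⟩
      have h6 := congrArg ψ hw
      rw [map_mul, map_one] at h6
      calc ψ w = x * ψ y * ψ w := by rw [h7, one_mul]
        _ = x := by rw [mul_assoc, h6, mul_one]
  have hresR : ∀ y : R, ∃ r : k1, v (ψ y - algebraMap k1 Ω r) < 1 := fun y => by
    obtain ⟨b, c, hc, h⟩ := hform y
    obtain ⟨r, hr⟩ := hjres b
    obtain ⟨r', hr'⟩ := hjres c
    have hr0 : r' ≠ 0 := by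
      rintro rfl
      simp only [map_zero, sub_zero] at hr'
      exact absurd hr' (by rw [hc]; exact lt_irrefl _)
    refine ⟨r / r', ?_⟩
    have hr0' : algebraMap k1 Ω r' ≠ 0 := by simpa using hr0
    have e : (ψ y - algebraMap k1 Ω (r / r')) * j c =
        (j b - algebraMap k1 Ω r) - algebraMap k1 Ω (r / r') * (j c - algebraMap k1 Ω r') := by
      rw [sub_mul, h, map_div₀]; field_simp; ring
    have : v (ψ y - algebraMap k1 Ω (r / r')) = v (ψ y - algebraMap k1 Ω (r / r')) * v (j c) := by
      rw [hc, mul_one]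
    rw [this, ← map_mul, e]
    refine (v.map_sub _ _).trans_lt (max_lt hr ?_)
    rw [map_mul]
    have hh := h1 (C (r / r'))
    rw [Polynomial.aeval_C] at hh
    calc _ ≤ 1 * v (j c - algebraMap k1 Ω r') := by gcongr
      _ < 1 := by rw [one_mul]; exact hr'
  obtain ⟨x', hx'⟩ := hsurj
  refine ⟨hx' ▸ hresR x', ?_⟩
  intro _ Δ hΔ1 hΔ2
  obtain ⟨c, hc⟩ := hΔ2
  obtain ⟨t, ht⟩ := IsDiscreteValuationRing.exists_irreducible R
  have htmax : IsLocalRing.maximalIdeal R = Ideal.span {t} := ht.maximalIdeal_eq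
  have hm : ∀ y, v (ψ y) < 1 → ∃ z, y = t * z := fun y hy => by
    rw [← hRmem, htmax, Ideal.mem_span_singleton] at hy
    exact hy
  have ht1 : v (ψ t) < 1 := by
    rw [← hRmem, htmax]; exact Ideal.mem_span_singleton_self t
  have hpB0 : algebraMap B R pB ≠ 0 := by
    intro h
    apply hp0
    rw [← hjp, ← hψj, h, map_zero]
  obtain ⟨e, u, hu⟩ := IsDiscreteValuationRing.eq_unit_mul_pow_irreducible hpB0 ht
  have hup : ψ t ^ e * ψ u = p := by
    rw [← hjp, ← hψj, hu, map_mul, map_pow, mul_comm]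
  have hvu : v (ψ u) = 1 := by
    refine le_antisymm (hR _) (not_lt.mp fun h => ?_)
    rw [← hRmem] at h
    exact h u.isUnit
  have hkc : ∀ r : k1, v (algebraMap k1 Ω r) ≤ 1 := fun r => by
    have := h1 (C r); rwa [Polynomial.aeval_C] at this
  have he : e ≠ 0 := by
    rintro rfl
    rw [pow_zero, one_mul] at hup
    rw [hup] at hvu
    exact absurd h2 (by rw [hvu]; exact lt_irrefl _)
  have hve : v (e : Ω) = 1 := by
    have := h3 (C (e : k1)) (by simpa using he)
    simpa using this
  have hbd : ∃ n : ℕ, ∀ y, v (ψ t ^ n * Δ (ψ y)) ≤ 1 := by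
    obtain ⟨S, hS⟩ := hfinB.fg_top
    choose cc hcc using fun b : B => harch (Δ (j b))
    let N := S.sup cc
    have hvp1 : ∀ n, v p ^ n ≤ 1 := fun n => pow_le_one' h2.le _
    have hA : ∀ f : k1[X], v (Δ (aeval p f)) ≤ 1 := fun f => by
      induction f using Polynomial.induction_on' with
      | add a b ha hb => rw [map_add, map_add]; exact (v.map_add _ _).trans (max_le ha hb)
      | monomial n a =>
        rw [Polynomial.aeval_monomial, Derivation.leibniz, Derivation.leibniz_pow, hc]
        simp only [smul_eq_mul, nsmul_eq_mul]
        obtain ⟨r', hr'⟩ := hΔ1 a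
        rw [hr']
        refine (v.map_add _ _).trans (max_le ?_ ?_)
        · rw [map_mul]
          refine mul_le_one' (hkc _) ?_
          rw [map_mul, map_mul, map_mul, map_pow]
          refine mul_le_one' ?_ (mul_le_one' (hvp1 _) (mul_le_one' (hkc _) h2.le))
          have := hkc (n : k1)
          simpa using this
        · rw [map_mul, map_pow]; exact mul_le_one' (hvp1 _) (hkc _)
    have hB : ∀ b : B, v (p ^ N * Δ (j b)) ≤ 1 := fun b => by
      have hb : b ∈ Submodule.span k1[X] (S : Set B) := hS ▸ Submodule.mem_top
      induction hb using Submodule.span_induction with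
      | mem b hb =>
        have : cc b ≤ N := Finset.le_sup hb
        rw [← Nat.sub_add_cancel this, pow_add, mul_assoc, map_mul, map_pow]
        exact mul_le_one' (hvp1 _) (hcc b)
      | zero => simp
      | add a b _ _ ha hb =>
        rw [map_add, map_add, mul_add]; exact (v.map_add _ _).trans (max_le ha hb)
      | smul f b _ hb =>
        rw [Algebra.smul_def, map_mul j, hjX, Derivation.leibniz, smul_eq_mul, smul_eq_mul, mul_add]
        refine (v.map_add _ _).trans (max_le ?_ ?_)
        · rw [mul_left_comm, map_mul]; exact mul_le_one' (h1 _) hb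
        · rw [map_mul, map_mul, map_pow]
          exact mul_le_one' (hvp1 _) (mul_le_one' (hj1 _) (hA f))
    refine ⟨e * N, fun y => ?_⟩
    have e0 : ψ t ^ (e * N) * ψ u ^ N = p ^ N := by rw [pow_mul, ← mul_pow, hup]
    have e1 : v (ψ t ^ (e * N) * Δ (ψ y)) = v (p ^ N * Δ (ψ y)) := by
      rw [← e0, map_mul, map_mul, map_mul, map_pow v (ψ u), hvu]; simp
    rw [e1]
    obtain ⟨b, c', hc', h⟩ := hform y
    have e2 : (p ^ N * Δ (ψ y)) * j c' = p ^ N * Δ (j b) - ψ y * (p ^ N * Δ (j c')) := by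
      rw [← h, Derivation.leibniz, smul_eq_mul, smul_eq_mul]; ring
    have e3 : v (p ^ N * Δ (ψ y)) = v ((p ^ N * Δ (ψ y)) * j c') := by
      rw [map_mul v _ (j c'), hc', mul_one]
    rw [e3, e2]
    refine (v.map_sub _ _).trans (max_le (hB b) ?_)
    rw [map_mul]; exact mul_le_one' (hR y) (hB c')
  have ht0 : ψ t ≠ 0 := by
    rw [Ne, map_eq_zero_iff ψ hψinj]; exact ht.ne_zero
  have := place_descent v ψ Δ t u e p (algebraMap k1 Ω c) hR ht0 ht1 hm hvu he hve hup (hkc _) hc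
    (fun y => by
      obtain ⟨r, hr⟩ := hresR y
      obtain ⟨r', hr'⟩ := hΔ1 r
      have hrr : ψ (algebraMap B R (algebraMap k1[X] B (C r))) = algebraMap k1 Ω r := by
        rw [hψj, hjX, Polynomial.aeval_C]
      rw [← hrr, ← map_sub] at hr
      obtain ⟨z, hz⟩ := hm _ hr
      refine ⟨algebraMap k1 Ω r, z, by rw [hr']; exact hkc _, ?_⟩
      rw [← map_mul, ← hz, map_sub, hrr]; ring) hbd
  rw [← hx']
  exact ⟨this.1 x', this.2 x'⟩

theorem place_K {Ω k1 : Type*} [Field Ω] [Field k1] [IsAlgClosed k1] [CharZero k1] [Algebra k1 Ω] (p : Ω)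
    [Algebra k1[X] Ω] (halg : ∀ f : k1[X], algebraMap k1[X] Ω f = aeval p f)
    [Algebra.IsAlgebraic k1[X] Ω] (hinj : Function.Injective (algebraMap k1[X] Ω))
    [Algebra (FractionRing k1[X]) Ω] [hst : IsScalarTower k1[X] (FractionRing k1[X]) Ω]
    (O : ValuationSubring Ω) (h1 : ∀ f : k1[X], O.valuation (aeval p f) ≤ 1)
    (h2 : O.valuation p < 1)
    (h3 : ∀ f : k1[X], f.coeff 0 ≠ 0 → O.valuation (aeval p f) = 1)
    (h4 : ∀ f : k1[X], f ≠ 0 → ∃ j : ℕ, O.valuation (aeval p f) = O.valuation p ^ j) (x : Ω)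
    (hx : O.valuation x ≤ 1) :
    (∃ r : k1, O.valuation (x - algebraMap k1 Ω r) < 1) ∧
    ∀ [Algebra ℂ Ω] (Δ : Derivation ℂ Ω Ω), (∀ r : k1, ∃ r' : k1, Δ (algebraMap k1 Ω r) = algebraMap k1 Ω r') →
      (∃ c : k1, Δ p = algebraMap k1 Ω c * p) → O.valuation (Δ x) ≤ 1 ∧
        (O.valuation x < 1 → O.valuation (Δ x) < 1) := by
  obtain ⟨hintg, harch⟩ := place_arch p halg hinj O h1 h4
  let L := IntermediateField.adjoin (FractionRing k1[X]) {x}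
  have : Algebra.IsAlgebraic (FractionRing k1[X]) Ω := Algebra.IsAlgebraic.extendScalars (R := k1[X]) (IsFractionRing.injective k1[X] (FractionRing k1[X]))
  have hfin : FiniteDimensional (FractionRing k1[X]) L := IntermediateField.adjoin.finiteDimensional (Algebra.IsAlgebraic.isAlgebraic x).isIntegral
  have hst2 : IsScalarTower k1[X] L Ω := IsScalarTower.of_algebraMap_eq fun f => by
    rw [IsScalarTower.algebraMap_apply k1[X] (FractionRing k1[X]) Ω,
      IsScalarTower.algebraMap_apply k1[X] (FractionRing k1[X]) L]; rfl
  let B := integralClosure k1[X] L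
  have : IsFractionRing B L := integralClosure.isFractionRing_of_finite_extension (FractionRing k1[X]) L
  have : IsDedekindDomain B := integralClosure.isDedekindDomain k1[X] (FractionRing k1[X]) L
  have hfinB : Module.Finite k1[X] B := IsIntegralClosure.finite k1[X] (FractionRing k1[X]) L B
  let j : B →+* Ω := (algebraMap L Ω).comp (algebraMap B L)
  have hj : Function.Injective j := (algebraMap L Ω).injective.comp (IsFractionRing.injective B L)
  have hjint : ∀ b, IsIntegral k1[X] (j b) := fun b => by
    have : IsIntegral k1[X] (b : L) := b.2
    exact this.map (IsScalarTower.toAlgHom k1[X] L Ω)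
  have hj1 : ∀ b, O.valuation (j b) ≤ 1 := fun b => hintg _ (hjint b)
  have hjX : ∀ f : k1[X], j (algebraMap k1[X] B f) = aeval p f := fun f => by
    rw [← halg]
    show algebraMap L Ω (algebraMap B L (algebraMap k1[X] B f)) = _
    rw [← IsScalarTower.algebraMap_apply k1[X] B L, ← IsScalarTower.algebraMap_apply k1[X] L Ω]
  have hp0 : p ≠ 0 := by
    intro h
    have := hinj (a₁ := X) (a₂ := 0) (by rw [halg, Polynomial.aeval_X, h, map_zero])
    exact X_ne_zero this
  refine place_K_core p O h1 h2 hp0 h3 harch j hj hj1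
    (fun b => res_integral p halg O h1 h2 (j b) (hjint b) (hj1 b)) hjX x hx ?_
  let xL : L := ⟨x, IntermediateField.mem_adjoin_simple_self (FractionRing k1[X]) x⟩
  obtain ⟨b, c, hc, hbc⟩ := IsFractionRing.div_surjective (A := B) xL
  have hc0 : j c ≠ 0 := by
    intro h
    exact nonZeroDivisors.ne_zero hc (hj (by rw [h, map_zero]))
  refine ⟨b, c, hc0, ?_⟩
  have : algebraMap L Ω xL = x := rfl
  rw [← this, ← hbc, map_div₀]
  exact div_mul_cancel₀ _ hc0
end CI22

namespace CI22
open MvPolynomial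
open Polynomial

/-- A field with two commuting derivations dual to generators of its rational subfield. -/
structure Frame (Ω : Type) [Field Ω] [Algebra ℂ Ω] where
  s : Ω
  t : Ω
  ds : Derivation ℂ Ω Ω
  dt : Derivation ℂ Ω Ω
  ds_s : ds s = 1
  ds_t : ds t = 0
  dt_s : dt s = 0
  dt_t : dt t = 1
  alg : Algebra.IsAlgebraic (IntermediateField.adjoin ℂ {s, t}) Ω

variable {Ω : Type} [Field Ω] [Algebra ℂ Ω]

def Frame.swap (fr : Frame Ω) : Frame Ω where
  s := fr.t
  t := fr.s
  ds := fr.dt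
  dt := fr.ds
  ds_s := fr.dt_t
  ds_t := fr.dt_s
  dt_s := fr.ds_t
  dt_t := fr.ds_s
  alg := by rw [Set.pair_comm]; exact fr.alg

theorem der_alg {Δ : Derivation ℂ Ω Ω} (F : IntermediateField ℂ Ω) (hF : ∀ x ∈ F, Δ x = 0) (x : Ω)
    (hx : IsAlgebraic F x) : Δ x = 0 := by
  have : CharZero Ω := charZero_of_injective_algebraMap (algebraMap ℂ Ω).injective
  have : CharZero F := charZero_of_injective_algebraMap (algebraMap ℂ F).injective
  have hi := hx.isIntegral
  have hsep : (minpoly F x).Separable := (minpoly.irreducible hi).separable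
  have key : ∀ f : F[X], Δ (aeval x f) = aeval x (derivative f) * Δ x := fun f => by
    induction f using Polynomial.induction_on' with
    | add a b ha hb => simp only [map_add, ha, hb, add_mul]
    | monomial n a =>
      rw [Polynomial.aeval_monomial, Derivation.leibniz, Derivation.leibniz_pow, Polynomial.derivative_monomial, Polynomial.aeval_monomial]
      have : Δ (algebraMap F Ω a) = 0 := hF _ a.2
      rw [this]
      simp
      ring
  have h1 := key (minpoly F x)
  rw [minpoly.aeval, map_zero] at h1
  have h2 : aeval x (derivative (minpoly F x)) ≠ 0 := hsep.aeval_derivative_ne_zero (minpoly.aeval _ _)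
  exact (mul_eq_zero.mp h1.symm).resolve_left h2

def constF (Δ : Derivation ℂ Ω Ω) : IntermediateField ℂ Ω where
  carrier := {x | Δ x = 0}
  mul_mem' := fun {a b} ha hb => by
    simp only [Set.mem_setOf_eq] at *; rw [Derivation.leibniz, ha, hb]; simp
  one_mem' := by simp
  add_mem' := fun {a b} ha hb => by simp only [Set.mem_setOf_eq] at *; rw [map_add, ha, hb, add_zero]
  zero_mem' := by simp
  algebraMap_mem' := fun r => by simp
  inv_mem' := fun x hx => by
    simp only [Set.mem_setOf_eq] at *; rw [Derivation.leibniz_inv, hx]; simp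

theorem mem_constF {Δ : Derivation ℂ Ω Ω} {x : Ω} : x ∈ constF Δ ↔ Δ x = 0 := Iff.rfl

instance constF_closed [IsAlgClosed Ω] (Δ : Derivation ℂ Ω Ω) : IsAlgClosed (constF Δ) := by
  apply IsAlgClosed.of_exists_root
  intro p hp hirr
  obtain ⟨x, hx⟩ := IsAlgClosed.exists_aeval_eq_zero Ω p (hirr.degree_pos.ne')
  have : Δ x = 0 := der_alg (constF Δ) (fun _ h => h) x ⟨p, hp.ne_zero, hx⟩
  refine ⟨⟨x, this⟩, ?_⟩
  apply (algebraMap (constF Δ) Ω).injective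
  rw [map_zero, ← hx, ← Polynomial.aeval_algebraMap_apply_eq_algebraMap_eval]
  rfl

theorem Frame.der_zero (fr : Frame Ω) (Δ : Derivation ℂ Ω Ω) (h1 : Δ fr.s = 0) (h2 : Δ fr.t = 0) : Δ = 0 := by
  ext x
  have hle : IntermediateField.adjoin ℂ {fr.s, fr.t} ≤ constF Δ := by
    rw [IntermediateField.adjoin_le_iff]
    rintro y (rfl | rfl)
    · exact h1
    · exact h2
  exact der_alg _ (fun y hy => hle hy) x (fr.alg.isAlgebraic x)

theorem Frame.comm (fr : Frame Ω) (x : Ω) : fr.ds (fr.dt x) = fr.dt (fr.ds x) := by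
  have := fr.der_zero ⁅fr.ds, fr.dt⁆ (by simp [Derivation.commutator_apply, fr.ds_s, fr.dt_s])
    (by simp [Derivation.commutator_apply, fr.ds_t, fr.dt_t])
  have h := congrArg (fun D : Derivation ℂ Ω Ω => D x) this
  simp only [Derivation.commutator_apply, Derivation.coe_zero, Pi.zero_apply] at h
  exact sub_eq_zero.mp h

structure Place (fr : Frame Ω) where
  O : ValuationSubring Ω
  e : Ω
  b : Ω
  kval : ∀ r, fr.ds r = 0 → r ≠ 0 → O.valuation r = 1
  res : ∀ x, O.valuation x ≤ 1 → ∃ r, fr.ds r = 0 ∧ O.valuation (x - r) < 1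
  Eint : ∀ x, O.valuation x ≤ 1 → O.valuation (e * fr.ds x) < 1
  Dint : ∀ x, O.valuation x ≤ 1 → O.valuation (fr.dt x + b * fr.ds x) ≤ 1

theorem exists_place [IsAlgClosed Ω] (fr : Frame Ω) (p e b : Ω) (hp : fr.ds p ≠ 0)
    (hs : fr.s ∈ IntermediateField.adjoin (constF fr.ds) {p})
    (hEp : ∃ c ∈ constF fr.ds, e * fr.ds p = c * p) (hDp : fr.dt p + b * fr.ds p = 0) 
    (hb : fr.ds b = 0) :
    ∃ P : Place fr, P.e = e ∧ P.b = b ∧ 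
      P.O.valuation p < 1 ∧ ∀ f : (constF fr.ds)[X], P.O.valuation (aeval p f) ≤ 1 ∧
       (f.coeff 0 ≠ 0 → P.O.valuation (aeval p f) = 1) := by
  let k1 := constF fr.ds
  have htr : Transcendental k1 p := fun h => hp (der_alg k1 (fun _ h => h) p h)
  have hinj : Function.Injective (aeval (R := k1) p) := transcendental_iff_injective.mp htr
  have hc0 : CharZero k1 := charZero_of_injective_algebraMap (algebraMap ℂ k1).injective
  letI : Algebra k1[X] Ω := (aeval (R := k1) p).toAlgebra
  have halg : ∀ f : k1[X], algebraMap k1[X] Ω f = aeval p f := fun f => rfl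
  letI : Algebra (FractionRing k1[X]) Ω := (IsFractionRing.lift (A := k1[X]) (K := FractionRing k1[X]) 
    (g := algebraMap k1[X] Ω) hinj).toAlgebra
  haveI : IsScalarTower k1[X] (FractionRing k1[X]) Ω := IsScalarTower.of_algebraMap_eq fun f =>
    (IsFractionRing.lift_algebraMap (A := k1[X]) (K := FractionRing k1[X]) (g := algebraMap k1[X] Ω) hinj f).symm
  haveI : Algebra.IsAlgebraic k1[X] Ω := by
    refine ⟨fun x => ?_⟩
    rw [IsFractionRing.isAlgebraic_iff k1[X] (FractionRing k1[X]) Ω]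
    let G : Subfield Ω := (algebraMap (FractionRing k1[X]) Ω).fieldRange
    have hGc : ∀ r : k1, (r : Ω) ∈ G := fun r =>
      ⟨algebraMap k1[X] _ (C r), by
        rw [← IsScalarTower.algebraMap_apply, halg, Polynomial.aeval_C]; rfl⟩
    have hGp : p ∈ G := ⟨algebraMap k1[X] _ X, by
        rw [← IsScalarTower.algebraMap_apply, halg, Polynomial.aeval_X]⟩
    let G' : IntermediateField k1 Ω := { G with algebraMap_mem' := hGc }
    have hGs : fr.s ∈ G := by
      have : IntermediateField.adjoin k1 {p} ≤ G' := by
        rw [IntermediateField.adjoin_le_iff]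
        rintro y rfl
        exact hGp
      exact this hs
    let G'' : IntermediateField ℂ Ω := { G with algebraMap_mem' := fun z => hGc (algebraMap ℂ k1 z) }
    have hle : IntermediateField.adjoin ℂ {fr.s, fr.t} ≤ G'' := by
      rw [IntermediateField.adjoin_le_iff]
      rintro y (rfl | rfl)
      · exact hGs
      · exact hGc ⟨fr.t, fr.ds_t⟩
    obtain ⟨f, hf, hx⟩ := fr.alg.isAlgebraic x
    have hex : ∀ y : IntermediateField.adjoin ℂ {fr.s, fr.t}, ∃ z, algebraMap (FractionRing k1[X]) Ω z = y :=
      fun y => hle y.2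
    have hinjF := (algebraMap (FractionRing k1[X]) Ω).injective
    let eq1 : FractionRing k1[X] ≃+* G := RingEquiv.ofBijective (algebraMap (FractionRing k1[X]) Ω).rangeRestrictField
      ⟨fun a b h => hinjF (congrArg Subtype.val h), (algebraMap (FractionRing k1[X]) Ω).rangeRestrictField_bijective.2⟩
    let i1 : IntermediateField.adjoin ℂ {fr.s, fr.t} →+* G := (IntermediateField.inclusion hle).toRingHom
    let i2 := eq1.symm.toRingHom.comp i1
    have hi2 : ∀ y, algebraMap (FractionRing k1[X]) Ω (i2 y) = y := fun y => by
      have : (eq1 (i2 y) : Ω) = (i1 y : Ω) := by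
        simp [i2]
      exact this
    refine ⟨f.map i2, (Polynomial.map_ne_zero_iff i2.injective).mpr hf, ?_⟩
    rw [← hx, Polynomial.aeval_def, Polynomial.aeval_def, Polynomial.eval₂_map]
    congr 1
    ext y
    exact hi2 y
  obtain ⟨O, h1, h2, h3, h4⟩ := place_basic (k1 := k1) p htr
  have hK := place_K (k1 := k1) p halg hinj O h1 h2 h3 h4
  have hk1 : ∀ r : k1, O.valuation (r : Ω) ≤ 1 := fun r => by
    have := h1 (C r); rw [Polynomial.aeval_C] at this; exact this
  let E : Derivation ℂ Ω Ω := e • fr.ds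
  let D : Derivation ℂ Ω Ω := fr.dt + b • fr.ds
  have hE : ∀ x, E x = e * fr.ds x := fun x => rfl
  have hD : ∀ x, D x = fr.dt x + b * fr.ds x := fun x => rfl
  have hDk : ∀ r : k1, fr.ds (D r) = 0 := fun r => by
    have hr : fr.ds r = 0 := r.2
    rw [hD, map_add, Derivation.leibniz, fr.comm, hr]; simp
  refine ⟨⟨O, e, b, ?_, ?_, ?_, ?_⟩, rfl, rfl, h2, fun f => ⟨h1 f, h3 f⟩⟩
  · intro r hr hr0
    have := h3 (C ⟨r, hr⟩) (by simpa using fun h => hr0 (congrArg Subtype.val h))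
    rw [Polynomial.aeval_C] at this; exact this
  · intro x hx
    obtain ⟨r, hr⟩ := (hK x hx).1
    exact ⟨r, r.2, hr⟩
  · intro x hx
    obtain ⟨r, hr⟩ := (hK x hx).1
    obtain ⟨c, hc, hc2⟩ := hEp
    have h5 := ((hK (x - r) (hr.le)).2 E (fun r => ⟨0, by
      have : fr.ds (r : Ω) = 0 := r.2
      show e * fr.ds (r : Ω) = _
      rw [this]; simp⟩) ⟨⟨c, hc⟩, hc2⟩).2 hr
    have hr2 : fr.ds (r : Ω) = 0 := r.2
    rw [map_sub, hE, hE, hr2, mul_zero, sub_zero] at h5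
    exact h5
  · intro x hx
    have h5 := ((hK x hx).2 D (fun r => ⟨⟨D r, hDk r⟩, rfl⟩) ⟨0, by rw [map_zero, zero_mul]; exact hDp⟩).1
    exact h5
end CI22

namespace CI22
open MvPolynomial
open Polynomial
variable {Ω : Type} [Field Ω] [Algebra ℂ Ω]

theorem rational_zero [IsAlgClosed Ω] (fr : Frame Ω) (T : Ω)
    (hT : T ∈ IntermediateField.adjoin ℂ {fr.s, fr.t})
    (h : ∀ P : Place fr, P.O.valuation (P.e * T) < 1) : T = 0 := by
  let k1 := constF fr.ds
  have hs0 : fr.s ≠ 0 := by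
    intro h0; have := fr.ds_s; rw [h0] at this; simp at this
  have hT2 : T ∈ IntermediateField.adjoin k1 {fr.s} := by
    have : IntermediateField.adjoin ℂ {fr.s, fr.t} ≤ (IntermediateField.adjoin k1 {fr.s}).restrictScalars ℂ := by
      rw [IntermediateField.adjoin_le_iff]
      rintro y (rfl | rfl)
      · exact IntermediateField.mem_adjoin_simple_self k1 _
      · exact (IntermediateField.adjoin k1 {fr.s}).algebraMap_mem ⟨fr.t, fr.ds_t⟩
    exact this hT
  rw [IntermediateField.mem_adjoin_simple_iff] at hT2
  obtain ⟨f, g, hfg⟩ := hT2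
  by_cases hT0 : T = 0
  · exact hT0
  exfalso
  have hg0 : g ≠ 0 := by rintro rfl; simp at hfg; exact hT0 hfg
  have htr : Transcendental k1 fr.s := fun h => by
    have := der_alg k1 (fun _ h => h) fr.s h
    rw [fr.ds_s] at this; exact one_ne_zero this
  have hinj : Function.Injective (aeval (R := k1) fr.s) := transcendental_iff_injective.mp htr
  -- make coprime
  obtain ⟨P, Q, hPQ, hcop, hQ0⟩ : ∃ P Q : k1[X], T * aeval fr.s Q = aeval fr.s P ∧ IsCoprime P Q ∧ Q ≠ 0 := by
    classical
    obtain ⟨f', g', hf', hg'⟩ : ∃ f' g' : k1[X], f = EuclideanDomain.gcd f g * f' ∧ g = EuclideanDomain.gcd f g * g' :=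
      ⟨_, _, (EuclideanDomain.gcd_dvd_left f g).choose_spec, (EuclideanDomain.gcd_dvd_right f g).choose_spec⟩
    have hd : EuclideanDomain.gcd f g ≠ 0 := fun h0 => by
      rw [h0, zero_mul] at hg'; exact hg0 hg'
    refine ⟨f', g', ?_, ?_, ?_⟩
    · have hgs : aeval fr.s g ≠ 0 := fun h0 => hg0 (hinj (by rw [h0, map_zero]))
      have hds : aeval fr.s (EuclideanDomain.gcd f g) ≠ 0 := fun h0 => hd (hinj (by rw [h0, map_zero]))
      apply mul_left_cancel₀ hds
      rw [mul_left_comm, ← map_mul, ← map_mul, ← hf', ← hg', hfg, div_mul_cancel₀ _ hgs]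
    · have hb := EuclideanDomain.gcd_eq_gcd_ab f g
      refine ⟨EuclideanDomain.gcdA f g, EuclideanDomain.gcdB f g, ?_⟩
      apply mul_left_cancel₀ hd
      conv_rhs => rw [mul_one, hb]
      linear_combination (-EuclideanDomain.gcdA f g) * hf' - EuclideanDomain.gcdB f g * hg'
    · rintro rfl
      rw [mul_zero] at hg'; exact hg0 hg'
  have hroot : ∀ a : k1, ¬ Q.IsRoot a := by
    intro a ha
    have ha0 : fr.ds (a : Ω) = 0 := a.2
    obtain ⟨pl, he, hb, hv, hf⟩ := exists_place fr (fr.s - a) (fr.s - a) (fr.dt a) (by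
      rw [map_sub, fr.ds_s, ha0, sub_zero]; exact one_ne_zero) (by
      have h1 := IntermediateField.mem_adjoin_simple_self k1 (fr.s - (a : Ω))
      have h2 := (IntermediateField.adjoin k1 {fr.s - (a : Ω)}).algebraMap_mem a
      have := add_mem h1 h2
      simpa using this) ⟨1, by simp [mem_constF], by rw [map_sub, fr.ds_s, ha0]; ring⟩
      (by rw [map_sub, map_sub, fr.ds_s, ha0, fr.dt_s]; ring) (by rw [fr.comm, ha0, map_zero])
    have hcomp : ∀ F : k1[X], aeval fr.s F = aeval (fr.s - (a : Ω)) (F.comp (Polynomial.X + Polynomial.C a)) := fun F => by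
      rw [aeval_comp]; simp
    have hPa : P.eval a ≠ 0 := by
      intro h0
      obtain ⟨u, w, huw⟩ := hcop
      have := congrArg (Polynomial.eval a) huw
      rw [Polynomial.eval_add, Polynomial.eval_mul, Polynomial.eval_mul, h0, ha] at this
      simp at this
    have hvP : pl.O.valuation (aeval fr.s P) = 1 := by
      rw [hcomp]
      apply (hf _).2
      rw [coeff_zero_eq_eval_zero, eval_comp]; simpa using hPa
    obtain ⟨Q', hQ'⟩ := dvd_iff_isRoot.mpr ha
    have hvT := h pl
    rw [he] at hvT
    have e3 : aeval fr.s Q = (fr.s - a) * aeval fr.s Q' := by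
      rw [hQ', map_mul]; simp
    rw [e3, ← mul_assoc, mul_comm T] at hPQ
    rw [← hPQ, map_mul] at hvP
    have hQv : pl.O.valuation (aeval fr.s Q') ≤ 1 := by rw [hcomp]; exact (hf _).1
    have : pl.O.valuation ((fr.s - a) * T) * pl.O.valuation (aeval fr.s Q') < 1 := by
      calc _ ≤ pl.O.valuation ((fr.s - a) * T) * 1 := by gcongr
        _ < 1 := by simpa using hvT
    rw [hvP] at this
    exact lt_irrefl _ this
  have hQd : Q.degree = 0 := by
    by_contra hd
    obtain ⟨a, ha⟩ := IsAlgClosed.exists_root Q hd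
    exact hroot a ha
  rw [eq_C_of_degree_eq_zero hQd, Polynomial.aeval_C] at hPQ
  set q := Q.coeff 0
  have hq0 : q ≠ 0 := fun h0 => by
    rw [eq_C_of_degree_eq_zero hQd] at hQ0; exact hQ0 (by rw [show Q.coeff 0 = 0 from h0]; simp)
  have hdinv : fr.ds fr.s⁻¹ = - (fr.s⁻¹)^2 := by rw [Derivation.leibniz_inv, fr.ds_s]; simp
  obtain ⟨pl, he, hb, hv, hf⟩ := exists_place fr (fr.s⁻¹) fr.s 0 (by
      rw [hdinv]; simpa using hs0) (by
      have h1 := IntermediateField.mem_adjoin_simple_self k1 (fr.s⁻¹)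
      have := inv_mem h1
      simpa using this) ⟨-1, by simp [mem_constF], by rw [hdinv]; field_simp⟩
      (by rw [Derivation.leibniz_inv, fr.dt_s]; simp) (by simp)
  have hvT := h pl
  rw [he] at hvT
  have hP0 : P ≠ 0 := by
    rintro rfl
    rw [map_zero] at hPQ
    rcases mul_eq_zero.mp hPQ with h0 | h0
    · exact hT0 h0
    · exact hq0 (by simpa using h0)
  have hrev : aeval fr.s P = fr.s ^ P.natDegree * aeval fr.s⁻¹ P.reverse := by
    have := Polynomial.eval₂_reverse_mul_pow (algebraMap k1 Ω) (invertibleOfNonzero hs0).1 P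
    letI := invertibleOfNonzero hs0
    have := Polynomial.eval₂_reverse_mul_pow (algebraMap k1 Ω) fr.s P
    rw [Polynomial.aeval_def, Polynomial.aeval_def, ← this, invOf_eq_inv, mul_comm]
  have hvr := (hf P.reverse).2 (by rw [coeff_zero_reverse]; exact leadingCoeff_ne_zero.mpr hP0)
  have hvs : 1 < pl.O.valuation fr.s := by
    rw [map_inv₀] at hv
    exact (inv_lt_one₀ (zero_lt_iff.mpr ((Valuation.ne_zero_iff _).mpr hs0))).mp hv
  have hvq : pl.O.valuation (algebraMap k1 Ω q) = 1 := pl.kval _ q.2 (by simpa using hq0)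
  have h8 := congrArg pl.O.valuation hPQ
  rw [map_mul, hvq, mul_one, hrev, map_mul, hvr, mul_one, map_pow] at h8
  rw [map_mul, h8] at hvT
  have : 1 ≤ pl.O.valuation fr.s * pl.O.valuation fr.s ^ P.natDegree := 
    one_le_mul hvs.le (one_le_pow_of_one_le' hvs.le _)
  exact absurd hvT (not_lt.mpr this)
end CI22

namespace CI22
open MvPolynomial TensorProduct

theorem exists_der (Ω : Type) [Field Ω] [Algebra (FractionRing (MvPolynomial (Fin 2) ℂ)) Ω]
    [Algebra (MvPolynomial (Fin 2) ℂ) Ω] [Algebra ℂ Ω] [IsScalarTower (MvPolynomial (Fin 2) ℂ) (FractionRing (MvPolynomial (Fin 2) ℂ)) Ω]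
    [IsScalarTower ℂ (MvPolynomial (Fin 2) ℂ) Ω]
    [Algebra.IsAlgebraic (FractionRing (MvPolynomial (Fin 2) ℂ)) Ω] (i : Fin 2) :
    ∃ D : Derivation ℂ Ω Ω, ∀ j, D (algebraMap (MvPolynomial (Fin 2) ℂ) Ω (X j)) = if i = j then 1 else 0 := by
  have h1 : Algebra.FormallyEtale (MvPolynomial (Fin 2) ℂ) (FractionRing (MvPolynomial (Fin 2) ℂ)) :=
    Algebra.FormallyEtale.of_isLocalization (nonZeroDivisors (MvPolynomial (Fin 2) ℂ))
  have h2 : Algebra.FormallyEtale (FractionRing (MvPolynomial (Fin 2) ℂ)) Ω :=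
    Algebra.FormallyEtale.of_isSeparable _ _
  have h3 : Algebra.FormallyEtale (MvPolynomial (Fin 2) ℂ) Ω := Algebra.FormallyEtale.comp _ (FractionRing (MvPolynomial (Fin 2) ℂ)) _
  let eqv := KaehlerDifferential.tensorKaehlerEquivOfFormallyEtale ℂ (MvPolynomial (Fin 2) ℂ) Ω
  let D0 : Derivation ℂ (MvPolynomial (Fin 2) ℂ) Ω := mkDerivation ℂ (fun j => if i = j then (1:Ω) else 0)
  let l : Ω[Ω⁄ℂ] →ₗ[Ω] Ω := (LinearMap.liftBaseChange Ω D0.liftKaehlerDifferential) ∘ₗ eqv.symm.toLinearMap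
  refine ⟨l.compDer (KaehlerDifferential.D ℂ Ω), fun j => ?_⟩
  show (LinearMap.liftBaseChange Ω D0.liftKaehlerDifferential) (eqv.symm (KaehlerDifferential.D ℂ Ω _)) = _
  simp only [eqv, D0]
  rw [KaehlerDifferential.tensorKaehlerEquivOfFormallyEtale_symm_D_algebraMap]
  simp [mkDerivation_X]

theorem exists_frame : ∃ (Ω : Type) (_ : Field Ω) (_ : Algebra ℂ Ω) (_ : IsAlgClosed Ω) (fr : Frame Ω),
    AlgebraicIndependent ℂ ![fr.s, fr.t] := by
  let A := MvPolynomial (Fin 2) ℂ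
  let K := FractionRing A
  let Ω := AlgebraicClosure K
  obtain ⟨ds, hs⟩ := exists_der Ω 0
  obtain ⟨dt, ht⟩ := exists_der Ω 1
  have hinj : Function.Injective (algebraMap A Ω) := by
    rw [IsScalarTower.algebraMap_eq A K Ω]
    exact (algebraMap K Ω).injective.comp (IsFractionRing.injective A K)
  let s : Ω := algebraMap A Ω (X 0)
  let t : Ω := algebraMap A Ω (X 1)
  have hfun : aeval ![s, t] = IsScalarTower.toAlgHom ℂ A Ω := by
    apply MvPolynomial.algHom_ext
    intro i; fin_cases i <;> simp [s, t] <;> rfl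
  have hmem : ∀ a : A, algebraMap A Ω a ∈ IntermediateField.adjoin ℂ {s, t} := fun a => by
    have : algebraMap A Ω a = aeval ![s, t] a := by rw [hfun]; rfl
    rw [this, MvPolynomial.aeval_def, MvPolynomial.eval₂_eq]
    apply sum_mem
    intro j _
    apply mul_mem
    · exact (IntermediateField.adjoin ℂ {s, t}).algebraMap_mem _
    · apply prod_mem
      intro i _
      apply pow_mem
      apply IntermediateField.subset_adjoin
      fin_cases i <;> simp
  have hmem2 : ∀ a : K, algebraMap K Ω a ∈ IntermediateField.adjoin ℂ {s, t} := fun a => by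
    obtain ⟨x, y, hy, rfl⟩ := IsFractionRing.div_surjective (A := A) a
    rw [map_div₀, ← IsScalarTower.algebraMap_apply, ← IsScalarTower.algebraMap_apply]
    exact div_mem (hmem _) (hmem _)
  have halg : Algebra.IsAlgebraic (IntermediateField.adjoin ℂ {s, t}) Ω := by
    let F := IntermediateField.adjoin ℂ {s, t}
    letI : Algebra K F := ((algebraMap K Ω).codRestrict F.toSubring hmem2).toAlgebra
    haveI : IsScalarTower K F Ω := IsScalarTower.of_algebraMap_eq (fun x => rfl)
    haveI : Algebra.IsAlgebraic K Ω := inferInstance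
    exact Algebra.IsAlgebraic.tower_top (K := K) F
  refine ⟨Ω, inferInstance, inferInstance, inferInstance,
    { s := s, t := t, ds := ds, dt := dt, ds_s := by rw [hs]; simp, ds_t := by rw [hs]; simp, dt_s := by rw [ht]; simp, dt_t := by rw [ht]; simp, alg := halg }, ?_⟩
  show Function.Injective (aeval ![s, t])
  rw [hfun]; exact hinj
end CI22

namespace CI22
open Matrix

section rho
variable {r m ι : Type} [Fintype r] [Fintype m] [Fintype ι] [DecidableEq r] [DecidableEq m] [DecidableEq ι]

/-- The square matrix obtained by stacking two blocks of rows. -/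
def stk {R : Type*} (e : r ⊕ m ≃ ι) (N : Matrix r ι R) (f : Matrix m ι R) : Matrix (r ⊕ m) (r ⊕ m) R :=
  (Matrix.fromRows N f).submatrix id e

theorem stk_mul {R : Type*} [CommRing R] (e : r ⊕ m ≃ ι) (N : Matrix r ι R) (f : Matrix m ι R)
    (ξ : Matrix ι r R) (U : Matrix ι m R) :
    stk e N f * (Matrix.fromCols ξ U).submatrix e id = Matrix.fromBlocks (N * ξ) (N * U) (f * ξ) (f * U) := by
  unfold stk
  rw [Matrix.submatrix_mul_equiv, Matrix.fromRows_mul_fromCols]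
  ext i j; simp

theorem ratio {R : Type*} [CommRing R] (e : r ⊕ m ≃ ι) (N : Matrix r ι R)
    (ξ : Matrix ι r R) (U : Matrix ι m R) (h1 : N * ξ = 1) (h2 : N * U = 0) (f : Matrix m ι R) :
    (f * U).det = ((Matrix.fromCols ξ U).submatrix e id).det * (stk e N f).det := by
  rw [mul_comm, ← det_mul, stk_mul, h1, h2, det_fromBlocks_zero₁₂, det_one, one_mul]

theorem exists_left_inv {K : Type*} [Field K] {m ι : Type*} [Fintype m] [Fintype ι] [DecidableEq m] [DecidableEq ι]
    (U : Matrix ι m K) (hU : ∀ c : m → K, U *ᵥ c = 0 → c = 0) : ∃ f : Matrix m ι K, f * U = 1 := by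
  obtain ⟨g, hg⟩ := LinearMap.exists_leftInverse_of_injective (toLin' U) (LinearMap.ker_eq_bot'.mpr hU)
  refine ⟨LinearMap.toMatrix' g, ?_⟩
  have := congrArg LinearMap.toMatrix' hg
  rwa [LinearMap.toMatrix'_comp, LinearMap.toMatrix'_toLin', LinearMap.toMatrix'_id] at this

theorem exists_right_inv {K : Type*} [Field K] {m ι : Type*} [Fintype m] [Fintype ι] [DecidableEq m] [DecidableEq ι]
    (N : Matrix m ι K) (hN : ∀ c : m → K, c ᵥ* N = 0 → c = 0) : ∃ f : Matrix ι m K, N * f = 1 := by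
  obtain ⟨f, hf⟩ := exists_left_inv Nᵀ (fun c hc => hN c (by rwa [mulVec_transpose] at hc))
  refine ⟨fᵀ, ?_⟩
  rw [← Matrix.transpose_transpose N, ← transpose_mul, hf, transpose_one]

theorem exists_compl {K : Type*} [Field K] (e : r ⊕ m ≃ ι) (N : Matrix r ι K)
    (ξ : Matrix ι r K) (h1 : N * ξ = 1) : ∃ f : Matrix m ι K, (stk e N f).det ≠ 0 := by
  have hsurj : Function.Surjective (Matrix.toLin' N) := by
    intro y
    refine ⟨ξ *ᵥ y, ?_⟩
    rw [toLin'_apply, mulVec_mulVec, h1, one_mulVec]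
  have hdim : Module.finrank K (LinearMap.ker (Matrix.toLin' N)) = Fintype.card m := by
    have := LinearMap.finrank_range_add_finrank_ker (Matrix.toLin' N)
    rw [LinearMap.range_eq_top.mpr hsurj, finrank_top, Module.finrank_fintype_fun_eq_card, Module.finrank_fintype_fun_eq_card,
      ← Fintype.card_congr e, Fintype.card_sum] at this
    omega
  let b := (Module.finBasisOfFinrankEq K _ hdim).reindex (Fintype.equivFin m).symm
  let U : Matrix ι m K := fun i j => (b j : ι → K) i
  have hNU : N * U = 0 := by
    ext i j
    have := (b j).2
    rw [LinearMap.mem_ker, toLin'_apply] at this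
    have := congrFun this i
    rw [mul_apply]
    simpa [mulVec, dotProduct, U] using this
  let Y : Matrix (r ⊕ m) (r ⊕ m) K := (Matrix.fromCols ξ U).submatrix e id
  have hY : IsUnit Y := by
    rw [← Matrix.mulVec_injective_iff_isUnit]
    rw [show Y.mulVec = (Matrix.mulVecLin Y : (r ⊕ m → K) → _) from rfl, injective_iff_map_eq_zero]
    intro c hc
    have hc' : (Matrix.fromCols ξ U) *ᵥ c = 0 := by
      ext i
      have := congrFun hc (e.symm i)
      simpa [Y, mulVec, submatrix, dotProduct] using this
    rw [fromCols_mulVec] at hc'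
    have h3 : (c ∘ Sum.inl) = 0 := by
      have := congrArg (N *ᵥ ·) hc'
      simp only [mulVec_add, mulVec_mulVec, h1, hNU, one_mulVec, zero_mulVec, add_zero, mulVec_zero] at this
      exact this
    rw [h3, mulVec_zero, zero_add] at hc'
    have h4 : (c ∘ Sum.inr) = 0 := by
      have hl := Fintype.linearIndependent_iff.mp b.linearIndependent (c ∘ Sum.inr) (by
        apply Subtype.ext
        ext i
        have := congrFun hc' i
        simpa [mulVec, dotProduct, U, Finset.sum_apply, mul_comm] using this)
      ext i; exact hl i
    ext (i | i)
    · exact congrFun h3 i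
    · exact congrFun h4 i
  let f : Matrix m ι K := (Y⁻¹).submatrix Sum.inr e.symm
  refine ⟨f, ?_⟩
  have hYY : Y⁻¹ * Y = 1 := nonsing_inv_mul _ ((isUnit_iff_isUnit_det _).mp hY)
  have hfa : ∀ i j, (f * Matrix.fromCols ξ U) i j = (1 : Matrix (r ⊕ m) (r ⊕ m) K) (Sum.inr i) j := by
    intro i j
    rw [← hYY, mul_apply, mul_apply, ← e.sum_comp]
    simp [f, Y]
  have hp := stk_mul e N f ξ U
  have h5 : f * ξ = 0 := by
    ext i j
    have := hfa i (Sum.inl j)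
    rw [mul_fromCols] at this
    simpa using this
  have h6 : f * U = 1 := by
    ext i j
    have := hfa i (Sum.inr j)
    rw [mul_fromCols] at this
    simpa [one_apply] using this
  have h8 := congrArg det hp
  rw [h1, hNU, h5, h6, fromBlocks_one, det_one, det_mul] at h8
  exact left_ne_zero_of_mul_eq_one h8

/-- `ρ` is the proportionality factor between the maximal minors of `U` and the complementary minors of `N`. -/
def IsRho {K : Type*} [Field K] (e : r ⊕ m ≃ ι) (N : Matrix r ι K) (U : Matrix ι m K) (ρ : K) : Prop :=
  (∃ ξ : Matrix ι r K, N * ξ = 1) ∧ ∀ f : Matrix m ι K, (f * U).det = ρ * (stk e N f).det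

variable {K : Type*} [Field K] {e : r ⊕ m ≃ ι} {N : Matrix r ι K} {U : Matrix ι m K} {ρ ρ' : K}

theorem IsRho.unique (h : IsRho e N U ρ) (h' : IsRho e N U ρ') : ρ = ρ' := by
  obtain ⟨⟨ξ, hξ⟩, h⟩ := h
  obtain ⟨f, hf⟩ := exists_compl e N ξ hξ
  exact mul_right_cancel₀ hf ((h f).symm.trans (h'.2 f))

theorem IsRho.exists (ξ : Matrix ι r K) (h1 : N * ξ = 1) (h2 : N * U = 0) : ∃ ρ, IsRho e N U ρ :=
  ⟨_, ⟨ξ, h1⟩, fun f => ratio e N ξ U h1 h2 f⟩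

theorem IsRho.map (σ : K ≃+* K) (h : IsRho e N U ρ) : IsRho e (N.map σ) (U.map σ) (σ ρ) := by
  obtain ⟨⟨ξ, hξ⟩, h⟩ := h
  refine ⟨⟨ξ.map σ, ?_⟩, fun f => ?_⟩
  · have := congrArg (fun M => M.map (σ : K →+* K)) hξ
    simp only [Matrix.map_mul] at this
    rw [Matrix.map_one _ (map_zero _) (map_one _)] at this
    exact this
  · have h1 := congrArg σ (h (f.map σ.symm))
    have hf : (f.map σ.symm).map σ = f := by ext; simp
    rw [map_mul] at h1
    have e1 := RingHom.map_det (σ : K →+* K) (f.map σ.symm * U)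
    have e2 := RingHom.map_det (σ : K →+* K) (stk e N (f.map σ.symm))
    have e3 : (σ : K →+* K).mapMatrix (f.map σ.symm * U) = f * U.map σ := by
      rw [RingHom.mapMatrix_apply, Matrix.map_mul]
      congr 1
    have e4 : (σ : K →+* K).mapMatrix (stk e N (f.map σ.symm)) = stk e (N.map σ) f := by
      ext i j; rcases i with i | i
      · rfl
      · show σ (σ.symm _) = _
        simp [stk]
    rw [e3] at e1; rw [e4] at e2
    rw [← e1, ← e2]; exact h1

theorem IsRho.scale (h : IsRho e N U ρ) (A : Matrix r r K) (B : Matrix m m K) (hA : A.det ≠ 0) :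
    IsRho e (A * N) (U * B) (ρ * B.det / A.det) := by
  obtain ⟨⟨ξ, hξ⟩, h⟩ := h
  refine ⟨⟨ξ * A⁻¹, ?_⟩, fun f => ?_⟩
  · rw [Matrix.mul_assoc, ← Matrix.mul_assoc N, hξ, Matrix.one_mul, Matrix.mul_nonsing_inv _ (isUnit_iff_ne_zero.mpr hA)]
  · have e1 : stk e (A * N) f = Matrix.fromBlocks A 0 0 1 * stk e N f := by
      unfold stk
      rw [← Matrix.submatrix_id_id (Matrix.fromBlocks A 0 0 1), ← Matrix.submatrix_mul _ _ _ _ _ Function.bijective_id,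
        Matrix.fromBlocks_mul_fromRows]
      simp
    rw [e1, det_mul, det_fromBlocks_zero₂₁, det_one, ← Matrix.mul_assoc, det_mul, h f]
    field_simp

theorem IsRho.ne_zero_of (h : IsRho e N U ρ) (hU : ∀ c : m → K, U *ᵥ c = 0 → c = 0) : ρ ≠ 0 := by
  rintro rfl
  obtain ⟨f, hf⟩ : ∃ f : Matrix m ι K, f * U = 1 := by
    exact exists_left_inv U hU
  have := h.2 f
  rw [hf] at this; simp at this

/-- The local version: integrality of `ρ`. -/
theorem right_inv_of_residue {R : Type*} [CommRing R] [IsLocalRing R] (N : Matrix r ι R) (ξ : Matrix ι r R)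
    (h : ∀ i j, (N * ξ) i j - (1 : Matrix r r R) i j ∈ IsLocalRing.maximalIdeal R) : ∃ ξ' : Matrix ι r R, N * ξ' = 1 := by
  have hu : IsUnit (N * ξ).det := by
    rw [← IsLocalRing.residue_ne_zero_iff_isUnit, RingHom.map_det]
    have : (IsLocalRing.residue R).mapMatrix (N * ξ) = 1 := by
      have h1 : (1 : Matrix r r (IsLocalRing.ResidueField R)) = (IsLocalRing.residue R).mapMatrix 1 := by simp
      rw [h1]
      ext i j
      rw [RingHom.mapMatrix_apply, RingHom.mapMatrix_apply, map_apply, map_apply, ← sub_eq_zero, ← map_sub]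
      exact (IsLocalRing.residue_eq_zero_iff _).mpr (h i j)
    rw [this, det_one]; exact one_ne_zero
  exact ⟨ξ * (N * ξ)⁻¹, by rw [← Matrix.mul_assoc, Matrix.mul_nonsing_inv _ hu]⟩
end rho
end CI22

namespace CI22
open MvPolynomial
variable {Ω : Type} [Field Ω] [Algebra ℂ Ω]

/-- gradient of a complex polynomial at an `Ω`-point -/
noncomputable def gr {n : ℕ} (p : MvPolynomial (Fin n) ℂ) (x : Fin n → Ω) (i : Fin n) : Ω := aeval x (pderiv i p)

theorem chain {n : ℕ} (Δ : Derivation ℂ Ω Ω) (p : MvPolynomial (Fin n) ℂ) (x : Fin n → Ω) :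
    Δ (aeval x p) = ∑ i, gr p x i * Δ (x i) := by
  unfold gr
  induction p using MvPolynomial.induction_on with
  | C a => simp
  | add p q hp hq => simp only [map_add, hp, hq, add_mul, Finset.sum_add_distrib]
  | mul_X p j hp =>
    rw [map_mul, Derivation.leibniz, hp, aeval_X]
    simp only [Derivation.leibniz, pderiv_X, smul_eq_mul, map_add, map_mul, aeval_X, add_mul, Finset.sum_add_distrib]
    congr 1
    · rw [Finset.sum_eq_single j]
      · simp
      · intro b _ hb; simp [Pi.single_apply, hb.symm]
      · simp
    · rw [Finset.mul_sum]
      apply Finset.sum_congr rfl; intros; ring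

theorem euler {n d : ℕ} {p : MvPolynomial (Fin n) ℂ} (hp : p.IsHomogeneous d) (x : Fin n → Ω) :
    ∑ i, gr p x i * x i = d * aeval x p := by
  have h := congrArg (aeval x) hp.sum_X_mul_pderiv
  simp only [map_sum, map_mul, aeval_X, nsmul_eq_mul, map_natCast] at h
  rw [← h]
  apply Finset.sum_congr rfl; intros; rw [mul_comm]; rfl

theorem aeval_smul_hom {n d : ℕ} {p : MvPolynomial (Fin n) ℂ} (hp : p.IsHomogeneous d) (c : Ω) (x : Fin n → Ω) :
    aeval (c • x) p = c ^ d * aeval x p := by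
  rw [aeval_def, aeval_def, eval₂_eq, eval₂_eq, Finset.mul_sum]
  apply Finset.sum_congr rfl
  intro k hk
  have hdeg : ∑ i, k i = d := by
    have := hp (mem_support_iff.mp hk)
    rw [← this, Finsupp.weight_apply, Finsupp.sum_fintype] <;> simp
  simp only [Pi.smul_apply, smul_eq_mul, mul_pow]
  rw [Finset.prod_mul_distrib]
  have : ∏ i ∈ k.support, c ^ k i = c ^ d := by
    rw [Finset.prod_pow_eq_pow_sum, ← hdeg]
    congr 1
    apply Finset.sum_subset (Finset.subset_univ _)
    intro i _ hi; simpa using hi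
  rw [this]; ring

theorem gr_smul {n d : ℕ} {p : MvPolynomial (Fin n) ℂ} (hp : p.IsHomogeneous d) (c : Ω) (x : Fin n → Ω) :
    gr p (c • x) = c ^ (d - 1) • gr p x := by
  ext i
  exact aeval_smul_hom (hp.pderiv) c x

theorem aeval_map {n : ℕ} (σ : Ω →ₐ[ℂ] Ω) (p : MvPolynomial (Fin n) ℂ) (x : Fin n → Ω) :
    σ (aeval x p) = aeval (fun i => σ (x i)) p := by
  rw [← AlgHom.comp_apply, comp_aeval]

theorem gr_map {n : ℕ} (σ : Ω →ₐ[ℂ] Ω) (p : MvPolynomial (Fin n) ℂ) (x : Fin n → Ω) (i) :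
    σ (gr p x i) = gr p (fun i => σ (x i)) i := aeval_map σ _ x

section galois
variable [IsAlgClosed Ω] (fr : Frame Ω)

/-- base field -/
noncomputable abbrev Frame.K0 : IntermediateField ℂ Ω := IntermediateField.adjoin ℂ {fr.s, fr.t}

theorem Frame.s_mem : fr.s ∈ fr.K0 := IntermediateField.subset_adjoin _ _ (by simp)
theorem Frame.t_mem : fr.t ∈ fr.K0 := IntermediateField.subset_adjoin _ _ (by simp)

theorem Frame.gal_mem (T : Ω) (h : ∀ σ : Ω ≃ₐ[fr.K0] Ω, σ T = T) : T ∈ fr.K0 := by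
  have := fr.alg
  have : CharZero fr.K0 := charZero_of_injective_algebraMap (algebraMap ℂ fr.K0).injective
  haveI : IsAlgClosure fr.K0 Ω := ⟨inferInstance, inferInstance⟩
  haveI : IsGalois fr.K0 Ω := IsAlgClosure.isGalois _ _
  obtain ⟨y, hy⟩ := (InfiniteGalois.mem_range_algebraMap_iff_fixed T).mpr h
  rw [← hy]; exact y.2

noncomputable def Frame.conjLin (D : Derivation ℂ Ω Ω) (σ : Ω ≃ₐ[fr.K0] Ω) : Ω →ₗ[ℂ] Ω where
  toFun x := σ.symm (D (σ x))
  map_add' x y := by simp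
  map_smul' c x := by
    have h : ∀ z : Ω, ∀ τ : Ω ≃ₐ[fr.K0] Ω, τ (c • z) = c • τ z := fun z τ => map_smul (τ.restrictScalars ℂ) c z
    simp [h]

noncomputable def Frame.conj (D : Derivation ℂ Ω Ω) (σ : Ω ≃ₐ[fr.K0] Ω) : Derivation ℂ Ω Ω :=
  Derivation.mk' (fr.conjLin D σ) (fun a b => by simp [Frame.conjLin])

theorem Frame.conj_eq (D : Derivation ℂ Ω Ω) (σ : Ω ≃ₐ[fr.K0] Ω)
   (hs : σ.symm (D fr.s) = D fr.s) (ht : σ.symm (D fr.t) = D fr.t) : fr.conj D σ = D := by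
  have h1 : σ fr.s = fr.s := σ.commutes ⟨fr.s, fr.s_mem⟩
  have h2 : σ fr.t = fr.t := σ.commutes ⟨fr.t, fr.t_mem⟩
  have := fr.der_zero (fr.conj D σ - D) (by
    show σ.symm (D (σ fr.s)) - D fr.s = 0
    rw [h1, hs, sub_self]) (by
    show σ.symm (D (σ fr.t)) - D fr.t = 0
    rw [h2, ht, sub_self])
  exact sub_eq_zero.mp this

theorem Frame.gal_ds (σ : Ω ≃ₐ[fr.K0] Ω) (x : Ω) : σ (fr.ds x) = fr.ds (σ x) := by
  have := congrArg (fun D : Derivation ℂ Ω Ω => σ (D x)) (fr.conj_eq fr.ds σ (by rw [fr.ds_s]; simp) (by rw [fr.ds_t]; simp))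
  have h2 : σ (fr.conj fr.ds σ x) = fr.ds (σ x) := σ.apply_symm_apply _
  exact this.symm.trans h2

theorem Frame.gal_dt (σ : Ω ≃ₐ[fr.K0] Ω) (x : Ω) : σ (fr.dt x) = fr.dt (σ x) := by
  have := congrArg (fun D : Derivation ℂ Ω Ω => σ (D x)) (fr.conj_eq fr.dt σ (by rw [fr.dt_s]; simp) (by rw [fr.dt_t]; simp))
  have h2 : σ (fr.conj fr.dt σ x) = fr.dt (σ x) := σ.apply_symm_apply _
  exact this.symm.trans h2

/-- The trace argument. -/
theorem trace_zero {α : Type} (S : Finset α) (T : α → Ω) (act : (Ω ≃ₐ[fr.K0] Ω) → α → α)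
    (h1 : ∀ σ, ∀ x ∈ S, act σ x ∈ S) (h2 : ∀ σ, Function.Injective (act σ))
    (h3 : ∀ σ, ∀ x ∈ S, T (act σ x) = σ (T x))
    (h4 : ∀ P : Place fr, ∀ x ∈ S, P.O.valuation (P.e * T x) < 1) : ∑ x ∈ S, T x = 0 := by
  apply rational_zero fr
  · apply fr.gal_mem
    intro σ
    rw [map_sum, ← Finset.sum_congr rfl (h3 σ)]
    classical
    have him : S.image (act σ) = S := Finset.eq_of_subset_of_card_le
      (Finset.image_subset_iff.mpr (h1 σ)) (by rw [Finset.card_image_of_injective _ (h2 σ)])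
    conv_rhs => rw [← him]
    rw [Finset.sum_image (fun a _ b _ h => h2 σ h)]
  · intro P
    rw [Finset.mul_sum]
    exact Valuation.map_sum_lt _ one_ne_zero (h4 P)
end galois
end CI22

namespace CI22
open MvPolynomial Matrix
variable {Ω : Type} [Field Ω] [Algebra ℂ Ω] {fr : Frame Ω} (P : Place fr)

theorem Place.vC (c : ℂ) : P.O.valuation (algebraMap ℂ Ω c) ≤ 1 := by
  by_cases h : algebraMap ℂ Ω c = 0
  · rw [h, map_zero]; exact zero_le_one
  · exact (P.kval _ (by simp) h).le

theorem Place.vconst {r : Ω} (h : fr.ds r = 0) : P.O.valuation r ≤ 1 := by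
  by_cases h0 : r = 0
  · rw [h0, map_zero]; exact zero_le_one
  · exact (P.kval _ h h0).le

theorem Place.vE {x : Ω} (h : P.O.valuation x ≤ 1) : P.O.valuation (P.e * fr.ds x) < 1 := P.Eint x h

theorem Place.vadd {x y : Ω} (hx : P.O.valuation x ≤ 1) (hy : P.O.valuation y ≤ 1) : P.O.valuation (x + y) ≤ 1 :=
  Valuation.map_add_le _ hx hy
theorem Place.vmul {x y : Ω} (hx : P.O.valuation x ≤ 1) (hy : P.O.valuation y ≤ 1) : P.O.valuation (x * y) ≤ 1 := by
  rw [map_mul]; exact mul_le_one' hx hy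
theorem Place.vaddlt {x y : Ω} (hx : P.O.valuation x < 1) (hy : P.O.valuation y < 1) : P.O.valuation (x + y) < 1 :=
  Valuation.map_add_lt _ hx hy
theorem Place.vmullt {x y : Ω} (hx : P.O.valuation x < 1) (hy : P.O.valuation y ≤ 1) : P.O.valuation (x * y) < 1 := by
  rw [map_mul]; exact mul_lt_one_of_lt_of_le hx hy
theorem Place.vmullt' {x y : Ω} (hx : P.O.valuation x ≤ 1) (hy : P.O.valuation y < 1) : P.O.valuation (x * y) < 1 := by
  rw [mul_comm]; exact P.vmullt hy hx

theorem Place.vpoly {n : ℕ} (p : MvPolynomial (Fin n) ℂ) (x : Fin n → Ω) (hx : ∀ i, P.O.valuation (x i) ≤ 1) :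
    P.O.valuation (aeval x p) ≤ 1 := by
  induction p using MvPolynomial.induction_on with
  | C a => rw [aeval_C]; exact P.vC a
  | add p q hp hq => rw [map_add]; exact P.vadd hp hq
  | mul_X p j hp => rw [map_mul, aeval_X]; exact P.vmul hp (hx j)

theorem Place.cpoly {n : ℕ} (p : MvPolynomial (Fin n) ℂ) (x y : Fin n → Ω) (hx : ∀ i, P.O.valuation (x i) ≤ 1)
    (hy : ∀ i, P.O.valuation (y i) ≤ 1) (h : ∀ i, P.O.valuation (x i - y i) < 1) :
    P.O.valuation (aeval x p - aeval y p) < 1 := by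
  induction p using MvPolynomial.induction_on with
  | C a => simp
  | add p q hp hq => rw [map_add, map_add, add_sub_add_comm]; exact P.vaddlt hp hq
  | mul_X p j hp =>
    rw [map_mul, map_mul, aeval_X, aeval_X, show aeval x p * x j - aeval y p * y j = aeval x p * (x j - y j) + (aeval x p - aeval y p) * y j by ring]
    exact P.vaddlt (P.vmullt' (P.vpoly p x hx) (h j)) (P.vmullt hp (hy j))

theorem Place.const_aeval {n : ℕ} (p : MvPolynomial (Fin n) ℂ) (x : Fin n → Ω) (hx : ∀ i, fr.ds (x i) = 0) :
    fr.ds (aeval x p) = 0 := by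
  rw [chain]; simp [hx]

/-- the reduction of an integral vector -/
theorem Place.red {n : ℕ} (x : Fin n → Ω) (hx : ∀ i, P.O.valuation (x i) ≤ 1) :
    ∃ r : Fin n → Ω, (∀ i, fr.ds (r i) = 0) ∧ ∀ i, P.O.valuation (x i - r i) < 1 := by
  choose r hr using fun i => P.res (x i) (hx i)
  exact ⟨r, fun i => (hr i).1, fun i => (hr i).2⟩

theorem Place.const_eq_zero {r : Ω} (h : fr.ds r = 0) (hv : P.O.valuation r < 1) : r = 0 := by
  by_contra h0
  rw [P.kval r h h0] at hv
  exact lt_irrefl _ hv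

/-- scaling a vector to be primitive -/
theorem Place.primitive {n : ℕ} (x : Fin n → Ω) (hx : x ≠ 0) :
    ∃ c : Ω, c ≠ 0 ∧ (∀ i, P.O.valuation (c * x i) ≤ 1) ∧ ∃ i, P.O.valuation (c * x i) = 1 := by
  obtain ⟨j, hj⟩ := Function.ne_iff.mp hx
  haveI : Nonempty (Fin n) := ⟨j⟩
  obtain ⟨i0, h0⟩ := Finite.exists_max (fun i => P.O.valuation (x i))
  have hi : x i0 ≠ 0 := by
    intro h1
    have := h0 j
    rw [h1, map_zero] at this
    exact hj (by simpa using this)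
  have hv : 0 < P.O.valuation (x i0) := zero_lt_iff.mpr ((Valuation.ne_zero_iff _).mpr hi)
  refine ⟨(x i0)⁻¹, inv_ne_zero hi, fun i => ?_, i0, by rw [inv_mul_cancel₀ hi, map_one]⟩
  rw [map_mul, map_inv₀]
  exact inv_mul_le_one_of_le₀ (h0 i) (zero_le)

section
variable {r m ι : Type} [Fintype r] [Fintype m] [Fintype ι] [DecidableEq r] [DecidableEq m] [DecidableEq ι]

theorem Place.exists_lift_inv (N N0 : Matrix r ι Ω) (hN : ∀ i j, P.O.valuation (N i j) ≤ 1)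
    (hN0 : ∀ i j, fr.ds (N0 i j) = 0) (h : ∀ i j, P.O.valuation (N i j - N0 i j) < 1)
    (hind : ∀ c : r → Ω, c ᵥ* N0 = 0 → c = 0) :
    ∃ ξ : Matrix ι r Ω, N * ξ = 1 ∧ ∀ i j, P.O.valuation (ξ i j) ≤ 1 := by
  let k1 := constF fr.ds
  let M0 : Matrix r ι k1 := fun i j => ⟨N0 i j, hN0 i j⟩
  have hM0 : M0.map (algebraMap k1 Ω) = N0 := by ext; rfl
  obtain ⟨η, hη⟩ := exists_right_inv M0 (fun c hc => by
    have h1 : (algebraMap k1 Ω ∘ c) ᵥ* N0 = 0 := by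
      rw [← hM0, funext_iff]
      intro i
      have := RingHom.map_vecMul (algebraMap k1 Ω) M0 c i
      rw [← this, hc]; simp
    have h2 := hind _ h1
    ext i
    have := congrFun h2 i
    simpa using this)
  let N' : Matrix r ι P.O := fun i j => ⟨N i j, (P.O.valuation_le_one_iff _).mp (hN i j)⟩
  let ξ' : Matrix ι r P.O := fun i j => ⟨(η i j : Ω), (P.O.valuation_le_one_iff _).mp (P.vconst (η i j).2)⟩
  obtain ⟨ζ, hζ⟩ := right_inv_of_residue N' ξ' (fun i j => by
    rw [ValuationSubring.valuation_lt_one_iff]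
    have e1 : (((N' * ξ') i j - (1 : Matrix r r P.O) i j : P.O) : Ω) = ∑ k, (N i k - N0 i k) * (η k j : Ω) := by
      have e2 : ((1 : Matrix r r P.O) i j : Ω) = ∑ k, N0 i k * (η k j : Ω) := by
        have := congrArg (algebraMap k1 Ω) (congrFun (congrFun hη i) j)
        rw [mul_apply, map_sum] at this
        rw [one_apply] at this ⊢
        split_ifs at this ⊢ <;> exact this.symm
      push_cast
      rw [e2, mul_apply]
      push_cast
      rw [← Finset.sum_sub_distrib]
      apply Finset.sum_congr rfl; intros; rw [sub_mul]
    rw [e1]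
    exact Valuation.map_sum_lt _ one_ne_zero (fun k _ => P.vmullt (h i k) (P.vconst (η k j).2)))
  refine ⟨ζ.map (fun x => (x : Ω)), ?_, fun i j => (P.O.valuation_le_one_iff _).mpr (ζ i j).2⟩
  ext i j
  have := congrArg (fun x : P.O => (x : Ω)) (congrFun (congrFun hζ i) j)
  rw [mul_apply] at this ⊢
  push_cast at this
  rw [one_apply] at this ⊢
  split_ifs at this ⊢ <;> exact this

theorem Place.det_le {n : Type} [Fintype n] [DecidableEq n] (A : Matrix n n Ω) (hA : ∀ i j, P.O.valuation (A i j) ≤ 1) :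
    P.O.valuation A.det ≤ 1 := by
  rw [det_apply]
  apply Valuation.map_sum_le
  intro σ _
  have : P.O.valuation (Equiv.Perm.sign σ • ∏ i, A (σ i) i) = P.O.valuation (∏ i, A (σ i) i) := by
    rcases Int.units_eq_one_or (Equiv.Perm.sign σ) with h | h <;> rw [h] <;> simp
  rw [this, map_prod]
  exact Finset.prod_le_one' (fun i _ => hA _ _)

theorem Place.det_lt {n : Type} [Fintype n] [DecidableEq n] (A : Matrix n n Ω) (hA : ∀ i j, P.O.valuation (A i j) ≤ 1)
    (j0 : n) (h0 : ∀ i, P.O.valuation (A i j0) < 1) : P.O.valuation A.det < 1 := by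
  rw [det_apply]
  apply Valuation.map_sum_lt _ one_ne_zero
  intro σ _
  have : P.O.valuation (Equiv.Perm.sign σ • ∏ i, A (σ i) i) = P.O.valuation (∏ i, A (σ i) i) := by
    rcases Int.units_eq_one_or (Equiv.Perm.sign σ) with h | h <;> rw [h] <;> simp
  rw [this, map_prod, ← Finset.mul_prod_erase _ _ (Finset.mem_univ j0)]
  exact mul_lt_one_of_lt_of_le (h0 _) (Finset.prod_le_one' (fun i _ => hA _ _))

theorem Place.rho_le (e : r ⊕ m ≃ ι) (N N0 : Matrix r ι Ω) (U : Matrix ι m Ω) (hN : ∀ i j, P.O.valuation (N i j) ≤ 1)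
    (hN0 : ∀ i j, fr.ds (N0 i j) = 0) (h : ∀ i j, P.O.valuation (N i j - N0 i j) < 1)
    (hind : ∀ c : r → Ω, c ᵥ* N0 = 0 → c = 0) (hU : ∀ i j, P.O.valuation (U i j) ≤ 1) (hNU : N * U = 0) (ρ : Ω) (hρ : IsRho e N U ρ)
    (j0 : m) (h0 : ∀ i, P.O.valuation (U i j0) < 1) : P.O.valuation ρ < 1 := by
  obtain ⟨ξ, h1, h2⟩ := P.exists_lift_inv N N0 hN hN0 h hind
  have : IsRho e N U _ := ⟨⟨ξ, h1⟩, fun f => ratio e N ξ U h1 hNU f⟩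
  rw [hρ.unique this]
  apply P.det_lt _ _ (Sum.inr j0)
  · intro i; exact h0 _
  · rintro i (j | j)
    · exact h2 _ _
    · exact hU _ _
end
end CI22

namespace CI22
open MvPolynomial Matrix

/-- The geometric configuration, with smoothness stated over the big field. -/
structure Cfg (Ω : Type) [Field Ω] [Algebra ℂ Ω] where
  d : ℕ
  e : ℕ
  hd : 8 ≤ d
  q1 : MvPolynomial (Fin 6) ℂ
  q2 : MvPolynomial (Fin 6) ℂ
  g : MvPolynomial (Fin 6) ℂ
  F0 : MvPolynomial (Fin 6) ℂ
  F1 : MvPolynomial (Fin 6) ℂ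
  F2 : MvPolynomial (Fin 6) ℂ
  h1 : q1.IsHomogeneous 2
  h2 : q2.IsHomogeneous 2
  hg : g.IsHomogeneous d
  hF0 : F0.IsHomogeneous e
  hF1 : F1.IsHomogeneous e
  hF2 : F2.IsHomogeneous e
  smZ : ∀ v : Fin 6 → Ω, v ≠ 0 → aeval v q1 = 0 → aeval v q2 = 0 → ∀ a b : Ω,
    (∀ i, a * gr q1 v i + b * gr q2 v i = 0) → a = 0 ∧ b = 0
  smX : ∀ v : Fin 6 → Ω, v ≠ 0 → aeval v q1 = 0 → aeval v q2 = 0 → aeval v g = 0 → ∀ a b c : Ω,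
    (∀ i, a * gr q1 v i + b * gr q2 v i + c * gr g v i = 0) → a = 0 ∧ b = 0 ∧ c = 0

variable {Ω : Type} [Field Ω] [Algebra ℂ Ω]

/-- points of the generic fiber, normalized -/
structure Pt (fr : Frame Ω) (cf : Cfg Ω) (x : Fin 6 → Ω) : Prop where
  norm : ∃ i, x i = 1 ∧ ∀ j < i, x j = 0
  z1 : aeval x cf.q1 = 0
  z2 : aeval x cf.q2 = 0
  zg : aeval x cf.g = 0
  f0 : aeval x cf.F0 ≠ 0
  f1 : aeval x cf.F1 = fr.s * aeval x cf.F0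
  f2 : aeval x cf.F2 = fr.t * aeval x cf.F0

variable {fr : Frame Ω} {cf : Cfg Ω}

theorem Pt.ne_zero {x : Fin 6 → Ω} (h : Pt fr cf x) : x ≠ 0 := by
  rintro rfl
  obtain ⟨i, hi, _⟩ := h.norm
  simp at hi

theorem Pt.indep {x : Fin 6 → Ω} (h : Pt fr cf x) (a b c : Ω)
    (h0 : ∀ i, a * x i + b * fr.ds (x i) + c * fr.dt (x i) = 0) : a = 0 ∧ b = 0 ∧ c = 0 := by
  have key : ∀ F : MvPolynomial (Fin 6) ℂ, F.IsHomogeneous cf.e →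
      b * fr.ds (aeval x F) + c * fr.dt (aeval x F) = - a * (cf.e * aeval x F) := by
    intro F hF
    rw [chain, chain, ← euler hF, Finset.mul_sum, Finset.mul_sum, Finset.mul_sum, ← Finset.sum_add_distrib]
    apply Finset.sum_congr rfl
    intro i _
    linear_combination gr F x i * h0 i
  have k0 := key _ cf.hF0
  have k1 := key _ cf.hF1
  have k2 := key _ cf.hF2
  rw [h.f1] at k1
  rw [h.f2] at k2
  simp only [Derivation.leibniz, fr.ds_s, fr.dt_s, fr.ds_t, fr.dt_t, smul_eq_mul] at k1 k2
  have hb : b * aeval x cf.F0 = 0 := by linear_combination k1 - fr.s * k0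
  have hc : c * aeval x cf.F0 = 0 := by linear_combination k2 - fr.t * k0
  have hb' := (mul_eq_zero.mp hb).resolve_right h.f0
  have hc' := (mul_eq_zero.mp hc).resolve_right h.f0
  obtain ⟨i, hi, _⟩ := h.norm
  have := h0 i
  rw [hi, hb', hc'] at this
  refine ⟨by simpa using this, hb', hc'⟩

/-- Jacobian matrix -/
noncomputable def NX (cf : Cfg Ω) (x : Fin 6 → Ω) : Matrix (Fin 3) (Fin 6) Ω := ![gr cf.q1 x, gr cf.q2 x, gr cf.g x]

noncomputable def UX (fr : Frame Ω) (x : Fin 6 → Ω) : Matrix (Fin 6) (Fin 3) Ω :=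
  fun i => ![x i, fr.ds (x i), fr.dt (x i)]

def e33 : Fin 3 ⊕ Fin 3 ≃ Fin 6 := finSumFinEquiv

theorem NX_rows (cf : Cfg Ω) (x : Fin 6 → Ω) (hx : x ≠ 0) (z1 : aeval x cf.q1 = 0) (z2 : aeval x cf.q2 = 0)
    (zg : aeval x cf.g = 0) (c : Fin 3 → Ω) (hc : c ᵥ* NX cf x = 0) : c = 0 := by
  have := cf.smX x hx z1 z2 zg (c 0) (c 1) (c 2) (fun i => by
    have := congrFun hc i
    simpa [vecMul, dotProduct, Fin.sum_univ_three, NX] using this)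
  ext i
  fin_cases i
  · exact this.1
  · exact this.2.1
  · exact this.2.2

theorem NX_UX {x : Fin 6 → Ω} (z1 : aeval x cf.q1 = 0) (z2 : aeval x cf.q2 = 0)
    (zg : aeval x cf.g = 0) : NX cf x * UX fr x = 0 := by
  have key : ∀ (p : MvPolynomial (Fin 6) ℂ) (k : ℕ), p.IsHomogeneous k → aeval x p = 0 → ∀ j, ∑ i, gr p x i * UX fr x i j = 0 := by
    intro p k hp h0 j
    fin_cases j
    · have := euler hp x
      rw [h0, mul_zero] at this
      exact this
    · have := chain fr.ds p x
      rw [h0, map_zero] at this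
      exact this.symm
    · have := chain fr.dt p x
      rw [h0, map_zero] at this
      exact this.symm
  ext i j
  rw [mul_apply]
  fin_cases i
  · exact key _ _ cf.h1 z1 j
  · exact key _ _ cf.h2 z2 j
  · exact key _ _ cf.hg zg j

theorem Pt.rho {x : Fin 6 → Ω} (h : Pt fr cf x) : ∃ ρ, IsRho e33 (NX cf x) (UX fr x) ρ ∧ ρ ≠ 0 := by
  obtain ⟨ξ, hξ⟩ := exists_right_inv (NX cf x) (NX_rows cf x h.ne_zero h.z1 h.z2 h.zg)
  obtain ⟨ρ, hρ⟩ := IsRho.exists (e := e33) ξ hξ (NX_UX (fr := fr) h.z1 h.z2 h.zg)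
  refine ⟨ρ, hρ, hρ.ne_zero_of fun c hc => ?_⟩
  have := h.indep (c 0) (c 1) (c 2) (fun i => by
    have := congrFun hc i
    simp [mulVec, dotProduct, Fin.sum_univ_three, UX] at this
    linear_combination this)
  ext i
  fin_cases i
  · exact this.1
  · exact this.2.1
  · exact this.2.2

open Classical in
noncomputable def JX (fr : Frame Ω) (cf : Cfg Ω) (x : Fin 6 → Ω) : Ω :=
  if h : Pt fr cf x then h.rho.choose else 0

theorem Pt.JX_rho {x : Fin 6 → Ω} (h : Pt fr cf x) : IsRho e33 (NX cf x) (UX fr x) (JX fr cf x) := by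
  rw [JX, dif_pos h]; exact h.rho.choose_spec.1
theorem Pt.JX_ne {x : Fin 6 → Ω} (h : Pt fr cf x) : JX fr cf x ≠ 0 := by
  rw [JX, dif_pos h]; exact h.rho.choose_spec.2

/-- Galois action on vectors -/
noncomputable def actv (σ : Ω ≃ₐ[fr.K0] Ω) (x : Fin 6 → Ω) : Fin 6 → Ω := fun i => σ (x i)

theorem actv_inj (σ : Ω ≃ₐ[fr.K0] Ω) : Function.Injective (actv σ) := by
  intro x y h
  ext i
  exact σ.injective (congrFun h i)

theorem aeval_actv (σ : Ω ≃ₐ[fr.K0] Ω) (p : MvPolynomial (Fin 6) ℂ) (x : Fin 6 → Ω) :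
    aeval (actv σ x) p = σ (aeval x p) :=
  (aeval_map ((σ.restrictScalars ℂ : Ω ≃ₐ[ℂ] Ω) : Ω →ₐ[ℂ] Ω) p x).symm

theorem gr_actv (σ : Ω ≃ₐ[fr.K0] Ω) (p : MvPolynomial (Fin 6) ℂ) (x : Fin 6 → Ω) (i) :
    gr p (actv σ x) i = σ (gr p x i) := aeval_actv σ _ x

theorem Pt.act [IsAlgClosed Ω] (σ : Ω ≃ₐ[fr.K0] Ω) {x : Fin 6 → Ω} (h : Pt fr cf x) : Pt fr cf (actv σ x) := by
  have h1 : σ fr.s = fr.s := σ.commutes ⟨fr.s, fr.s_mem⟩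
  have h2 : σ fr.t = fr.t := σ.commutes ⟨fr.t, fr.t_mem⟩
  refine ⟨?_, ?_, ?_, ?_, ?_, ?_, ?_⟩
  · obtain ⟨i, hi, hj⟩ := h.norm
    exact ⟨i, by simp [actv, hi], fun j hji => by simp [actv, hj j hji]⟩
  · rw [aeval_actv, h.z1, map_zero]
  · rw [aeval_actv, h.z2, map_zero]
  · rw [aeval_actv, h.zg, map_zero]
  · rw [aeval_actv]; simpa using h.f0
  · rw [aeval_actv, aeval_actv, h.f1, map_mul, h1]
  · rw [aeval_actv, aeval_actv, h.f2, map_mul, h2]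

theorem Pt.JX_act [IsAlgClosed Ω] (σ : Ω ≃ₐ[fr.K0] Ω) {x : Fin 6 → Ω} (h : Pt fr cf x) :
    JX fr cf (actv σ x) = σ (JX fr cf x) := by
  apply ((h.act σ).JX_rho).unique
  have := h.JX_rho.map (σ : Ω ≃+* Ω)
  convert this using 1
  · ext i j
    fin_cases i <;> exact gr_actv σ _ x j
  · ext i j
    fin_cases j
    · rfl
    · exact (fr.gal_ds σ _).symm
    · exact (fr.gal_dt σ _).symm
  · rfl

theorem Pt.local_bound (P : Place fr) {x : Fin 6 → Ω} (h : Pt fr cf x) (p : MvPolynomial (Fin 6) ℂ)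
    (hp : p.IsHomogeneous (cf.d - 2)) : P.O.valuation (P.e * (JX fr cf x * aeval x p)) < 1 := by
  obtain ⟨l, hl, hintg, i0, hi0⟩ := P.primitive x h.ne_zero
  obtain ⟨r, hr, hxr⟩ := P.red (l • x) hintg
  have hrv : ∀ i, P.O.valuation (r i) ≤ 1 := fun i => P.vconst (hr i)
  have hr0 : r ≠ 0 := by
    intro h0
    have := hxr i0
    rw [h0] at this
    simp only [Pi.zero_apply, sub_zero, Pi.smul_apply, smul_eq_mul] at this
    rw [hi0] at this
    exact lt_irrefl _ this
  have hz : ∀ (q : MvPolynomial (Fin 6) ℂ) (k : ℕ), q.IsHomogeneous k → aeval x q = 0 → aeval r q = 0 := by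
    intro q k hq h0
    apply P.const_eq_zero (Place.const_aeval q r hr)
    have := P.cpoly q (l • x) r hintg hrv hxr
    rw [aeval_smul_hom hq, h0, mul_zero, zero_sub, Valuation.map_neg] at this
    exact this
  let A : Matrix (Fin 3) (Fin 3) Ω := diagonal ![l, l, l ^ (cf.d - 1)]
  let B : Matrix (Fin 3) (Fin 3) Ω := !![l, P.e * fr.ds l, fr.dt l + P.b * fr.ds l; 0, l * P.e, l * P.b; 0, 0, l]
  have hAdet : A.det = l ^ (cf.d + 1) := by
    rw [det_diagonal, Fin.prod_univ_three]
    simp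
    have := cf.hd
    rw [show cf.d + 1 = 2 + (cf.d - 1) by omega, pow_add]; ring
  have hBdet : B.det = l ^ 3 * P.e := by
    rw [det_fin_three]; simp [B]; ring
  have hA0 : A.det ≠ 0 := by rw [hAdet]; exact pow_ne_zero _ hl
  have hρ := h.JX_rho.scale A B hA0
  have hN : A * NX cf x = NX cf (l • x) := by
    ext i j
    rw [diagonal_mul]
    fin_cases i
    · simp [NX, gr_smul cf.h1]
    · simp [NX, gr_smul cf.h2]
    · simp [NX, gr_smul cf.hg]
  have hU : ∀ i, (UX fr x * B) i 0 = l * x i ∧ (UX fr x * B) i 1 = P.e * fr.ds (l * x i) ∧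
      (UX fr x * B) i 2 = fr.dt (l * x i) + P.b * fr.ds (l * x i) := by
    intro i
    simp only [mul_apply, Fin.sum_univ_three]
    simp only [UX, B, Derivation.leibniz, smul_eq_mul]
    refine ⟨?_, ?_, ?_⟩ <;> simp <;> ring
  have hNU : A * NX cf x * (UX fr x * B) = 0 := by
    rw [Matrix.mul_assoc, ← Matrix.mul_assoc (NX cf x), NX_UX h.z1 h.z2 h.zg, Matrix.zero_mul, Matrix.mul_zero]
  have hlt := P.rho_le e33 (A * NX cf x) (NX cf r) (UX fr x * B) (by
      rw [hN]
      intro i j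
      fin_cases i <;> exact P.vpoly _ _ hintg) (by
      intro i j
      fin_cases i <;> exact Place.const_aeval _ r hr) (by
      rw [hN]
      intro i j
      fin_cases i <;> exact P.cpoly _ _ _ hintg hrv hxr)
      (NX_rows cf r hr0 (hz _ _ cf.h1 h.z1) (hz _ _ cf.h2 h.z2) (hz _ _ cf.hg h.zg))
      (by
        intro i j
        fin_cases j
        · show P.O.valuation ((UX fr x * B) i 0) ≤ 1
          rw [(hU i).1]; exact hintg i
        · show P.O.valuation ((UX fr x * B) i 1) ≤ 1
          rw [(hU i).2.1]; exact (P.Eint _ (hintg i)).le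
        · show P.O.valuation ((UX fr x * B) i 2) ≤ 1
          rw [(hU i).2.2]; exact P.Dint _ (hintg i)) hNU _ hρ 1 (fun i => by
        rw [(hU i).2.1]; exact P.Eint _ (hintg i))
  have e1 : P.e * (JX fr cf x * aeval x p) = (JX fr cf x * B.det / A.det) * aeval (l • x) p := by
    rw [aeval_smul_hom hp, hAdet, hBdet]
    have := cf.hd
    rw [show cf.d + 1 = 3 + (cf.d - 2) by omega, pow_add]
    field_simp
  rw [e1]
  exact P.vmullt hlt (P.vpoly _ _ hintg)

/-- Cayley--Bacharach type relation. -/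
def CBr (m : ℕ) (S : Finset (Fin 6 → Ω)) : Prop :=
  ∃ c : (Fin 6 → Ω) → Ω, (∀ x ∈ S, c x ≠ 0) ∧
    ∀ l : Fin m → (Module.Dual Ω (Fin 6 → Ω)), ∑ x ∈ S, c x * ∏ k, l k x = 0

theorem cb_of_pt [IsAlgClosed Ω] (S : Finset (Fin 6 → Ω)) (hS : ∀ x, x ∈ S ↔ Pt fr cf x) : CBr (cf.d - 2) S := by
  refine ⟨JX fr cf, fun x hx => ((hS x).mp hx).JX_ne, fun l => ?_⟩
  have h0 : ∀ p : MvPolynomial (Fin 6) ℂ, p.IsHomogeneous (cf.d - 2) → ∑ x ∈ S, JX fr cf x * aeval x p = 0 := by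
    intro p hp
    apply trace_zero fr S _ (fun σ => actv σ)
    · intro σ x hx; exact (hS _).mpr (((hS x).mp hx).act σ)
    · exact actv_inj
    · intro σ x hx
      rw [((hS x).mp hx).JX_act σ, aeval_actv, map_mul]
    · intro P x hx
      exact ((hS x).mp hx).local_bound P p hp
  have h1 : ∀ x : Fin 6 → Ω, ∏ k, l k x = ∑ f : Fin (cf.d - 2) → Fin 6, (∏ k, l k (Pi.single (f k) 1)) * aeval x (∏ k, X (f k) : MvPolynomial (Fin 6) ℂ) := by
    intro x
    have h2 : ∀ k, l k x = ∑ j, l k (Pi.single j 1) * x j := by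
      intro k
      rw [LinearMap.pi_apply_eq_sum_univ (l k) x]
      apply Finset.sum_congr rfl
      intro j _
      rw [smul_eq_mul, mul_comm]
      congr 2
      ext i; simp [Pi.single_apply, eq_comm]
    simp only [h2, Finset.prod_univ_sum, map_prod, aeval_X]
    rw [← Finset.sum_congr (Fintype.piFinset_univ) (fun _ _ => rfl)]
    apply Finset.sum_congr rfl
    intro f _
    rw [Finset.prod_mul_distrib]
  simp only [h1, Finset.mul_sum]
  rw [Finset.sum_comm]
  apply Finset.sum_eq_zero
  intro f _
  have := h0 (∏ k, X (f k)) (by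
    have := IsHomogeneous.prod Finset.univ (fun k => (X (f k) : MvPolynomial (Fin 6) ℂ)) (fun _ => 1) (fun k _ => isHomogeneous_X _ _)
    simpa using this)
  have h3 := congrArg ((∏ k, l k (Pi.single (f k) 1)) * ·) this
  simp only [mul_zero, Finset.mul_sum] at h3
  rw [← h3]
  apply Finset.sum_congr rfl
  intros; ring
end CI22

namespace CI22
open Module
variable {Ω : Type} [Field Ω] [Algebra ℂ Ω]

/-- nonzero, pairwise independent vectors -/
def Gen (S : Finset (Fin 6 → Ω)) : Prop :=
  (∀ x ∈ S, x ≠ 0) ∧ ∀ x ∈ S, ∀ y ∈ S, x ∈ Submodule.span Ω {y} → x = y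

theorem Gen.mono {S T : Finset (Fin 6 → Ω)} (h : Gen S) (hT : T ⊆ S) : Gen T :=
  ⟨fun x hx => h.1 x (hT hx), fun x hx y hy => h.2 x (hT hx) y (hT hy)⟩

theorem inf_om : Infinite Ω := Infinite.of_injective _ (algebraMap ℂ Ω).injective

open Classical in
/-- points outside a subspace -/
noncomputable def out (S : Finset (Fin 6 → Ω)) (W : Submodule Ω (Fin 6 → Ω)) : Finset (Fin 6 → Ω) := S.filter (· ∉ W)
open Classical in
noncomputable def ins (S : Finset (Fin 6 → Ω)) (W : Submodule Ω (Fin 6 → Ω)) : Finset (Fin 6 → Ω) := S.filter (· ∈ W)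

theorem mem_out {S : Finset (Fin 6 → Ω)} {W x} : x ∈ out S W ↔ x ∈ S ∧ x ∉ W := by simp [out]
theorem mem_ins {S : Finset (Fin 6 → Ω)} {W x} : x ∈ ins S W ↔ x ∈ S ∧ x ∈ W := by simp [ins]
theorem card_ins_out (S : Finset (Fin 6 → Ω)) (W) : (ins S W).card + (out S W).card = S.card := by
  classical
  exact Finset.card_filter_add_card_filter_not _

theorem out_sub (S : Finset (Fin 6 → Ω)) (W) : out S W ⊆ S := fun x hx => (mem_out.mp hx).1
theorem ins_sub (S : Finset (Fin 6 → Ω)) (W) : ins S W ⊆ S := fun x hx => (mem_ins.mp hx).1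

theorem CBr.rem {m : ℕ} {S : Finset (Fin 6 → Ω)} (h : CBr (m + 1) S) (W) : CBr m (out S W) := by
  classical
  haveI := inf_om (Ω := Ω)
  obtain ⟨c, hc, hs⟩ := h
  obtain ⟨φ, hφ, hφ2⟩ : ∃ φ : Dual Ω (Fin 6 → Ω), (∀ x ∈ W, φ x = 0) ∧ ∀ x ∈ CI22.out S W, φ x ≠ 0 := by
    obtain ⟨φ, hφ, h2⟩ := Module.Dual.exists_forall_mem_ne_zero_of_forall_exists (K := Ω) W.dualAnnihilator
      (fun x : CI22.out S W => Module.Dual.eval Ω _ (x : Fin 6 → Ω)) (fun x => by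
        obtain ⟨f, hf, hf2⟩ := Submodule.exists_le_ker_of_notMem (mem_out.mp x.2).2
        exact ⟨f, (Submodule.mem_dualAnnihilator _).mpr (fun w hw => hf2 hw), hf⟩)
    exact ⟨φ, fun x hx => (Submodule.mem_dualAnnihilator _).mp hφ x hx, fun x hx => h2 ⟨x, hx⟩⟩
  refine ⟨fun x => c x * φ x, fun x hx => mul_ne_zero (hc x (out_sub _ _ hx)) (hφ2 x hx), fun l => ?_⟩
  have := hs (Fin.cons φ l)
  rw [← Finset.sum_filter_add_sum_filter_not S (· ∈ W)] at this
  rw [Finset.sum_eq_zero (s := S.filter (· ∈ W)), zero_add] at this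
  · rw [← this, CI22.out]
    apply Finset.sum_congr
    · congr
    · intro x _
      rw [Fin.prod_univ_succ]
      simp [mul_assoc]
  · intro x hx
    rw [Fin.prod_univ_succ]
    simp [hφ x (Finset.mem_filter.mp hx).2]

theorem CBr.not_single {m : ℕ} {x : Fin 6 → Ω} (hx : x ≠ 0) : ¬ CBr m {x} := by
  haveI := inf_om (Ω := Ω)
  rintro ⟨c, hc, hs⟩
  obtain ⟨f, hf⟩ := Module.exists_dual_forall_apply_ne_zero (K := Ω) (fun _ : Unit => x) (fun _ => hx)
  have := hs (fun _ => f)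
  rw [Finset.sum_singleton] at this
  exact mul_ne_zero (hc x (by simp)) (Finset.prod_ne_zero_iff.mpr (fun _ _ => hf ())) this

theorem CBr.card_ge {m : ℕ} {S : Finset (Fin 6 → Ω)} (h : CBr m S) (hG : Gen S) (hne : S.Nonempty) : m + 2 ≤ S.card := by
  induction m generalizing S with
  | zero =>
    have h1 : S.card ≠ 1 := fun h1 => by
      obtain ⟨x, rfl⟩ := Finset.card_eq_one.mp h1
      exact CBr.not_single (hG.1 x (by simp)) h
    have := hne.card_pos
    omega
  | succ m ih =>
    obtain ⟨x, hx⟩ := hne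
    have hi : (ins S (Submodule.span Ω {x})) = {x} := by
      ext y
      rw [mem_ins, Finset.mem_singleton]
      constructor
      · rintro ⟨hy, h2⟩; exact hG.2 y hy x hx h2
      · rintro rfl; exact ⟨hx, Submodule.mem_span_singleton_self _⟩
    have hc := card_ins_out S (Submodule.span Ω {x})
    rw [hi, Finset.card_singleton] at hc
    rcases (out S (Submodule.span Ω {x})).eq_empty_or_nonempty with h0 | h0
    · rw [h0, Finset.card_empty] at hc
      obtain ⟨y, rfl⟩ := Finset.card_eq_one.mp hc.symm
      exact absurd h (CBr.not_single (hG.1 y (by simp)))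
    · have := ih (h.rem _) (hG.mono (out_sub _ _)) h0
      omega

theorem span_small {S : Finset (Fin 6 → Ω)} (k : ℕ) (hk : k ≤ S.card) :
    ∃ W : Submodule Ω (Fin 6 → Ω), finrank Ω W ≤ k ∧ k ≤ (ins S W).card := by
  obtain ⟨T, hT, hc⟩ := Finset.exists_subset_card_eq hk
  refine ⟨Submodule.span Ω (T : Set (Fin 6 → Ω)), hc ▸ finrank_span_finset_le_card T, hc ▸ ?_⟩
  apply Finset.card_le_card
  intro x hx
  exact mem_ins.mpr ⟨hT hx, Submodule.subset_span hx⟩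

theorem CBr.collinear {m : ℕ} {S : Finset (Fin 6 → Ω)} (h : CBr m S) (hG : Gen S) (hc : S.card ≤ 2 * m + 1) :
    ∃ W : Submodule Ω (Fin 6 → Ω), finrank Ω W ≤ 2 ∧ ∀ x ∈ S, x ∈ W := by
  induction m generalizing S with
  | zero =>
    rcases S.eq_empty_or_nonempty with h0 | h0
    · exact ⟨⊥, by simp, by simp [h0]⟩
    · have := h.card_ge hG h0; omega
  | succ m ih =>
    rcases S.eq_empty_or_nonempty with h0 | h0
    · exact ⟨⊥, by simp, by simp [h0]⟩
    have h1 := h.card_ge hG h0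
    obtain ⟨W, hW, hWc⟩ := span_small (S := S) 2 (by omega)
    have e1 := card_ins_out S W
    obtain ⟨W2, hW2, hW2c⟩ := ih (h.rem W) (hG.mono (out_sub _ _)) (by omega)
    by_cases h3 : (out S W).Nonempty
    swap
    · refine ⟨W, hW, fun x hx => ?_⟩
      by_contra h4
      exact h3 ⟨x, mem_out.mpr ⟨hx, h4⟩⟩
    by_cases h4 : (out S W2).Nonempty
    swap
    · refine ⟨W2, hW2, fun x hx => ?_⟩
      by_contra h5
      exact h4 ⟨x, mem_out.mpr ⟨hx, h5⟩⟩
    have c1 := (h.rem W).card_ge (hG.mono (out_sub _ _)) h3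
    have c2 := (h.rem W2).card_ge (hG.mono (out_sub _ _)) h4
    have c3 : (out S W2).card ≤ (ins S W).card := by
      apply Finset.card_le_card
      intro x hx
      rw [mem_out] at hx
      rw [mem_ins]
      refine ⟨hx.1, ?_⟩
      by_contra h5
      exact hx.2 (hW2c x (mem_out.mpr ⟨hx.1, h5⟩))
    omega

theorem CBr.planar {m : ℕ} (hm : 6 ≤ m) {S : Finset (Fin 6 → Ω)} (h : CBr m S) (hG : Gen S) (hc : S.card ≤ 2 * m + 4)
    (hne : S.Nonempty) :
    (∃ W : Submodule Ω (Fin 6 → Ω), finrank Ω W ≤ 3 ∧ ∀ x ∈ S, x ∈ W) ∨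
    ∃ W₁ W₂ : Submodule Ω (Fin 6 → Ω), finrank Ω W₁ ≤ 2 ∧ finrank Ω W₂ ≤ 2 ∧ (∀ x ∈ S, x ∈ W₁ ∨ x ∈ W₂) ∧
      m + 1 ≤ (out S W₁).card ∧ m + 1 ≤ (out S W₂).card := by
  obtain ⟨k, rfl⟩ : ∃ k, m = k + 3 := ⟨m - 3, by omega⟩
  have hS := h.card_ge hG hne
  have hbig : ∃ W : Submodule Ω (Fin 6 → Ω), finrank Ω W ≤ 3 ∧ 5 ≤ (ins S W).card := by
    by_contra hcon
    push Not at hcon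
    have hle : ∀ T ⊆ S, ∀ W : Submodule Ω (Fin 6 → Ω), finrank Ω W ≤ 3 → (ins T W).card ≤ 4 := by
      intro T hT W hW
      have h1 := hcon W hW
      have h2 : (ins T W).card ≤ (ins S W).card := Finset.card_le_card (fun x hx => by
        rw [mem_ins] at hx ⊢; exact ⟨hT hx.1, hx.2⟩)
      omega
    obtain ⟨W1, hW1, c1⟩ := span_small (S := S) 3 (by omega)
    have d1 := card_ins_out S W1
    have l1 := hle S (le_refl _) W1 hW1
    have g1 := hG.mono (out_sub S W1)
    have n1 : (out S W1).Nonempty := Finset.card_pos.mp (by omega)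
    have b1 := (h.rem W1).card_ge g1 n1
    obtain ⟨W2, hW2, c2⟩ := span_small (S := out S W1) 3 (by omega)
    have d2 := card_ins_out (out S W1) W2
    have l2 := hle _ (out_sub S W1) W2 hW2
    have g2 := g1.mono (out_sub _ W2)
    have n2 : (out (out S W1) W2).Nonempty := Finset.card_pos.mp (by omega)
    have b2 := ((h.rem W1).rem W2).card_ge g2 n2
    obtain ⟨W3, hW3, c3⟩ := span_small (S := out (out S W1) W2) 3 (by omega)
    have d3 := card_ins_out (out (out S W1) W2) W3
    have s2 := (out_sub (out S W1) W2).trans (out_sub S W1)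
    have l3 := hle _ s2 W3 hW3
    have g3 := g2.mono (out_sub _ W3)
    have n3 : (out (out (out S W1) W2) W3).Nonempty := Finset.card_pos.mp (by omega)
    have b3 := (((h.rem W1).rem W2).rem W3).card_ge g3 n3
    obtain ⟨L, hL, hL2⟩ := (((h.rem W1).rem W2).rem W3).collinear g3 (by omega)
    have l4 := hle _ ((out_sub _ W3).trans s2) L (by omega)
    have : ins (out (out (out S W1) W2) W3) L = out (out (out S W1) W2) W3 := by
      ext x; rw [mem_ins]; exact ⟨fun h => h.1, fun h => ⟨h, hL2 x h⟩⟩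
    rw [this] at l4
    omega
  obtain ⟨W, hW, hWc⟩ := hbig
  have d1 := card_ins_out S W
  by_cases h3 : (out S W).Nonempty
  swap
  · left
    refine ⟨W, hW, fun x hx => ?_⟩
    by_contra h4
    exact h3 ⟨x, mem_out.mpr ⟨hx, h4⟩⟩
  have b1 := (h.rem W).card_ge (hG.mono (out_sub _ _)) h3
  obtain ⟨L, hL, hL2⟩ := (h.rem W).collinear (hG.mono (out_sub _ _)) (by omega)
  have d2 := card_ins_out S L
  have c2 : (out S W).card ≤ (ins S L).card := Finset.card_le_card (fun x hx => mem_ins.mpr ⟨(mem_out.mp hx).1, hL2 x hx⟩)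
  obtain ⟨L', hL', hL2'⟩ := (h.rem L).collinear (hG.mono (out_sub _ _)) (by omega)
  by_cases n1 : (out S L).Nonempty
  swap
  · left
    refine ⟨L, by omega, fun x hx => ?_⟩
    by_contra h4
    exact n1 ⟨x, mem_out.mpr ⟨hx, h4⟩⟩
  by_cases n2 : (out S L').Nonempty
  swap
  · left
    refine ⟨L', by omega, fun x hx => ?_⟩
    by_contra h4
    exact n2 ⟨x, mem_out.mpr ⟨hx, h4⟩⟩
  right
  refine ⟨L, L', hL, hL', fun x hx => ?_, (h.rem L).card_ge (hG.mono (out_sub _ _)) n1, (h.rem L').card_ge (hG.mono (out_sub _ _)) n2⟩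
  by_cases hx1 : x ∈ L
  · exact Or.inl hx1
  · exact Or.inr (hL2' x (mem_out.mpr ⟨hx, hx1⟩))
end CI22

namespace CI22
open MvPolynomial Module
variable {Ω : Type} [Field Ω] [Algebra ℂ Ω]

noncomputable def hess (q : MvPolynomial (Fin 6) ℂ) (j k : Fin 6) : ℂ := coeff 0 (pderiv k (pderiv j q))

theorem hess_symm (q : MvPolynomial (Fin 6) ℂ) (j k : Fin 6) : hess q j k = hess q k j := by
  unfold hess
  have : ∀ p : MvPolynomial (Fin 6) ℂ, pderiv k (pderiv j p) = pderiv j (pderiv k p) := by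
    intro p
    induction p using MvPolynomial.induction_on with
    | C a => simp
    | add p q hp hq => simp [hp, hq]
    | mul_X p i hp =>
      have h0 : ∀ a b c : Fin 6, pderiv a (Pi.single (M := fun _ => MvPolynomial (Fin 6) ℂ) b 1 c) = 0 := by
        intro a b c
        rw [Pi.single_apply]; split_ifs <;> simp
      simp only [Derivation.leibniz, pderiv_X, smul_eq_mul, map_add, hp, h0]
      ring
  rw [this]

/-- polar form of a quadric -/
noncomputable def Bf (q : MvPolynomial (Fin 6) ℂ) : (Fin 6 → Ω) →ₗ[Ω] (Fin 6 → Ω) →ₗ[Ω] Ω :=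
  LinearMap.mk₂ Ω (fun u v => ∑ j, ∑ k, algebraMap ℂ Ω (hess q j k) * u k * v j)
    (by intros; simp only [Pi.add_apply, mul_add, add_mul, Finset.sum_add_distrib])
    (by intros; simp only [Pi.smul_apply, smul_eq_mul, Finset.mul_sum]
        refine Finset.sum_congr rfl fun _ _ => Finset.sum_congr rfl fun _ _ => by ring)
    (by intros; simp only [Pi.add_apply, mul_add, add_mul, Finset.sum_add_distrib])
    (by intros; simp only [Pi.smul_apply, smul_eq_mul, Finset.mul_sum]
        refine Finset.sum_congr rfl fun _ _ => Finset.sum_congr rfl fun _ _ => by ring)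

theorem Bf_apply (q : MvPolynomial (Fin 6) ℂ) (u v : Fin 6 → Ω) :
    Bf q u v = ∑ j, ∑ k, algebraMap ℂ Ω (hess q j k) * u k * v j := rfl

theorem Bf_symm (q : MvPolynomial (Fin 6) ℂ) (u v : Fin 6 → Ω) : Bf q u v = Bf q v u := by
  rw [Bf_apply, Bf_apply, Finset.sum_comm]
  refine Finset.sum_congr rfl fun _ _ => Finset.sum_congr rfl fun _ _ => ?_
  rw [hess_symm]; ring

theorem gr_eq {q : MvPolynomial (Fin 6) ℂ} (hq : q.IsHomogeneous 2) (u : Fin 6 → Ω) (j : Fin 6) : gr q u j = ∑ k, algebraMap ℂ Ω (hess q j k) * u k := by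
  have h1 : (pderiv j q).IsHomogeneous 1 := hq.pderiv
  have := euler h1 u
  rw [Nat.cast_one, one_mul] at this
  rw [gr, ← this]
  refine Finset.sum_congr rfl fun k _ => ?_
  have h2 : (pderiv k (pderiv j q)).IsHomogeneous 0 := h1.pderiv
  rw [gr, hess]
  rw [← totalDegree_zero_iff_isHomogeneous] at h2
  conv_lhs => rw [totalDegree_eq_zero_iff_eq_C.mp h2, aeval_C]

theorem Bf_gr {q : MvPolynomial (Fin 6) ℂ} (hq : q.IsHomogeneous 2) (u v : Fin 6 → Ω) : Bf q u v = ∑ j, gr q u j * v j := by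
  rw [Bf_apply]
  refine Finset.sum_congr rfl fun j _ => ?_
  rw [gr_eq hq, Finset.sum_mul]

theorem Bf_self {q : MvPolynomial (Fin 6) ℂ} (hq : q.IsHomogeneous 2) (u : Fin 6 → Ω) : Bf q u u = 2 * aeval u q := by
  rw [Bf_gr hq, euler hq]; norm_num

theorem two_ne : (2 : Ω) ≠ 0 := by
  haveI : CharZero Ω := charZero_of_injective_algebraMap (algebraMap ℂ Ω).injective
  exact two_ne_zero
theorem Bf_self_zero {q : MvPolynomial (Fin 6) ℂ} (hq : q.IsHomogeneous 2) (u : Fin 6 → Ω) : aeval u q = 0 ↔ Bf q u u = 0 := by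
  rw [Bf_self hq]; simp [two_ne]

/-- apply a derivation to a vector -/
def dv (Δ : Derivation ℂ Ω Ω) (u : Fin 6 → Ω) : Fin 6 → Ω := fun i => Δ (u i)

theorem dv_Bf (q : MvPolynomial (Fin 6) ℂ) (Δ : Derivation ℂ Ω Ω) (u v : Fin 6 → Ω) :
    Δ (Bf q u v) = Bf q (dv Δ u) v + Bf q u (dv Δ v) := by
  simp only [Bf_apply, map_sum, Derivation.leibniz, smul_eq_mul, Derivation.map_algebraMap, dv, ← Finset.sum_add_distrib]
  refine Finset.sum_congr rfl fun _ _ => Finset.sum_congr rfl fun _ _ => ?_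
  ring

theorem dv_smul (Δ : Derivation ℂ Ω Ω) (a : Ω) (u : Fin 6 → Ω) : dv Δ (a • u) = a • dv Δ u + Δ a • u := by
  ext i; simp [dv, mul_comm]
theorem dv_add (Δ : Derivation ℂ Ω Ω) (u v : Fin 6 → Ω) : dv Δ (u + v) = dv Δ u + dv Δ v := by
  ext i; simp [dv]

theorem Bf_single (q : MvPolynomial (Fin 6) ℂ) (hq : q.IsHomogeneous 2) (u : Fin 6 → Ω) (j : Fin 6) : Bf q u (Pi.single j 1) = gr q u j := by
  rw [Bf_gr hq, Finset.sum_eq_single j] <;> simp +contextual [Pi.single_apply]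

/-- smoothness of `Z` in terms of polar forms -/
theorem Cfg.smB (cf : Cfg Ω) (v : Fin 6 → Ω) (hv : v ≠ 0) (h1 : Bf cf.q1 v v = 0) (h2 : Bf cf.q2 v v = 0) (a b : Ω)
    (h : ∀ w, a * Bf cf.q1 v w + b * Bf cf.q2 v w = 0) : a = 0 ∧ b = 0 :=
  cf.smZ v hv ((Bf_self_zero cf.h1 v).mpr h1) ((Bf_self_zero cf.h2 v).mpr h2) a b (fun i => by
    have := h (Pi.single i 1)
    rwa [Bf_single _ cf.h1, Bf_single _ cf.h2] at this)

theorem quad_split [IsAlgClosed Ω] (p b c : Ω) (hp : p ≠ 0) : ∃ r1 r2 : Ω, ∀ x, p * x ^ 2 + b * x + c = p * (x - r1) * (x - r2) := by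
  have h2 := two_ne (Ω := Ω)
  obtain ⟨z, hz⟩ := IsAlgClosed.exists_pow_nat_eq (b ^ 2 - 4 * p * c) (n := 2) (by norm_num)
  refine ⟨(-b + z) / (2 * p), (-b - z) / (2 * p), fun x => ?_⟩
  field_simp
  linear_combination hz

theorem quad_root [IsAlgClosed Ω] (p b c : Ω) (hp : p ≠ 0) : ∃ x : Ω, p * x ^ 2 + b * x + c = 0 := by
  obtain ⟨r1, r2, h⟩ := quad_split p b c hp
  exact ⟨r1, by rw [h]; ring⟩
end CI22

namespace CI22
open MvPolynomial Module
variable {Ω : Type} [Field Ω] [Algebra ℂ Ω]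

theorem pencil [IsAlgClosed Ω] {A T : Type} [AddCommGroup A] [Module Ω A] [AddCommGroup T] [Module Ω T]
    [FiniteDimensional Ω A] [FiniteDimensional Ω T] (h : finrank Ω A = finrank Ω T) (hA : 0 < finrank Ω A)
    (φ ψ : A →ₗ[Ω] T) : ∃ (a b : Ω) (w : A), (a ≠ 0 ∨ b ≠ 0) ∧ w ≠ 0 ∧ a • φ w + b • ψ w = 0 := by
  haveI : Nontrivial A := Module.finrank_pos_iff.mp hA
  by_cases hi : Function.Injective φ
  · let e := LinearEquiv.ofInjectiveOfFinrankEq φ hi h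
    obtain ⟨μ, hμ⟩ := Module.End.exists_eigenvalue (e.symm.toLinearMap.comp ψ)
    obtain ⟨w, hw⟩ := hμ.exists_hasEigenvector
    refine ⟨-μ, 1, w, Or.inr one_ne_zero, hw.2, ?_⟩
    have h2 := hw.apply_eq_smul
    have h3 : ψ w = μ • φ w := by
      have := congrArg e h2
      simp at this
      rw [this]; rfl
    rw [h3]; simp
  · rw [← LinearMap.ker_eq_bot, LinearMap.ker_eq_bot'] at hi
    push Not at hi
    obtain ⟨w, hw, hw0⟩ := hi
    exact ⟨1, 0, w, Or.inl one_ne_zero, hw0, by simp [hw]⟩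

theorem no_plane [IsAlgClosed Ω] (cf : Cfg Ω) (W : Submodule Ω (Fin 6 → Ω)) (hW : finrank Ω W = 3)
    (h1 : ∀ u ∈ W, ∀ v ∈ W, Bf cf.q1 u v = 0) (h2 : ∀ u ∈ W, ∀ v ∈ W, Bf cf.q2 u v = 0) : False := by
  let mk (q : MvPolynomial (Fin 6) ℂ) (h : ∀ u ∈ W, ∀ v ∈ W, Bf q u v = 0) : W →ₗ[Ω] W.dualAnnihilator :=
    LinearMap.codRestrict W.dualAnnihilator ((Bf q).comp W.subtype)
      (fun u => (Submodule.mem_dualAnnihilator _).mpr (fun v hv => h u u.2 v hv))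
  have hd : finrank Ω W = finrank Ω W.dualAnnihilator := by
    have := Subspace.finrank_add_finrank_dualAnnihilator_eq W
    simp at this
    omega
  obtain ⟨a, b, w, hab, hw, h⟩ := pencil (A := W) (T := W.dualAnnihilator) hd (by rw [hW]; norm_num) (mk cf.q1 h1) (mk cf.q2 h2)
  have := cf.smB w (by simpa using hw) (h1 _ w.2 _ w.2) (h2 _ w.2 _ w.2) a b (fun v => by
    have := congrArg (fun f : W.dualAnnihilator => (f : Dual Ω (Fin 6 → Ω)) v) h
    simpa [mk] using this)
  rcases hab with hab | hab
  · exact hab this.1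
  · exact hab this.2

theorem pol_zero (B : (Fin 6 → Ω) →ₗ[Ω] (Fin 6 → Ω) →ₗ[Ω] Ω) (hs : ∀ u v, B u v = B v u) (W : Submodule Ω (Fin 6 → Ω))
    (h : ∀ u ∈ W, B u u = 0) : ∀ u ∈ W, ∀ v ∈ W, B u v = 0 := by
  intro u hu v hv
  have := h _ (W.add_mem hu hv)
  simp only [map_add, LinearMap.add_apply, h u hu, h v hv, hs v u] at this
  have h2 : 2 * B u v = 0 := by linear_combination this
  exact (mul_eq_zero.mp h2).resolve_left two_ne

theorem span3 (W : Submodule Ω (Fin 6 → Ω)) (hW : finrank Ω W = 3) (x y z : Fin 6 → Ω) (hx : x ∈ W) (hy : y ∈ W) (hz : z ∈ W)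
    (hl : LinearIndependent Ω ![x, y, z]) : ∀ u ∈ W, ∃ a b c : Ω, u = a • x + b • y + c • z := by
  have hle : Submodule.span Ω {x, y, z} ≤ W := by
    rw [Submodule.span_le]; rintro _ (rfl | rfl | rfl) <;> assumption
  have hf := finrank_span_eq_card hl
  have hr : Set.range ![x, y, z] = {x, y, z} := by simp [Matrix.range_cons, Matrix.range_empty]; ext; simp; tauto
  rw [hr] at hf
  have he := Submodule.eq_of_le_of_finrank_eq hle (by rw [hf, hW]; rfl)
  intro u hu
  rw [← he, Submodule.mem_span_triple] at hu
  obtain ⟨a, b, c, h⟩ := hu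
  exact ⟨a, b, c, h.symm⟩

theorem sing_factor [IsAlgClosed Ω] (B : (Fin 6 → Ω) →ₗ[Ω] (Fin 6 → Ω) →ₗ[Ω] Ω) (hs : ∀ u v, B u v = B v u)
    (W : Submodule Ω (Fin 6 → Ω)) (hW : finrank Ω W = 3) (w : Fin 6 → Ω) (hw : w ∈ W) (hw0 : w ≠ 0) (hr : ∀ u ∈ W, B w u = 0)
    (v : Fin 6 → Ω) (hv : v ∈ W) (hv0 : B v v ≠ 0) :
    ∃ L₁ L₂ : Submodule Ω (Fin 6 → Ω), finrank Ω L₁ ≤ 2 ∧ finrank Ω L₂ ≤ 2 ∧ ∀ u ∈ W, B u u = 0 → u ∈ L₁ ∨ u ∈ L₂ := by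
  classical
  have hl2 : LinearIndependent Ω ![(⟨v, hv⟩ : W), ⟨w, hw⟩] := by
    rw [LinearIndependent.pair_iff]
    intro a b h
    have h' : a • v + b • w = 0 := by simpa using congrArg Subtype.val h
    have h1 : a * B v v = 0 := by
      have := congrArg (fun x => B x v) h'
      simpa [hr v hv] using this
    have ha := (mul_eq_zero.mp h1).resolve_right hv0
    refine ⟨ha, ?_⟩
    rw [ha] at h'
    simpa [hw0] using h'
  obtain ⟨x, hx⟩ := exists_linearIndependent_cons_of_lt_finrank hl2 (by rw [hW]; norm_num)
  have hl : LinearIndependent Ω ![(x : Fin 6 → Ω), v, w] := by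
    have := hx.map' W.subtype (Submodule.ker_subtype W)
    have e : ![(x : Fin 6 → Ω), v, w] = W.subtype ∘ (Fin.cons x ![(⟨v, hv⟩ : W), ⟨w, hw⟩] : Fin 3 → W) := by
      funext i; fin_cases i <;> rfl
    rw [e]; exact this
  have hsp := span3 W hW _ v w x.2 hv hw hl
  obtain ⟨r1, r2, hr12⟩ := quad_split (B v v) (2 * B x v) (B x x) hv0
  have hfr : ∀ r : Ω, finrank Ω (Submodule.span Ω ({w, x + r • v} : Set (Fin 6 → Ω))) ≤ 2 := by
    intro r
    have := finrank_span_finset_le_card (R := Ω) ({w, (x : Fin 6 → Ω) + r • v} : Finset (Fin 6 → Ω))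
    simp only [Finset.coe_insert, Finset.coe_singleton] at this
    exact this.trans Finset.card_le_two
  refine ⟨Submodule.span Ω {w, x + r1 • v}, Submodule.span Ω {w, x + r2 • v}, hfr r1, hfr r2, ?_⟩
  intro u hu hu0
  obtain ⟨a, b, c, rfl⟩ := hsp u hu
  have hxw : B x w = 0 := by rw [hs]; exact hr _ x.2
  have hvw : B v w = 0 := by rw [hs]; exact hr _ hv
  simp only [map_add, map_smul, LinearMap.add_apply, LinearMap.smul_apply, smul_eq_mul, hr _ x.2, hr _ hv, hr _ hw, hxw, hvw, hs v x] at hu0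
  by_cases ha : a = 0
  · left
    rw [ha] at hu0 ⊢
    have : b ^ 2 * B v v = 0 := by linear_combination hu0
    have hb : b = 0 := by simpa [hv0] using this
    rw [hb]
    simp only [zero_smul, zero_add]
    exact Submodule.smul_mem _ _ (Submodule.subset_span (by simp))
  · have h3 := hr12 (b / a)
    have h4 : B v v * (b / a) ^ 2 + 2 * B x v * (b / a) + B x x = 0 := by
      field_simp
      linear_combination hu0
    rw [h4] at h3
    have key : ∀ r, b / a - r = 0 → a • (x : Fin 6 → Ω) + b • v + c • w ∈ Submodule.span Ω ({w, x + r • v} : Set (Fin 6 → Ω)) := by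
      intro r h5
      rw [Submodule.mem_span_pair]
      refine ⟨c, a, ?_⟩
      have : b = a * r := by
        have := sub_eq_zero.mp h5
        field_simp at this; exact this
      rw [this]; module
    rcases mul_eq_zero.mp h3.symm with h5 | h5
    · exact Or.inl (key r1 ((mul_eq_zero.mp h5).resolve_left hv0))
    · exact Or.inr (key r2 h5)

/-- `S` lies on two lines, each with many points -/
structure TwoLines (m : ℕ) (S : Finset (Fin 6 → Ω)) (W₁ W₂ : Submodule Ω (Fin 6 → Ω)) : Prop where
  f1 : finrank Ω W₁ ≤ 2
  f2 : finrank Ω W₂ ≤ 2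
  cov : ∀ x ∈ S, x ∈ W₁ ∨ x ∈ W₂
  c1 : m + 1 ≤ (ins S W₁).card
  c2 : m + 1 ≤ (ins S W₂).card

structure SmoothPlane (cf : Cfg Ω) (S : Finset (Fin 6 → Ω)) (W : Submodule Ω (Fin 6 → Ω)) (p r : MvPolynomial (Fin 6) ℂ) : Prop where
  fW : finrank Ω W = 3
  sub : ∀ x ∈ S, x ∈ W
  which : (p = cf.q1 ∧ r = cf.q2) ∨ (p = cf.q2 ∧ r = cf.q1)
  nd : ∀ w ∈ W, w ≠ 0 → ∃ u ∈ W, Bf p w u ≠ 0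
  prop : ∃ a : Ω, ∀ u ∈ W, Bf r u u = a * Bf p u u

theorem two_of_cover {m : ℕ} (hm : 1 ≤ m) {S : Finset (Fin 6 → Ω)} (h : CBr m S) (hG : Gen S) (hne : S.Nonempty)
    (W₁ W₂ : Submodule Ω (Fin 6 → Ω)) (f1 : finrank Ω W₁ ≤ 2) (f2 : finrank Ω W₂ ≤ 2) (hc : ∀ x ∈ S, x ∈ W₁ ∨ x ∈ W₂) :
    ∃ W₁ W₂, TwoLines m S W₁ W₂ := by
  obtain ⟨k, rfl⟩ : ∃ k, m = k + 1 := ⟨m - 1, by omega⟩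
  have hS := h.card_ge hG hne
  have one : ∀ W : Submodule Ω (Fin 6 → Ω), finrank Ω W ≤ 2 → ¬ (out S W).Nonempty → TwoLines (k + 1) S W W := by
    intro W hW h0
    have hin : ∀ x ∈ S, x ∈ W := fun x hx => by
      by_contra h4
      exact h0 ⟨x, mem_out.mpr ⟨hx, h4⟩⟩
    have he : S ⊆ ins S W := fun x hx => mem_ins.mpr ⟨hx, hin x hx⟩
    have := Finset.card_le_card he
    exact ⟨hW, hW, fun x hx => Or.inl (hin x hx), by omega, by omega⟩
  by_cases h1 : (out S W₁).Nonempty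
  swap
  · exact ⟨_, _, one W₁ f1 h1⟩
  by_cases h2 : (out S W₂).Nonempty
  swap
  · exact ⟨_, _, one W₂ f2 h2⟩
  have b1 := (h.rem W₁).card_ge (hG.mono (out_sub _ _)) h1
  have b2 := (h.rem W₂).card_ge (hG.mono (out_sub _ _)) h2
  have s1 : out S W₁ ⊆ ins S W₂ := fun x hx => by
    rw [mem_out] at hx; exact mem_ins.mpr ⟨hx.1, (hc x hx.1).resolve_left hx.2⟩
  have s2 : out S W₂ ⊆ ins S W₁ := fun x hx => by
    rw [mem_out] at hx; exact mem_ins.mpr ⟨hx.1, (hc x hx.1).resolve_right hx.2⟩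
  have := Finset.card_le_card s1
  have := Finset.card_le_card s2
  exact ⟨W₁, W₂, f1, f2, hc, by omega, by omega⟩

theorem plane_cases [IsAlgClosed Ω] (cf : Cfg Ω) {m : ℕ} (hm : 6 ≤ m) {S : Finset (Fin 6 → Ω)} (h : CBr m S) (hG : Gen S)
    (hc : S.card ≤ 2 * m + 4) (hne : S.Nonempty) (hz1 : ∀ x ∈ S, Bf cf.q1 x x = 0) (hz2 : ∀ x ∈ S, Bf cf.q2 x x = 0) :
    (∃ W₁ W₂, TwoLines m S W₁ W₂) ∨ ∃ W p r, SmoothPlane cf S W p r := by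
  rcases h.planar hm hG hc hne with ⟨W, hW, hWS⟩ | ⟨W₁, W₂, f1, f2, hcov, _⟩
  swap
  · exact Or.inl (two_of_cover (by omega) h hG hne W₁ W₂ f1 f2 hcov)
  by_cases hW2 : finrank Ω W ≤ 2
  · exact Or.inl (two_of_cover (by omega) h hG hne W W hW2 hW2 (fun x hx => Or.inl (hWS x hx)))
  have hW3 : finrank Ω W = 3 := by omega
  by_cases hT : ∃ W₁ W₂, TwoLines m S W₁ W₂
  · exact Or.inl hT
  right
  -- a singular member is identically zero
  have hsing : ∀ a b : Ω, ∀ w ∈ W, w ≠ 0 → (∀ u ∈ W, a * Bf cf.q1 w u + b * Bf cf.q2 w u = 0) →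
      ∀ u ∈ W, a * Bf cf.q1 u u + b * Bf cf.q2 u u = 0 := by
    intro a b w hw hw0 hr
    by_contra hcon
    push Not at hcon
    obtain ⟨v, hv, hv0⟩ := hcon
    obtain ⟨L1, L2, g1, g2, hL⟩ := sing_factor (a • Bf cf.q1 + b • Bf cf.q2)
      (fun u v => by simp [Bf_symm cf.q1 u v, Bf_symm cf.q2 u v]) W hW3 w hw hw0 (fun u hu => by simpa using hr u hu) v hv (by simpa using hv0)
    exact hT (two_of_cover (by omega) h hG hne L1 L2 g1 g2 (fun x hx => hL x (hWS x hx) (by simp [hz1 x hx, hz2 x hx])))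
  obtain ⟨a, b, w, hab, hw0, hwr⟩ := pencil (A := W) (T := Dual Ω W) (by rw [Subspace.dual_finrank_eq]) (by omega)
    ((Bf cf.q1).domRestrict₁₂ W W) ((Bf cf.q2).domRestrict₁₂ W W)
  have hz := hsing a b w w.2 (by simpa using hw0) (fun u hu => by
    have := congrArg (fun f : Dual Ω W => f ⟨u, hu⟩) hwr
    simpa [LinearMap.domRestrict₁₂_apply] using this)
  -- the general conclusion
  have fin : ∀ p r : MvPolynomial (Fin 6) ℂ, (p = cf.q1 ∧ r = cf.q2) ∨ (p = cf.q2 ∧ r = cf.q1) → ∀ c : Ω, (∀ u ∈ W, Bf r u u = c * Bf p u u) →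
      SmoothPlane cf S W p r := by
    intro p r hpr c hpc
    refine ⟨hW3, hWS, hpr, ?_, c, hpc⟩
    by_contra hcon
    push Not at hcon
    obtain ⟨w, hw, hw0, hwr⟩ := hcon
    have hp0 : ∀ u ∈ W, Bf p u u = 0 := by
      rcases hpr with ⟨rfl, rfl⟩ | ⟨rfl, rfl⟩
      · intro u hu
        have := hsing 1 0 w hw hw0 (fun u hu => by simp [hwr u hu]) u hu
        simpa using this
      · intro u hu
        have := hsing 0 1 w hw hw0 (fun u hu => by simp [hwr u hu]) u hu
        simpa using this
    have hr0 : ∀ u ∈ W, Bf r u u = 0 := fun u hu => by rw [hpc u hu, hp0 u hu, mul_zero]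
    have e1 := pol_zero _ (Bf_symm p) W hp0
    have e2 := pol_zero _ (Bf_symm r) W hr0
    rcases hpr with ⟨rfl, rfl⟩ | ⟨rfl, rfl⟩
    · exact no_plane cf W hW3 e1 e2
    · exact no_plane cf W hW3 e2 e1
  by_cases ha : a = 0
  · have hb : b ≠ 0 := by rcases hab with h | h; exacts [absurd ha h, h]
    exact ⟨W, cf.q1, cf.q2, fin _ _ (Or.inl ⟨rfl, rfl⟩) 0 (fun u hu => by
      have := hz u hu
      rw [ha] at this; simpa [hb] using this)⟩
  · exact ⟨W, cf.q2, cf.q1, fin _ _ (Or.inr ⟨rfl, rfl⟩) (-b / a) (fun u hu => by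
      have := hz u hu
      field_simp
      linear_combination this)⟩
end CI22

namespace CI22
open MvPolynomial Module
variable {Ω : Type} [Field Ω] [Algebra ℂ Ω] {fr : Frame Ω} {cf : Cfg Ω}

theorem gen_of_pt (S : Finset (Fin 6 → Ω)) (hS : ∀ x ∈ S, Pt fr cf x) : Gen S := by
  refine ⟨fun x hx => (hS x hx).ne_zero, fun x hx y hy h => ?_⟩
  obtain ⟨a, ha⟩ := Submodule.mem_span_singleton.mp h
  have hx0 := (hS x hx).ne_zero
  obtain ⟨i, hi, hi2⟩ := (hS x hx).norm
  obtain ⟨j, hj, hj2⟩ := (hS y hy).norm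
  have ha0 : a ≠ 0 := by rintro rfl; exact hx0 (by rw [← ha, zero_smul])
  have e : ∀ k, a * y k = x k := fun k => by rw [← ha]; rfl
  have hij : i = j := by
    rcases lt_trichotomy i j with h | h | h
    · have := e i; rw [hj2 i h, hi] at this; simp at this
    · exact h
    · have := e j; rw [hi2 j h, hj] at this; simp [ha0] at this
  subst hij
  have := e i
  rw [hi, hj, mul_one] at this
  rw [← ha, this, one_smul]

theorem Gen.li {S : Finset (Fin 6 → Ω)} (hG : Gen S) {x y : Fin 6 → Ω} (hx : x ∈ S) (hy : y ∈ S) (hxy : x ≠ y) (a b : Ω)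
    (h : a • x + b • y = 0) : a = 0 ∧ b = 0 := by
  have hb : b = 0 := by
    by_contra hb
    have : y ∈ Submodule.span Ω {x} := Submodule.mem_span_singleton.mpr ⟨-a / b, by
      have h2 : b • y = -a • x := by rw [neg_smul]; exact (neg_eq_of_add_eq_zero_right h).symm
      rw [div_eq_inv_mul, mul_smul, ← h2, inv_smul_smul₀ hb]⟩
    exact hxy (hG.2 y hy x hx this).symm
  rw [hb, zero_smul, add_zero] at h
  exact ⟨(smul_eq_zero.mp h).resolve_right (hG.1 x hx), hb⟩

theorem Gen.third {S : Finset (Fin 6 → Ω)} (hG : Gen S) {x y z : Fin 6 → Ω} (hx : x ∈ S) (hy : y ∈ S) (hz : z ∈ S)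
    (hzx : z ≠ x) (hzy : z ≠ y) (h : z ∈ Submodule.span Ω {x, y}) : ∃ a b : Ω, a ≠ 0 ∧ b ≠ 0 ∧ z = a • x + b • y := by
  obtain ⟨a, b, h⟩ := Submodule.mem_span_pair.mp h
  refine ⟨a, b, ?_, ?_, h.symm⟩
  · rintro rfl
    exact hzy (hG.2 z hz y hy (Submodule.mem_span_singleton.mpr ⟨b, by rw [← h]; simp⟩))
  · rintro rfl
    exact hzx (hG.2 z hz x hx (Submodule.mem_span_singleton.mpr ⟨a, by rw [← h]; simp⟩))

theorem iso_line (B : (Fin 6 → Ω) →ₗ[Ω] (Fin 6 → Ω) →ₗ[Ω] Ω) (hs : ∀ u v, B u v = B v u) (x y : Fin 6 → Ω) (a b : Ω)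
    (ha : a ≠ 0) (hb : b ≠ 0) (hx : B x x = 0) (hy : B y y = 0) (hz : B (a • x + b • y) (a • x + b • y) = 0) : B x y = 0 := by
  simp only [map_add, map_smul, LinearMap.add_apply, LinearMap.smul_apply, smul_eq_mul, hx, hy, hs y x] at hz
  have : (2 * a * b) * B x y = 0 := by linear_combination hz
  exact (mul_eq_zero.mp this).resolve_left (mul_ne_zero (mul_ne_zero two_ne ha) hb)

theorem span_pair_eq {W : Submodule Ω (Fin 6 → Ω)} (hW : finrank Ω W ≤ 2) {x y : Fin 6 → Ω} (hx : x ∈ W) (hy : y ∈ W)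
    (hl : ∀ a b : Ω, a • x + b • y = 0 → a = 0 ∧ b = 0) : W = Submodule.span Ω {x, y} := by
  have hle : Submodule.span Ω {x, y} ≤ W := by
    rw [Submodule.span_le]; rintro _ (rfl | rfl) <;> assumption
  have hf := finrank_span_eq_card (LinearIndependent.pair_iff.mpr hl)
  have hr : Set.range ![x, y] = {x, y} := by simp [Matrix.range_cons, Matrix.range_empty]; ext; simp; tauto
  rw [hr] at hf
  exact (Submodule.eq_of_le_of_finrank_le hle (by rw [hf]; simpa using hW)).symm

theorem smooth_card {m : ℕ} (hm : 6 ≤ m) {S : Finset (Fin 6 → Ω)} (h : CBr m S) (hG : Gen S)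
    (hne : S.Nonempty) (hz1 : ∀ x ∈ S, Bf cf.q1 x x = 0) (hz2 : ∀ x ∈ S, Bf cf.q2 x x = 0)
    {W p r} (hW : SmoothPlane cf S W p r) : 2 * m + 2 ≤ S.card := by
  by_contra hcon
  obtain ⟨L, hL, hLS⟩ := h.collinear hG (by omega)
  have hz : ∀ x ∈ S, Bf p x x = 0 := by
    rcases hW.which with ⟨h0, _⟩ | ⟨h0, _⟩
    · rw [h0]; exact hz1
    · rw [h0]; exact hz2
  have hS := h.card_ge hG hne
  obtain ⟨x, y, z, hx, hy, hz', hxy, hxz, hyz⟩ := Finset.two_lt_card_iff.mp (show 2 < S.card by omega)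
  have hli := hG.li hx hy hxy
  have hsp := span_pair_eq hL (hLS x hx) (hLS y hy) hli
  obtain ⟨a, b, ha, hb, rfl⟩ := hG.third hx hy hz' hxz.symm hyz.symm (hsp ▸ hLS z hz')
  have hB := iso_line (Bf p) (Bf_symm p) x y a b ha hb (hz x hx) (hz y hy) (hz _ hz')
  have hxW := hW.sub x hx
  have hyW := hW.sub y hy
  have hl2 : LinearIndependent Ω ![(⟨x, hxW⟩ : W), ⟨y, hyW⟩] := by
    rw [LinearIndependent.pair_iff]
    intro a b h
    exact hli a b (by simpa using congrArg Subtype.val h)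
  obtain ⟨t, ht⟩ := exists_linearIndependent_cons_of_lt_finrank hl2 (by rw [hW.fW]; norm_num)
  have hl : LinearIndependent Ω ![(t : Fin 6 → Ω), x, y] := by
    have := ht.map' W.subtype (Submodule.ker_subtype W)
    have e : ![(t : Fin 6 → Ω), x, y] = W.subtype ∘ (Fin.cons t ![(⟨x, hxW⟩ : W), ⟨y, hyW⟩] : Fin 3 → W) := by
      funext i; fin_cases i <;> rfl
    rw [e]; exact this
  have hsp3 := span3 W hW.fW t x y t.2 hxW hyW hl
  obtain ⟨c, e, hce, hw⟩ : ∃ c e : Ω, (c ≠ 0 ∨ e ≠ 0) ∧ c * Bf p x t + e * Bf p y t = 0 := by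
    by_cases h0 : Bf p x t = 0
    · exact ⟨1, 0, Or.inl one_ne_zero, by rw [h0]; ring⟩
    · exact ⟨-Bf p y t, Bf p x t, Or.inr h0, by ring⟩
  have hw0 : c • x + e • y ≠ 0 := fun h0 => by
    obtain ⟨h1, h2⟩ := hli c e h0
    rcases hce with h | h
    · exact h h1
    · exact h h2
  obtain ⟨u, hu, hu0⟩ := hW.nd (c • x + e • y) (W.add_mem (W.smul_mem _ hxW) (W.smul_mem _ hyW)) hw0
  apply hu0
  obtain ⟨a1, a2, a3, rfl⟩ := hsp3 u hu
  simp only [map_add, map_smul, LinearMap.add_apply, LinearMap.smul_apply, smul_eq_mul, hz x hx, hz y hy, hB, Bf_symm p y x]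
  linear_combination a1 * hw
end CI22

namespace CI22
open MvPolynomial Module Matrix
variable {Ω : Type} [Field Ω] [Algebra ℂ Ω] {fr : Frame Ω} {cf : Cfg Ω}

noncomputable def NL (cf : Cfg Ω) (u v : Fin 6 → Ω) : Matrix (Fin 4) (Fin 6) Ω := ![gr cf.q1 u, gr cf.q2 u, gr cf.q1 v, gr cf.q2 v]
def UL (u v : Fin 6 → Ω) : Matrix (Fin 6) (Fin 2) Ω := fun i => ![u i, v i]

structure InZ (cf : Cfg Ω) (u v : Fin 6 → Ω) : Prop where
  li : ∀ a b : Ω, a • u + b • v = 0 → a = 0 ∧ b = 0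
  a1 : Bf cf.q1 u u = 0
  b1 : Bf cf.q1 u v = 0
  c1 : Bf cf.q1 v v = 0
  a2 : Bf cf.q2 u u = 0
  b2 : Bf cf.q2 u v = 0
  c2 : Bf cf.q2 v v = 0

theorem NL_mulVec (u v w : Fin 6 → Ω) : NL cf u v *ᵥ w = ![Bf cf.q1 u w, Bf cf.q2 u w, Bf cf.q1 v w, Bf cf.q2 v w] := by
  rw [Bf_gr cf.h1, Bf_gr cf.h2, Bf_gr cf.h1, Bf_gr cf.h2]
  ext i
  fin_cases i <;> rfl

theorem vecMul_NL (u v w : Fin 6 → Ω) (c : Fin 4 → Ω) (h : c ᵥ* NL cf u v = 0) :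
    c 0 * Bf cf.q1 u w + c 1 * Bf cf.q2 u w + c 2 * Bf cf.q1 v w + c 3 * Bf cf.q2 v w = 0 := by
  have : c ⬝ᵥ (NL cf u v *ᵥ w) = 0 := by rw [dotProduct_mulVec, h, zero_dotProduct]
  rw [NL_mulVec, dotProduct, Fin.sum_univ_four] at this
  simpa using this

theorem InZ.combo {u v : Fin 6 → Ω} (h : InZ cf u v) (a b c e : Ω) :
    Bf cf.q1 (a • u + b • v) (c • u + e • v) = 0 ∧ Bf cf.q2 (a • u + b • v) (c • u + e • v) = 0 := by
  constructor
  · simp [h.a1, h.b1, h.c1, Bf_symm cf.q1 v u]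
  · simp [h.a2, h.b2, h.c2, Bf_symm cf.q2 v u]

theorem InZ.sm4 {u v : Fin 6 → Ω} (h : InZ cf u v) (c : Fin 4 → Ω) (hc : c ᵥ* NL cf u v = 0) (hd : c 0 * c 3 = c 1 * c 2) : c = 0 := by
  have key := fun w => vecMul_NL u v w c hc
  suffices hh : c 0 = 0 ∧ c 1 = 0 ∧ c 2 = 0 ∧ c 3 = 0 by
    ext i; fin_cases i
    exacts [hh.1, hh.2.1, hh.2.2.1, hh.2.2.2]
  have hv0 : v ≠ 0 := fun h0 => by
    have := (h.li 0 1 (by rw [h0]; simp)).2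
    exact one_ne_zero this
  have h01 : c 0 = 0 ∧ c 1 = 0 := by
    have step : ∀ μ : Ω, (c 2 = μ * c 0) → (c 3 = μ * c 1) → c 0 = 0 ∧ c 1 = 0 := by
      intro μ h2 h3
      have e : u + μ • v = (1 : Ω) • u + μ • v := by rw [one_smul]
      apply cf.smB (u + μ • v) (fun h0 => one_ne_zero (h.li 1 μ (by rw [one_smul]; exact h0)).1)
      · rw [e]; exact (h.combo 1 μ 1 μ).1
      · rw [e]; exact (h.combo 1 μ 1 μ).2
      · intro w
        simp only [map_add, map_smul, LinearMap.add_apply, LinearMap.smul_apply, smul_eq_mul]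
        have := key w
        rw [h2, h3] at this
        linear_combination this
    by_cases h0 : c 0 = 0
    · by_cases h1 : c 1 = 0
      · exact ⟨h0, h1⟩
      · have h2 : c 2 = 0 := by
          rw [h0, zero_mul] at hd
          exact (mul_eq_zero.mp hd.symm).resolve_left h1
        exact step (c 3 / c 1) (by rw [h0, h2]; simp) (by field_simp)
    · exact step (c 2 / c 0) (by field_simp) (by field_simp; linear_combination hd)
  have h23 : c 2 = 0 ∧ c 3 = 0 := by
    apply cf.smB v hv0 h.c1 h.c2
    intro w
    have := key w
    rw [h01.1, h01.2] at this
    linear_combination this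
  exact ⟨h01.1, h01.2, h23.1, h23.2⟩

theorem InZ.ker4 [IsAlgClosed Ω] {u v : Fin 6 → Ω} (h : InZ cf u v) (c d : Fin 4 → Ω) (hc : c ᵥ* NL cf u v = 0) (hd : d ᵥ* NL cf u v = 0)
    (hd0 : d ≠ 0) : ∃ τ : Ω, c = τ • d := by
  have hQ : d 0 * d 3 - d 1 * d 2 ≠ 0 := fun h0 => hd0 (h.sm4 d hd (by linear_combination h0))
  obtain ⟨τ, hτ⟩ := quad_root (d 0 * d 3 - d 1 * d 2) (c 0 * d 3 + d 0 * c 3 - c 1 * d 2 - d 1 * c 2) (c 0 * c 3 - c 1 * c 2) hQ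
  have := h.sm4 (c + τ • d) (by rw [add_vecMul, smul_vecMul, hc, hd]; simp) (by simp; linear_combination hτ)
  exact ⟨-τ, by rw [neg_smul]; exact eq_neg_of_add_eq_zero_left this⟩

def e42 : Fin 4 ⊕ Fin 2 ≃ Fin 6 := finSumFinEquiv

theorem InZ.NU {u v : Fin 6 → Ω} (h : InZ cf u v) : NL cf u v * UL u v = 0 := by
  have h1 := NL_mulVec (cf := cf) u v u
  have h2 := NL_mulVec (cf := cf) u v v
  ext i j
  fin_cases j
  · have := congrFun h1 i
    rw [Bf_symm cf.q1 v u, Bf_symm cf.q2 v u, h.a1, h.a2, h.b1, h.b2] at this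
    refine Eq.trans this ?_
    fin_cases i <;> rfl
  · have := congrFun h2 i
    rw [h.c1, h.c2, h.b1, h.b2] at this
    refine Eq.trans this ?_
    fin_cases i <;> rfl

open Classical in
noncomputable def rhoL (cf : Cfg Ω) (u v : Fin 6 → Ω) : Ω :=
  if h : ∃ ρ, IsRho e42 (NL cf u v) (UL u v) ρ then h.choose else 0

theorem rhoL_eq {u v : Fin 6 → Ω} {ρ} (h : IsRho e42 (NL cf u v) (UL u v) ρ) : rhoL cf u v = ρ := by
  have h2 : ∃ ρ, IsRho e42 (NL cf u v) (UL u v) ρ := ⟨ρ, h⟩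
  rw [rhoL, dif_pos h2]
  exact h2.choose_spec.unique h

theorem rhoL_none {u v : Fin 6 → Ω} (h : ¬ ∃ ρ, IsRho e42 (NL cf u v) (UL u v) ρ) : rhoL cf u v = 0 := by
  rw [rhoL, dif_neg h]

theorem UL_inj {u v : Fin 6 → Ω} (h : InZ cf u v) (c : Fin 2 → Ω) (hc : UL u v *ᵥ c = 0) : c = 0 := by
  have := h.li (c 0) (c 1) (by
    ext i
    have := congrFun hc i
    simp [mulVec, dotProduct, Fin.sum_univ_two, UL] at this
    simp; linear_combination this)
  ext i; fin_cases i
  exacts [this.1, this.2]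

/-- change of basis -/
theorem rhoL_basis {u v : Fin 6 → Ω} (a b c e : Ω) (hD : a * e - b * c ≠ 0) :
    rhoL cf (a • u + b • v) (c • u + e • v) * (a * e - b * c) = rhoL cf u v := by
  have key : ∀ (u v : Fin 6 → Ω) (a b c e : Ω) (hD : a * e - b * c ≠ 0) (ρ : Ω), IsRho e42 (NL cf u v) (UL u v) ρ →
      IsRho e42 (NL cf (a • u + b • v) (c • u + e • v)) (UL (a • u + b • v) (c • u + e • v)) (ρ / (a * e - b * c)) := by
    intro u v a b c e hD ρ hρ
    let A : Matrix (Fin 4) (Fin 4) Ω := !![a, 0, b, 0; 0, a, 0, b; c, 0, e, 0; 0, c, 0, e]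
    let B : Matrix (Fin 2) (Fin 2) Ω := !![a, c; b, e]
    have hA : A.det = (a * e - b * c) ^ 2 := by
      simp [A, det_succ_row_zero, Fin.sum_univ_succ, Fin.succAbove]; ring
    have hB : B.det = a * e - b * c := by rw [det_fin_two]; simp [B]; ring
    have := hρ.scale A B (by rw [hA]; exact pow_ne_zero 2 hD)
    rw [hA, hB] at this
    have e1 : A * NL cf u v = NL cf (a • u + b • v) (c • u + e • v) := by
      have hlin : ∀ q : MvPolynomial (Fin 6) ℂ, q.IsHomogeneous 2 → ∀ (a b : Ω) (u v : Fin 6 → Ω) j, gr q (a • u + b • v) j = a * gr q u j + b * gr q v j := by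
        intro q hq a b u v j
        rw [← Bf_single q hq, ← Bf_single q hq, ← Bf_single q hq]; simp
      ext i j
      rw [mul_apply, Fin.sum_univ_four]
      fin_cases i <;> simp [A, NL, hlin _ cf.h1, hlin _ cf.h2]
    have e2 : UL u v * B = UL (a • u + b • v) (c • u + e • v) := by
      ext i j
      rw [mul_apply, Fin.sum_univ_two]
      fin_cases j <;> simp [B, UL] <;> ring
    rw [e1, e2] at this
    convert this using 1
    field_simp
  by_cases h : ∃ ρ, IsRho e42 (NL cf u v) (UL u v) ρ
  · obtain ⟨ρ, h⟩ := h
    rw [rhoL_eq h, rhoL_eq (key u v a b c e hD ρ h)]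
    field_simp
  · rw [rhoL_none h, rhoL_none, zero_mul]
    rintro ⟨ρ, h2⟩
    apply h
    set D := a * e - b * c with hDd
    have := key _ _ (e / D) (-b / D) (-c / D) (a / D) (by
      have : e / D * (a / D) - -b / D * (-c / D) = D⁻¹ := by field_simp; rw [hDd]; ring
      rw [this]; exact inv_ne_zero hD) ρ h2
    have e1 : (e / D) • (a • u + b • v) + (-b / D) • (c • u + e • v) = u := by
      have : (e / D) • (a • u + b • v) + (-b / D) • (c • u + e • v) = ((a * e - b * c) / D) • u := by module
      rw [this, ← hDd, div_self hD, one_smul]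
    have e2 : (-c / D) • (a • u + b • v) + (a / D) • (c • u + e • v) = v := by
      have : (-c / D) • (a • u + b • v) + (a / D) • (c • u + e • v) = ((a * e - b * c) / D) • v := by module
      rw [this, ← hDd, div_self hD, one_smul]
    rw [e1, e2] at this
    exact ⟨_, this⟩

/-- the invariant differential attached to a line in `Z` -/
noncomputable def al (cf : Cfg Ω) (q : MvPolynomial (Fin 6) ℂ) (Δ : Derivation ℂ Ω Ω) (u v : Fin 6 → Ω) : Ω :=
  Bf q u (dv Δ v) * rhoL cf u v

theorem eta_anti (q : MvPolynomial (Fin 6) ℂ) (Δ : Derivation ℂ Ω Ω) (u v : Fin 6 → Ω) (h : Bf q u v = 0) :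
    Bf q v (dv Δ u) = - Bf q u (dv Δ v) := by
  have := dv_Bf q Δ u v
  rw [h, map_zero, Bf_symm q (dv Δ u) v] at this
  linear_combination -this

theorem eta_self (q : MvPolynomial (Fin 6) ℂ) (Δ : Derivation ℂ Ω Ω) (u : Fin 6 → Ω) (h : Bf q u u = 0) :
    Bf q u (dv Δ u) = 0 := by
  have := eta_anti q Δ u u h
  have h2 : 2 * Bf q u (dv Δ u) = 0 := by linear_combination this
  exact (mul_eq_zero.mp h2).resolve_left two_ne

theorem eta_basis (q : MvPolynomial (Fin 6) ℂ) (Δ : Derivation ℂ Ω Ω) (u v : Fin 6 → Ω) (h1 : Bf q u u = 0) (h2 : Bf q u v = 0)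
    (h3 : Bf q v v = 0) (a b c e : Ω) : Bf q (a • u + b • v) (dv Δ (c • u + e • v)) = (a * e - b * c) * Bf q u (dv Δ v) := by
  rw [dv_add, dv_smul, dv_smul]
  simp only [map_add, map_smul, LinearMap.add_apply, LinearMap.smul_apply, smul_eq_mul, h1, h2, h3, Bf_symm q v u,
    eta_self q Δ u h1, eta_self q Δ v h3, eta_anti q Δ u v h2]
  ring

theorem al_basis1 {u v : Fin 6 → Ω} (h : InZ cf u v) (Δ : Derivation ℂ Ω Ω) (a b c e : Ω) (hD : a * e - b * c ≠ 0) :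
    al cf cf.q1 Δ (a • u + b • v) (c • u + e • v) = al cf cf.q1 Δ u v := by
  rw [al, al, eta_basis _ _ _ _ h.a1 h.b1 h.c1, show rhoL cf u v = _ from (rhoL_basis (u := u) (v := v) a b c e hD).symm]; ring
theorem al_basis2 {u v : Fin 6 → Ω} (h : InZ cf u v) (Δ : Derivation ℂ Ω Ω) (a b c e : Ω) (hD : a * e - b * c ≠ 0) :
    al cf cf.q2 Δ (a • u + b • v) (c • u + e • v) = al cf cf.q2 Δ u v := by
  rw [al, al, eta_basis _ _ _ _ h.a2 h.b2 h.c2, show rhoL cf u v = _ from (rhoL_basis (u := u) (v := v) a b c e hD).symm]; ring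

theorem Bf_act (q : MvPolynomial (Fin 6) ℂ) (σ : Ω ≃ₐ[fr.K0] Ω) (u v : Fin 6 → Ω) : Bf q (actv σ u) (actv σ v) = σ (Bf q u v) := by
  have hc : ∀ c : ℂ, σ (algebraMap ℂ Ω c) = algebraMap ℂ Ω c := fun c => (σ.restrictScalars ℂ).commutes c
  simp only [Bf_apply, map_sum, map_mul, hc, actv]

theorem rhoL_act (σ : Ω ≃ₐ[fr.K0] Ω) (u v : Fin 6 → Ω) : rhoL cf (actv σ u) (actv σ v) = σ (rhoL cf u v) := by
  have key : ∀ (σ : Ω ≃ₐ[fr.K0] Ω) (u v : Fin 6 → Ω) (ρ : Ω), IsRho e42 (NL cf u v) (UL u v) ρ →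
      IsRho e42 (NL cf (actv σ u) (actv σ v)) (UL (actv σ u) (actv σ v)) (σ ρ) := by
    intro σ u v ρ h
    have := h.map (σ : Ω ≃+* Ω)
    convert this using 1
    · ext i j
      fin_cases i <;> exact gr_actv σ _ _ j
    · ext i j
      fin_cases j <;> rfl
    · rfl
  by_cases h : ∃ ρ, IsRho e42 (NL cf u v) (UL u v) ρ
  · obtain ⟨ρ, h⟩ := h
    rw [rhoL_eq h, rhoL_eq (key σ u v ρ h)]
  · rw [rhoL_none h, rhoL_none, map_zero]
    rintro ⟨ρ, h2⟩
    have := key σ.symm _ _ ρ h2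
    have e : ∀ w : Fin 6 → Ω, actv σ.symm (actv σ w) = w := fun w => by ext i; simp [actv]
    rw [e, e] at this
    exact h ⟨_, this⟩
end CI22

namespace CI22
open MvPolynomial Module Matrix
variable {Ω : Type} [Field Ω] [Algebra ℂ Ω] {fr : Frame Ω} {cf : Cfg Ω}

theorem exists_adj {n : Type} [Fintype n] [DecidableEq n] (G : Matrix n n Ω) (hG : G.det = 0) (k : n)
    (hk : ∀ c : n → Ω, c ᵥ* G = 0 → c k = 0 → c = 0) : ∃ j, G.adjugate j k ≠ 0 := by
  by_contra hcon
  push Not at hcon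
  obtain ⟨f, hf⟩ : ∃ f : n → Ω, ∀ c : n → Ω, c ᵥ* G ≠ f := by
    by_contra h2
    push Not at h2
    have h3 : Function.Surjective G.vecMul := fun f => h2 f
    rw [Matrix.vecMul_surjective_iff_isUnit, Matrix.isUnit_iff_isUnit_det, hG] at h3
    exact not_isUnit_zero h3
  have hdet : (G.updateRow k f).det = 0 := by
    have h4 : (G.updateRow k f).det = ∑ j, f j * G.adjugate j k := by
      have : f = ∑ j, f j • (Pi.single j 1 : n → Ω) := by
        ext i; simp [Finset.sum_apply, Pi.single_apply]
      conv_lhs => rw [← Matrix.cramer_transpose_apply, this, map_sum]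
      rw [Finset.sum_apply]
      refine Finset.sum_congr rfl fun j _ => ?_
      rw [map_smul, Pi.smul_apply, smul_eq_mul, Matrix.cramer_transpose_apply, Matrix.adjugate_apply]
    rw [h4]
    exact Finset.sum_eq_zero fun j _ => by rw [hcon j, mul_zero]
  obtain ⟨v, hv0, hv⟩ := Matrix.exists_vecMul_eq_zero_iff.mpr hdet
  have hrel : ∀ v : n → Ω, v ᵥ* G.updateRow k f = v k • f + (Function.update v k 0) ᵥ* G := by
    intro v
    ext j
    simp only [vecMul, dotProduct, Pi.add_apply, Pi.smul_apply, smul_eq_mul]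
    rw [← Finset.add_sum_erase _ _ (Finset.mem_univ k), ← Finset.add_sum_erase _ (fun i => Function.update v k 0 i * G i j) (Finset.mem_univ k)]
    simp only [Function.update_self, zero_mul, zero_add, updateRow_self]
    congr 1
    refine Finset.sum_congr rfl fun i hi => ?_
    rw [updateRow_ne (Finset.ne_of_mem_erase hi), Function.update_of_ne (Finset.ne_of_mem_erase hi)]
  rw [hrel] at hv
  have hvk : v k = 0 := by
    by_contra h5
    apply hf (-(v k)⁻¹ • Function.update v k 0)
    rw [smul_vecMul, eq_neg_of_add_eq_zero_right hv]
    simp [h5]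
  rw [hvk, zero_smul, zero_add] at hv
  have h6 : Function.update v k 0 = v := by rw [← hvk]; exact Function.update_eq_self _ _
  rw [h6] at hv
  exact hv0 (hk v hv hvk)

variable (P : Place fr)

theorem Place.det_congr {n : Type} [Fintype n] [DecidableEq n] (G G0 : Matrix n n Ω) (h1 : ∀ i j, P.O.valuation (G i j) ≤ 1)
    (h2 : ∀ i j, P.O.valuation (G0 i j) ≤ 1) (h : ∀ i j, P.O.valuation (G i j - G0 i j) < 1) : P.O.valuation (G.det - G0.det) < 1 := by
  let M : Matrix n n P.O := fun i j => ⟨G i j, (P.O.valuation_le_one_iff _).mp (h1 i j)⟩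
  let M0 : Matrix n n P.O := fun i j => ⟨G0 i j, (P.O.valuation_le_one_iff _).mp (h2 i j)⟩
  have e1 : ((M.det : P.O) : Ω) = G.det := RingHom.map_det P.O.subtype M
  have e2 : ((M0.det : P.O) : Ω) = G0.det := RingHom.map_det P.O.subtype M0
  have h3 : IsLocalRing.residue P.O (M.det - M0.det) = 0 := by
    rw [map_sub, RingHom.map_det, RingHom.map_det, sub_eq_zero]
    congr 1
    ext i j
    show IsLocalRing.residue P.O (M i j) = IsLocalRing.residue P.O (M0 i j)
    rw [← sub_eq_zero, ← map_sub, IsLocalRing.residue_eq_zero_iff, ValuationSubring.valuation_lt_one_iff]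
    exact h i j
  rw [IsLocalRing.residue_eq_zero_iff, ValuationSubring.valuation_lt_one_iff] at h3
  rw [← e1, ← e2]
  exact h3

theorem const_det {n : Type} [Fintype n] [DecidableEq n] (G0 : Matrix n n Ω) (h : ∀ i j, fr.ds (G0 i j) = 0) : fr.ds G0.det = 0 := by
  let M : Matrix n n (constF fr.ds) := fun i j => ⟨G0 i j, h i j⟩
  have : ((M.det : constF fr.ds) : Ω) = G0.det := RingHom.map_det (algebraMap (constF fr.ds) Ω) M
  rw [← this]
  exact M.det.2

theorem Place.unit_of_congr {x y : Ω} (hy : fr.ds y = 0) (hy0 : y ≠ 0) (h : P.O.valuation (x - y) < 1) : P.O.valuation x = 1 := by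
  have := P.kval y hy hy0
  rw [← this]
  exact Valuation.map_eq_of_sub_lt _ (by rw [this]; exact h)

theorem Place.vBf (q : MvPolynomial (Fin 6) ℂ) (u v : Fin 6 → Ω) (hu : ∀ i, P.O.valuation (u i) ≤ 1)
    (I : AddSubgroup Ω) (hI : ∀ a x, P.O.valuation a ≤ 1 → x ∈ I → a * x ∈ I) (hv : ∀ i, v i ∈ I) : Bf q u v ∈ I := by
  rw [Bf_apply]
  exact AddSubgroup.sum_mem _ fun j _ => AddSubgroup.sum_mem _ fun k _ => hI _ _ (P.vmul (P.vC _) (hu k)) (hv j)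

/-- maximal ideal and valuation ring as additive subgroups -/
def Place.mI : AddSubgroup Ω where
  carrier := {x | P.O.valuation x < 1}
  add_mem' := fun h1 h2 => P.vaddlt h1 h2
  zero_mem' := by simp
  neg_mem' := fun h => by simpa using h
def Place.oI : AddSubgroup Ω where
  carrier := {x | P.O.valuation x ≤ 1}
  add_mem' := fun h1 h2 => P.vadd h1 h2
  zero_mem' := by simp
  neg_mem' := fun h => by simpa using h

theorem Place.mI_mul (a x : Ω) (h : P.O.valuation a ≤ 1) (hx : x ∈ P.mI) : a * x ∈ P.mI := P.vmullt' h hx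
theorem Place.oI_mul (a x : Ω) (h : P.O.valuation a ≤ 1) (hx : x ∈ P.oI) : a * x ∈ P.oI := P.vmul h hx

theorem Place.Bf_const (q : MvPolynomial (Fin 6) ℂ) (r s : Fin 6 → Ω) (hr : ∀ i, fr.ds (r i) = 0) (hs : ∀ i, fr.ds (s i) = 0) :
    fr.ds (Bf q r s) = 0 := by
  rw [dv_Bf, show dv fr.ds r = 0 from funext hr, show dv fr.ds s = 0 from funext hs]; simp

theorem Place.Bf_congr (q : MvPolynomial (Fin 6) ℂ) (u v r s : Fin 6 → Ω) (hv : ∀ i, P.O.valuation (v i) ≤ 1)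
    (hr : ∀ i, P.O.valuation (r i) ≤ 1) (h1 : ∀ i, P.O.valuation (u i - r i) < 1) (h2 : ∀ i, P.O.valuation (v i - s i) < 1) :
    P.O.valuation (Bf q u v - Bf q r s) < 1 := by
  have : Bf q u v - Bf q r s = Bf q v (u - r) + Bf q r (v - s) := by
    rw [map_sub, map_sub, Bf_symm q v u, Bf_symm q v r]; ring
  rw [this]
  exact P.vaddlt (P.vBf q v (u - r) hv P.mI P.mI_mul h1) (P.vBf q r (v - s) hr P.mI P.mI_mul h2)

/-- saturated bases -/
theorem Place.sat (u v : Fin 6 → Ω) (hli : ∀ a b : Ω, a • u + b • v = 0 → a = 0 ∧ b = 0) :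
    ∃ a b c e : Ω, a * e - b * c ≠ 0 ∧ ∃ u' v' : Fin 6 → Ω, u' = a • u + b • v ∧ v' = c • u + e • v ∧
      (∀ i, P.O.valuation (u' i) ≤ 1) ∧ (∀ i, P.O.valuation (v' i) ≤ 1) ∧ ∃ i0 i1, P.O.valuation (u' i0) = 1 ∧ v' i0 = 0 ∧ P.O.valuation (v' i1) = 1 := by
  have hu0 : u ≠ 0 := fun h0 => one_ne_zero (hli 1 0 (by rw [h0]; simp)).1
  obtain ⟨l, hl, hintg, i0, hi0⟩ := P.primitive u hu0
  have hui : u i0 ≠ 0 := by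
    rintro h; rw [h] at hi0; simp at hi0
  have hv0 : (-(v i0 / u i0)) • u + (1 : Ω) • v ≠ 0 := fun h0 => one_ne_zero (hli _ _ h0).2
  obtain ⟨k, hk, hint2, i1, hi1⟩ := P.primitive _ hv0
  refine ⟨l, 0, k * (-(v i0 / u i0)), k, by simp [hl, hk], _, _, rfl, rfl, ?_, ?_, i0, i1, ?_, ?_, ?_⟩
  · intro i; simpa using hintg i
  · intro i
    have := hint2 i
    simp only [Pi.add_apply, Pi.smul_apply, smul_eq_mul, one_mul, mul_add] at this
    simpa [mul_assoc] using this
  · simpa using hi0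
  · simp; field_simp; ring
  · simp only [Pi.add_apply, Pi.smul_apply, smul_eq_mul, one_mul, mul_add] at hi1
    simpa [mul_assoc] using hi1
end CI22

namespace CI22
open MvPolynomial Module Matrix
variable {Ω : Type} [Field Ω] [Algebra ℂ Ω] {fr : Frame Ω} {cf : Cfg Ω}

def fsel (i0 i1 : Fin 6) : Matrix (Fin 2) (Fin 6) Ω := ![Pi.single i0 1, Pi.single i1 1]
noncomputable def GG (cf : Cfg Ω) (i0 i1 : Fin 6) (u v : Fin 6 → Ω) : Matrix (Fin 4 ⊕ Fin 2) (Fin 4 ⊕ Fin 2) Ω :=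
  stk e42 (NL cf u v) (fsel i0 i1)

theorem GG_inl (i0 i1 : Fin 6) (u v : Fin 6 → Ω) (i : Fin 4) (j) : GG cf i0 i1 u v (Sum.inl i) j = NL cf u v i (e42 j) := rfl
theorem GG_inr (i0 i1 : Fin 6) (u v : Fin 6 → Ω) (i : Fin 2) (j) : GG cf i0 i1 u v (Sum.inr i) j = fsel i0 i1 i (e42 j) := rfl

theorem fsel_mulVec (i0 i1 : Fin 6) (w : Fin 6 → Ω) : fsel i0 i1 *ᵥ w = ![w i0, w i1] := by
  ext i; fin_cases i <;> simp [fsel, mulVec]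

theorem GG_mulVec (i0 i1 : Fin 6) (u v w : Fin 6 → Ω) :
    GG cf i0 i1 u v *ᵥ (w ∘ e42) = Sum.elim ![Bf cf.q1 u w, Bf cf.q2 u w, Bf cf.q1 v w, Bf cf.q2 v w] ![w i0, w i1] := by
  rw [← NL_mulVec, ← fsel_mulVec]
  ext i
  rcases i with i | i
  · simp only [mulVec, dotProduct, Sum.elim_inl, GG_inl, Function.comp]
    exact Equiv.sum_comp e42 (fun j => NL cf u v i j * w j)
  · simp only [mulVec, dotProduct, Sum.elim_inr, GG_inr, Function.comp]
    exact Equiv.sum_comp e42 (fun j => fsel i0 i1 i j * w j)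

theorem GG_ker (i0 i1 : Fin 6) (u v w : Fin 6 → Ω) (c : Fin 4 ⊕ Fin 2 → Ω) (y : Ω) (h : c ⬝ᵥ (GG cf i0 i1 u v *ᵥ (w ∘ e42)) = y) :
    c (Sum.inl 0) * Bf cf.q1 u w + c (Sum.inl 1) * Bf cf.q2 u w + c (Sum.inl 2) * Bf cf.q1 v w + c (Sum.inl 3) * Bf cf.q2 v w
      + c (Sum.inr 0) * w i0 + c (Sum.inr 1) * w i1 = y := by
  rw [← h, GG_mulVec, dotProduct, Fintype.sum_sum_type, Fin.sum_univ_four, Fin.sum_univ_two]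
  simp [add_assoc]

theorem GG_adj (i0 i1 : Fin 6) (u v w : Fin 6 → Ω) (j) :
    (fun k => (GG cf i0 i1 u v).adjugate j k) ⬝ᵥ (GG cf i0 i1 u v *ᵥ (w ∘ e42)) = (GG cf i0 i1 u v).det * w (e42 j) := by
  have : ((GG cf i0 i1 u v).adjugate *ᵥ (GG cf i0 i1 u v *ᵥ (w ∘ e42))) j = (GG cf i0 i1 u v).det * w (e42 j) := by
    rw [mulVec_mulVec, adjugate_mul, smul_mulVec, one_mulVec]; simp
  exact this

theorem InZ.ker_GG {u v : Fin 6 → Ω} (h : InZ cf u v) {i0 i1 : Fin 6} (h0 : v i0 = 0) (hu : u i0 ≠ 0) (hv : v i1 ≠ 0)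
    (c : Fin 4 ⊕ Fin 2 → Ω) (hc : c ᵥ* GG cf i0 i1 u v = 0) : (∀ i, c (Sum.inr i) = 0) ∧ (c ∘ Sum.inl) ᵥ* NL cf u v = 0 := by
  have k := fun w => GG_ker i0 i1 u v w c 0 (by rw [dotProduct_mulVec, hc, zero_dotProduct])
  have k1 := k v
  have k2 := k u
  rw [h.b1, h.b2, h.c1, h.c2, h0] at k1
  rw [h.a1, h.a2, Bf_symm cf.q1 v u, Bf_symm cf.q2 v u, h.b1, h.b2] at k2
  have e1 : c (Sum.inr 1) = 0 := by
    have : c (Sum.inr 1) * v i1 = 0 := by linear_combination k1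
    exact (mul_eq_zero.mp this).resolve_right hv
  rw [e1] at k2
  have e0 : c (Sum.inr 0) = 0 := by
    have : c (Sum.inr 0) * u i0 = 0 := by linear_combination k2
    exact (mul_eq_zero.mp this).resolve_right hu
  refine ⟨fun i => by fin_cases i <;> assumption, ?_⟩
  ext j
  have := congrFun hc (e42.symm j)
  simp only [vecMul, dotProduct, Fintype.sum_sum_type, GG_inl, Equiv.apply_symm_apply, Fin.sum_univ_two, e0, e1] at this
  simpa [vecMul, dotProduct] using this

theorem Place.GG_le (P : Place fr) (i0 i1 : Fin 6) (u v : Fin 6 → Ω) (hu : ∀ i, P.O.valuation (u i) ≤ 1) (hv : ∀ i, P.O.valuation (v i) ≤ 1) (i j) :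
    P.O.valuation (GG cf i0 i1 u v i j) ≤ 1 := by
  rcases i with i | i
  · rw [GG_inl]
    fin_cases i
    · exact P.vpoly _ _ hu
    · exact P.vpoly _ _ hu
    · exact P.vpoly _ _ hv
    · exact P.vpoly _ _ hv
  · rw [GG_inr]
    have : ∀ a b : Fin 6, P.O.valuation ((Pi.single a 1 : Fin 6 → Ω) b) ≤ 1 := by
      intro a b; rw [Pi.single_apply]; split_ifs <;> simp
    fin_cases i
    · exact this _ _
    · exact this _ _

theorem Place.GG_congr (P : Place fr) (i0 i1 : Fin 6) (u v r s : Fin 6 → Ω) (hu : ∀ i, P.O.valuation (u i) ≤ 1) (hv : ∀ i, P.O.valuation (v i) ≤ 1)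
    (hr : ∀ i, P.O.valuation (r i) ≤ 1) (hs : ∀ i, P.O.valuation (s i) ≤ 1)
    (h1 : ∀ i, P.O.valuation (u i - r i) < 1) (h2 : ∀ i, P.O.valuation (v i - s i) < 1) (i j) :
    P.O.valuation (GG cf i0 i1 u v i j - GG cf i0 i1 r s i j) < 1 := by
  rcases i with i | i
  · rw [GG_inl, GG_inl]
    fin_cases i
    · exact P.cpoly _ _ _ hu hr h1
    · exact P.cpoly _ _ _ hu hr h1
    · exact P.cpoly _ _ _ hv hs h2
    · exact P.cpoly _ _ _ hv hs h2
  · rw [GG_inr, GG_inr]; simp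

theorem GG_const (i0 i1 : Fin 6) (r s : Fin 6 → Ω) (hr : ∀ i, fr.ds (r i) = 0) (hs : ∀ i, fr.ds (s i) = 0) (i j) :
    fr.ds (GG cf i0 i1 r s i j) = 0 := by
  rcases i with i | i
  · rw [GG_inl]
    fin_cases i
    · exact Place.const_aeval _ _ hr
    · exact Place.const_aeval _ _ hr
    · exact Place.const_aeval _ _ hs
    · exact Place.const_aeval _ _ hs
  · rw [GG_inr]
    have : ∀ a b : Fin 6, fr.ds ((Pi.single a 1 : Fin 6 → Ω) b) = 0 := by
      intro a b; rw [Pi.single_apply]; split_ifs <;> simp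
    fin_cases i
    · exact this _ _
    · exact this _ _

theorem Place.updateRow_le (P : Place fr) {n : Type} [DecidableEq n] (G : Matrix n n Ω) (hG : ∀ i j, P.O.valuation (G i j) ≤ 1) (k l) (i j) :
    P.O.valuation ((G.updateRow k (Pi.single l 1)) i j) ≤ 1 := by
  rw [updateRow_apply]; split_ifs
  · rw [Pi.single_apply]; split_ifs <;> simp
  · exact hG _ _

theorem Place.adj_le (P : Place fr) {n : Type} [Fintype n] [DecidableEq n] (G : Matrix n n Ω) (hG : ∀ i j, P.O.valuation (G i j) ≤ 1) (i j) :
    P.O.valuation (G.adjugate i j) ≤ 1 := by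
  rw [adjugate_apply]; exact P.det_le _ (P.updateRow_le G hG _ _)

theorem Place.adj_congr (P : Place fr) {n : Type} [Fintype n] [DecidableEq n] (G G0 : Matrix n n Ω) (hG : ∀ i j, P.O.valuation (G i j) ≤ 1)
    (hG0 : ∀ i j, P.O.valuation (G0 i j) ≤ 1) (h : ∀ i j, P.O.valuation (G i j - G0 i j) < 1) (i j) :
    P.O.valuation (G.adjugate i j - G0.adjugate i j) < 1 := by
  rw [adjugate_apply, adjugate_apply]
  refine P.det_congr _ _ (P.updateRow_le G hG _ _) (P.updateRow_le G0 hG0 _ _) fun a b => ?_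
  rw [updateRow_apply, updateRow_apply]; split_ifs
  · simp
  · exact h _ _

theorem const_adj {n : Type} [Fintype n] [DecidableEq n] (G0 : Matrix n n Ω) (h : ∀ i j, fr.ds (G0 i j) = 0) (i j) : fr.ds (G0.adjugate i j) = 0 := by
  rw [adjugate_apply]
  refine const_det _ fun a b => ?_
  rw [updateRow_apply]; split_ifs
  · rw [Pi.single_apply]; split_ifs <;> simp
  · exact h _ _

/-- the residual line is again in Z -/
theorem InZ.red (P : Place fr) {u v : Fin 6 → Ω} (h : InZ cf u v) (hu : ∀ i, P.O.valuation (u i) ≤ 1) (hv : ∀ i, P.O.valuation (v i) ≤ 1)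
    (i0 i1 : Fin 6) (h0 : v i0 = 0) (hu1 : P.O.valuation (u i0) = 1) (hv1 : P.O.valuation (v i1) = 1) :
    ∃ r s : Fin 6 → Ω, (∀ i, fr.ds (r i) = 0) ∧ (∀ i, fr.ds (s i) = 0) ∧ (∀ i, P.O.valuation (u i - r i) < 1) ∧
      (∀ i, P.O.valuation (v i - s i) < 1) ∧ InZ cf r s ∧ s i0 = 0 ∧ r i0 ≠ 0 ∧ s i1 ≠ 0 := by
  obtain ⟨r, hr, hur⟩ := P.red u hu
  obtain ⟨s, hs, hvs⟩ := P.red v hv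
  have hri := fun i => P.vconst (hr i)
  have hsi := fun i => P.vconst (hs i)
  have s0 : s i0 = 0 := P.const_eq_zero (hs _) (by have := hvs i0; rw [h0] at this; simpa using this)
  have key : ∀ x y : Ω, P.O.valuation x = 1 → P.O.valuation (x - y) < 1 → y ≠ 0 := by
    rintro x y hx hxy rfl
    rw [sub_zero, hx] at hxy; exact lt_irrefl _ hxy
  have r0 := key _ _ hu1 (hur i0)
  have s1 := key _ _ hv1 (hvs i1)
  have vn : ∀ x : Ω, P.O.valuation (0 - x) < 1 → P.O.valuation x < 1 := fun x hx => by simpa using hx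
  refine ⟨r, s, hr, hs, hur, hvs, ⟨?_, ?_, ?_, ?_, ?_, ?_, ?_⟩, s0, r0, s1⟩
  · intro a b hab
    have ha : a = 0 := by
      have := congrFun hab i0
      simpa [s0, r0] using this
    have := congrFun hab i1
    rw [ha] at this
    refine ⟨ha, ?_⟩
    simpa [s1] using this
  · exact P.const_eq_zero (Place.Bf_const _ _ _ hr hr) (vn _ (h.a1 ▸ P.Bf_congr cf.q1 u u r r hu hri hur hur))
  · exact P.const_eq_zero (Place.Bf_const _ _ _ hr hs) (vn _ (h.b1 ▸ P.Bf_congr cf.q1 u v r s hv hri hur hvs))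
  · exact P.const_eq_zero (Place.Bf_const _ _ _ hs hs) (vn _ (h.c1 ▸ P.Bf_congr cf.q1 v v s s hv hsi hvs hvs))
  · exact P.const_eq_zero (Place.Bf_const _ _ _ hr hr) (vn _ (h.a2 ▸ P.Bf_congr cf.q2 u u r r hu hri hur hur))
  · exact P.const_eq_zero (Place.Bf_const _ _ _ hr hs) (vn _ (h.b2 ▸ P.Bf_congr cf.q2 u v r s hv hri hur hvs))
  · exact P.const_eq_zero (Place.Bf_const _ _ _ hs hs) (vn _ (h.c2 ▸ P.Bf_congr cf.q2 v v s s hv hsi hvs hvs))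

end CI22

namespace CI22
open MvPolynomial Module Matrix
variable {Ω : Type} [Field Ω] [Algebra ℂ Ω] {fr : Frame Ω} {cf : Cfg Ω}

theorem Place.vinv (P : Place fr) {x : Ω} (h : P.O.valuation x = 1) : P.O.valuation x⁻¹ ≤ 1 := by
  rw [map_inv₀, h, inv_one]

theorem Place.corr (P : Place fr) {u v : Fin 6 → Ω} (h : InZ cf u v) (hu : ∀ i, P.O.valuation (u i) ≤ 1) (hv : ∀ i, P.O.valuation (v i) ≤ 1)
    (i0 i1 : Fin 6) (h0 : v i0 = 0) (hu1 : P.O.valuation (u i0) = 1) (hv1 : P.O.valuation (v i1) = 1)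
    (I : AddSubgroup Ω) (hI : ∀ a x, P.O.valuation a ≤ 1 → x ∈ I → a * x ∈ I) (w : Fin 6 → Ω) (hw : ∀ i, w i ∈ I) (j) :
    ∃ y ∈ I, (GG cf i0 i1 u v).adjugate j (Sum.inl 0) * Bf cf.q1 u w + (GG cf i0 i1 u v).adjugate j (Sum.inl 1) * Bf cf.q2 u w
      + (GG cf i0 i1 u v).adjugate j (Sum.inl 2) * Bf cf.q1 v w + (GG cf i0 i1 u v).adjugate j (Sum.inl 3) * Bf cf.q2 v w
      = (GG cf i0 i1 u v).det * y := by
  have hu0 : u i0 ≠ 0 := by intro h; rw [h] at hu1; simp at hu1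
  have hv0 : v i1 ≠ 0 := by intro h; rw [h] at hv1; simp at hv1
  set a := (u i0)⁻¹ * w i0 with ha
  set b := (v i1)⁻¹ * (w i1 - u i1 * a) with hb
  have haI : a ∈ I := hI _ _ (P.vinv hu1) (hw _)
  have hbI : b ∈ I := hI _ _ (P.vinv hv1) (I.sub_mem (hw _) (hI _ _ (hu _) haI))
  set w' := w - a • u - b • v with hw'
  have e0 : w' i0 = 0 := by
    simp only [hw', Pi.sub_apply, Pi.smul_apply, smul_eq_mul, h0, ha]; field_simp; ring
  have e1 : w' i1 = 0 := by
    simp only [hw', Pi.sub_apply, Pi.smul_apply, smul_eq_mul, hb]; field_simp; ring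
  refine ⟨w' (e42 j), ?_, ?_⟩
  · simp only [hw', Pi.sub_apply, Pi.smul_apply, smul_eq_mul]
    refine I.sub_mem (I.sub_mem (hw _) ?_) ?_
    · rw [mul_comm]; exact hI _ _ (hu _) haI
    · rw [mul_comm]; exact hI _ _ (hv _) hbI
  · have k := GG_ker i0 i1 u v w' _ _ (GG_adj (cf := cf) i0 i1 u v w' j)
    rw [e0, e1] at k
    have f1 : Bf cf.q1 u w' = Bf cf.q1 u w := by rw [hw', map_sub, map_sub, map_smul, map_smul, h.a1, h.b1]; simp
    have f2 : Bf cf.q2 u w' = Bf cf.q2 u w := by rw [hw', map_sub, map_sub, map_smul, map_smul, h.a2, h.b2]; simp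
    have f3 : Bf cf.q1 v w' = Bf cf.q1 v w := by rw [hw', map_sub, map_sub, map_smul, map_smul, h.c1, Bf_symm cf.q1 v u, h.b1]; simp
    have f4 : Bf cf.q2 v w' = Bf cf.q2 v w := by rw [hw', map_sub, map_sub, map_smul, map_smul, h.c2, Bf_symm cf.q2 v u, h.b2]; simp
    rw [f1, f2, f3, f4] at k
    rw [← k]; ring

theorem Place.reg_sat [IsAlgClosed Ω] (P : Place fr) {u v : Fin 6 → Ω} (h : InZ cf u v) (hu : ∀ i, P.O.valuation (u i) ≤ 1) (hv : ∀ i, P.O.valuation (v i) ≤ 1)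
    (i0 i1 : Fin 6) (h0 : v i0 = 0) (hu1 : P.O.valuation (u i0) = 1) (hv1 : P.O.valuation (v i1) = 1)
    (I : AddSubgroup Ω) (hI : ∀ a x, P.O.valuation a ≤ 1 → x ∈ I → a * x ∈ I) (Δ : Derivation ℂ Ω Ω) (hΔ : ∀ x, P.O.valuation x ≤ 1 → Δ x ∈ I) :
    al cf cf.q1 Δ u v ∈ I ∧ al cf cf.q2 Δ u v ∈ I := by
  by_cases hρ : ∃ ρ, IsRho e42 (NL cf u v) (UL u v) ρ
  swap
  · rw [al, al, rhoL_none hρ, mul_zero, mul_zero]; exact ⟨I.zero_mem, I.zero_mem⟩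
  obtain ⟨ρ, hρ⟩ := hρ
  have hr := hρ.2 (fsel i0 i1)
  change _ = ρ * (GG cf i0 i1 u v).det at hr
  have hdet : ((fsel i0 i1 : Matrix (Fin 2) (Fin 6) Ω) * (UL u v : Matrix (Fin 6) (Fin 2) Ω)).det = u i0 * v i1 := by
    have e1 : ∀ k, ((fsel i0 i1 : Matrix (Fin 2) (Fin 6) Ω) * (UL u v : Matrix (Fin 6) (Fin 2) Ω)) 0 k = (UL u v) i0 k := fun k => congrFun (fsel_mulVec i0 i1 (fun i => UL u v i k)) 0
    have e2 : ∀ k, ((fsel i0 i1 : Matrix (Fin 2) (Fin 6) Ω) * (UL u v : Matrix (Fin 6) (Fin 2) Ω)) 1 k = (UL u v) i1 k := fun k => congrFun (fsel_mulVec i0 i1 (fun i => UL u v i k)) 1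
    rw [det_fin_two, e1, e1, e2, e2]
    simp [UL, h0]
  rw [hdet] at hr
  rw [al, al, rhoL_eq hρ]
  have hdl := P.det_le _ (P.GG_le (cf := cf) i0 i1 u v hu hv)
  set D := (GG cf i0 i1 u v).det with hD
  have hn1 : Bf cf.q1 u (dv Δ v) ∈ I := P.vBf _ _ _ hu I hI fun i => hΔ _ (hv i)
  have hn2 : Bf cf.q2 u (dv Δ v) ∈ I := P.vBf _ _ _ hu I hI fun i => hΔ _ (hv i)
  have huv : P.O.valuation (u i0 * v i1) = 1 := by rw [map_mul, hu1, hv1, one_mul]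
  rcases hdl.lt_or_eq with hlt | heq
  swap
  · have : P.O.valuation ρ = 1 := by
      rw [hr, map_mul, heq, mul_one] at huv; exact huv
    exact ⟨by rw [mul_comm]; exact hI _ _ this.le hn1, by rw [mul_comm]; exact hI _ _ this.le hn2⟩
  obtain ⟨r, s, hrc, hsc, hur, hvs, hZ, s0, r0, s1⟩ := h.red P hu hv i0 i1 h0 hu1 hv1
  have hri := fun i => P.vconst (hrc i)
  have hsi := fun i => P.vconst (hsc i)
  have hcg := P.GG_congr (cf := cf) i0 i1 u v r s hu hv hri hsi hur hvs
  have hGle := P.GG_le (cf := cf) i0 i1 u v hu hv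
  have hG0le := P.GG_le (cf := cf) i0 i1 r s hri hsi
  have hGc := GG_const (cf := cf) i0 i1 r s hrc hsc
  have hd0 : (GG cf i0 i1 r s).det = 0 := by
    refine P.const_eq_zero (const_det _ hGc) ?_
    have h1 := P.det_congr _ _ hGle hG0le hcg
    have h2 := P.vaddlt hlt (show P.O.valuation (-(D - (GG cf i0 i1 r s).det)) < 1 by rw [Valuation.map_neg]; exact h1)
    have h3 : D + -(D - (GG cf i0 i1 r s).det) = (GG cf i0 i1 r s).det := by ring
    rwa [h3] at h2
  obtain ⟨dd, hdd0, hdd⟩ := Matrix.exists_vecMul_eq_zero_iff.mpr hd0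
  obtain ⟨hd2, hd3⟩ := hZ.ker_GG s0 r0 s1 dd hdd
  have hd4 : dd ∘ Sum.inl ≠ 0 := by
    intro hz
    apply hdd0
    ext i
    rcases i with i | i
    · exact congrFun hz i
    · exact hd2 i
  obtain ⟨k, hk⟩ := Function.ne_iff.mp hd4
  obtain ⟨j, hj⟩ := exists_adj (GG cf i0 i1 r s) hd0 (Sum.inl k) (by
    intro c hc hck
    obtain ⟨hc2, hc3⟩ := hZ.ker_GG s0 r0 s1 c hc
    obtain ⟨τ, hτ⟩ := hZ.ker4 _ _ hc3 hd3 hd4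
    have : τ = 0 := by
      have h5 := congrFun hτ k
      simp only [Function.comp, Pi.smul_apply, smul_eq_mul, hck] at h5
      exact (mul_eq_zero.mp h5.symm).resolve_right hk
    rw [this, zero_smul] at hτ
    ext i
    rcases i with i | i
    · exact congrFun hτ i
    · exact hc2 i)
  set c := fun i : Fin 4 => (GG cf i0 i1 u v).adjugate j (Sum.inl i) with hc
  set c0 := fun i : Fin 4 => (GG cf i0 i1 r s).adjugate j (Sum.inl i) with hc0
  have hcle : ∀ i, P.O.valuation (c i) ≤ 1 := fun i => P.adj_le _ hGle _ _
  have hc0le : ∀ i, P.O.valuation (c0 i) ≤ 1 := fun i => P.adj_le _ hG0le _ _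
  have hcc : ∀ i, P.O.valuation (c i - c0 i) < 1 := fun i => P.adj_congr _ _ hGle hG0le hcg _ _
  have hc0c : ∀ i, fr.ds (c0 i) = 0 := fun i => const_adj _ hGc _ _
  have hker0 : c0 ᵥ* NL cf r s = 0 := by
    have h6 : (fun k => (GG cf i0 i1 r s).adjugate j k) ᵥ* GG cf i0 i1 r s = 0 := by
      have h7 := adjugate_mul (GG cf i0 i1 r s)
      rw [hd0, zero_smul] at h7
      ext l
      exact congrFun (congrFun h7 j) l
    exact (hZ.ker_GG s0 r0 s1 _ h6).2
  have hE0 : c0 0 * c0 3 - c0 1 * c0 2 ≠ 0 := by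
    intro hz
    have := hZ.sm4 c0 hker0 (by linear_combination hz)
    exact hj (congrFun this k)
  have hE : P.O.valuation (c 0 * c 3 - c 1 * c 2) = 1 := by
    refine P.unit_of_congr (y := c0 0 * c0 3 - c0 1 * c0 2) (by simp [hc0c]) hE0 ?_
    have : c 0 * c 3 - c 1 * c 2 - (c0 0 * c0 3 - c0 1 * c0 2) =
      (c 0 * (c 3 - c0 3) + c0 3 * (c 0 - c0 0)) + (-(c 1)) * (c 2 - c0 2) + (-(c0 2)) * (c 1 - c0 1) := by ring
    rw [this]
    refine P.vaddlt (P.vaddlt (P.vaddlt ?_ ?_) ?_) ?_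
    · exact P.vmullt' (hcle _) (hcc _)
    · exact P.vmullt' (hc0le _) (hcc _)
    · exact P.vmullt' (by rw [Valuation.map_neg]; exact hcle _) (hcc _)
    · exact P.vmullt' (by rw [Valuation.map_neg]; exact hc0le _) (hcc _)
  have hEn : c 0 * c 3 - c 1 * c 2 ≠ 0 := by intro h; rw [h] at hE; simp at hE
  obtain ⟨y, hy, hy2⟩ := P.corr h hu hv i0 i1 h0 hu1 hv1 I hI (dv Δ u) (fun i => hΔ _ (hu i)) j
  obtain ⟨z, hz, hz2⟩ := P.corr h hu hv i0 i1 h0 hu1 hv1 I hI (dv Δ v) (fun i => hΔ _ (hv i)) j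
  rw [eta_self cf.q1 Δ u h.a1, eta_self cf.q2 Δ u h.a2, eta_anti cf.q1 Δ u v h.b1, eta_anti cf.q2 Δ u v h.b2] at hy2
  rw [eta_self cf.q1 Δ v h.c1, eta_self cf.q2 Δ v h.c2] at hz2
  change c 0 * 0 + c 1 * 0 + c 2 * _ + c 3 * _ = D * y at hy2
  change c 0 * _ + c 1 * _ + c 2 * 0 + c 3 * 0 = D * z at hz2
  set n1 := Bf cf.q1 u (dv Δ v)
  set n2 := Bf cf.q2 u (dv Δ v)
  have f1 : n1 * ρ = (c 0 * c 3 - c 1 * c 2)⁻¹ * ((u i0 * v i1) * (c 3 * z + c 1 * y)) := by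
    rw [eq_inv_mul_iff_mul_eq₀ hEn, hr]
    linear_combination c 3 * ρ * hz2 + c 1 * ρ * hy2
  have f2 : n2 * ρ = (c 0 * c 3 - c 1 * c 2)⁻¹ * ((u i0 * v i1) * (-(c 2) * z + (-(c 0)) * y)) := by
    rw [eq_inv_mul_iff_mul_eq₀ hEn, hr]
    linear_combination -c 2 * ρ * hz2 - c 0 * ρ * hy2
  rw [f1, f2]
  constructor
  · exact hI _ _ (P.vinv hE) (hI _ _ huv.le (I.add_mem (hI _ _ (hcle _) hz) (hI _ _ (hcle _) hy)))
  · exact hI _ _ (P.vinv hE) (hI _ _ huv.le (I.add_mem (hI _ _ (by rw [Valuation.map_neg]; exact hcle _) hz) (hI _ _ (by rw [Valuation.map_neg]; exact hcle _) hy)))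

theorem Place.reg [IsAlgClosed Ω] (P : Place fr) {u v : Fin 6 → Ω} (h : InZ cf u v)
    (I : AddSubgroup Ω) (hI : ∀ a x, P.O.valuation a ≤ 1 → x ∈ I → a * x ∈ I) (Δ : Derivation ℂ Ω Ω) (hΔ : ∀ x, P.O.valuation x ≤ 1 → Δ x ∈ I) :
    al cf cf.q1 Δ u v ∈ I ∧ al cf cf.q2 Δ u v ∈ I := by
  obtain ⟨a, b, c, e, hD, u', v', rfl, rfl, hu, hv, i0, i1, hu1, h0, hv1⟩ := P.sat u v h.li
  have hZ : InZ cf (a • u + b • v) (c • u + e • v) := by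
    refine ⟨fun x y hxy => ?_, (h.combo _ _ _ _).1, (h.combo _ _ _ _).1, (h.combo _ _ _ _).1, (h.combo _ _ _ _).2, (h.combo _ _ _ _).2, (h.combo _ _ _ _).2⟩
    obtain ⟨k1, k2⟩ := h.li (x * a + y * c) (x * b + y * e) (by rw [← hxy]; module)
    constructor
    · have : x * (a * e - b * c) = 0 := by linear_combination e * k1 - c * k2
      exact (mul_eq_zero.mp this).resolve_right hD
    · have : y * (a * e - b * c) = 0 := by linear_combination a * k2 - b * k1
      exact (mul_eq_zero.mp this).resolve_right hD
  rw [← al_basis1 h Δ a b c e hD, ← al_basis2 h Δ a b c e hD]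
  exact P.reg_sat hZ hu hv i0 i1 h0 hu1 hv1 I hI Δ hΔ

theorem al_lin (q : MvPolynomial (Fin 6) ℂ) (a b : Ω) (Δ Δ' : Derivation ℂ Ω Ω) (u v : Fin 6 → Ω) :
    al cf q (a • Δ + b • Δ') u v = a * al cf q Δ u v + b * al cf q Δ' u v := by
  have : dv (a • Δ + b • Δ') v = a • dv Δ v + b • dv Δ' v := by ext i; simp [dv]
  rw [al, al, al, this, map_add, map_smul, map_smul]; simp; ring

theorem Place.al_e [IsAlgClosed Ω] (P : Place fr) {u v : Fin 6 → Ω} (h : InZ cf u v) :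
    P.O.valuation (P.e * al cf cf.q1 fr.ds u v) < 1 ∧ P.O.valuation (P.e * al cf cf.q2 fr.ds u v) < 1 := by
  have := P.reg h P.mI P.mI_mul (P.e • fr.ds + (0 : Ω) • fr.ds) (fun x hx => by
    show P.O.valuation _ < 1
    simpa using P.vE hx)
  rw [al_lin, al_lin, zero_mul, zero_mul, add_zero, add_zero] at this
  exact this

theorem Place.al_d [IsAlgClosed Ω] (P : Place fr) {u v : Fin 6 → Ω} (h : InZ cf u v) :
    P.O.valuation (al cf cf.q1 fr.dt u v + P.b * al cf cf.q1 fr.ds u v) ≤ 1 ∧ P.O.valuation (al cf cf.q2 fr.dt u v + P.b * al cf cf.q2 fr.ds u v) ≤ 1 := by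
  have := P.reg h P.oI P.oI_mul ((1 : Ω) • fr.dt + P.b • fr.ds) (fun x hx => by
    show P.O.valuation _ ≤ 1
    simpa using P.Dint x hx)
  rw [al_lin, al_lin, one_mul, one_mul] at this
  exact this

noncomputable def thL (fr : Frame Ω) (cf : Cfg Ω) (u v : Fin 6 → Ω) : Ω :=
  al cf cf.q1 fr.ds u v * al cf cf.q2 fr.dt u v - al cf cf.q2 fr.ds u v * al cf cf.q1 fr.dt u v

theorem Place.th_e [IsAlgClosed Ω] (P : Place fr) {u v : Fin 6 → Ω} (h : InZ cf u v) : P.O.valuation (P.e * thL fr cf u v) < 1 := by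
  obtain ⟨a1, a2⟩ := P.al_e h
  obtain ⟨b1, b2⟩ := P.al_d h
  have : P.e * thL fr cf u v = (P.e * al cf cf.q1 fr.ds u v) * (al cf cf.q2 fr.dt u v + P.b * al cf cf.q2 fr.ds u v)
    + -((P.e * al cf cf.q2 fr.ds u v) * (al cf cf.q1 fr.dt u v + P.b * al cf cf.q1 fr.ds u v)) := by rw [thL]; ring
  rw [this]
  exact P.vaddlt (P.vmullt a1 b2) (by rw [Valuation.map_neg]; exact P.vmullt a2 b1)
end CI22

namespace CI22
open MvPolynomial Module Matrix
variable {Ω : Type} [Field Ω] [Algebra ℂ Ω] {fr : Frame Ω} {cf : Cfg Ω}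

def Cfg.swap (cf : Cfg Ω) : Cfg Ω :=
  { cf with F1 := cf.F2, F2 := cf.F1, hF1 := cf.hF2, hF2 := cf.hF1 }

theorem Pt.swap {x : Fin 6 → Ω} (h : Pt fr cf x) : Pt fr.swap cf.swap x :=
  ⟨h.norm, h.z1, h.z2, h.zg, h.f0, h.f2, h.f1⟩
theorem Pt.unswap {x : Fin 6 → Ω} (h : Pt fr.swap cf.swap x) : Pt fr cf x :=
  ⟨h.norm, h.z1, h.z2, h.zg, h.f0, h.f2, h.f1⟩
theorem InZ.swap {u v : Fin 6 → Ω} (h : InZ cf u v) : InZ cf.swap u v :=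
  ⟨h.li, h.a1, h.b1, h.c1, h.a2, h.b2, h.c2⟩
theorem al_swap (q Δ) (u v : Fin 6 → Ω) : al cf.swap q Δ u v = al cf q Δ u v := rfl

def Heavy (S : Finset (Fin 6 → Ω)) (p : (Fin 6 → Ω) × (Fin 6 → Ω)) : Prop :=
  p.1 ∈ S ∧ p.2 ∈ S ∧ p.1 ≠ p.2 ∧ ∃ z ∈ S, z ≠ p.1 ∧ z ≠ p.2 ∧ z ∈ Submodule.span Ω {p.1, p.2}

open Classical in
noncomputable def HS (S : Finset (Fin 6 → Ω)) : Finset ((Fin 6 → Ω) × (Fin 6 → Ω)) := (S ×ˢ S).filter (Heavy S)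

theorem mem_HS {S : Finset (Fin 6 → Ω)} {p} : p ∈ HS S ↔ Heavy S p := by
  classical
  simp only [HS, Finset.mem_filter, Finset.mem_product]
  exact ⟨fun h => h.2, fun h => ⟨⟨h.1, h.2.1⟩, h⟩⟩

theorem Heavy.inZ {S : Finset (Fin 6 → Ω)} (hS : ∀ x ∈ S, Pt fr cf x) {p} (h : Heavy S p) : InZ cf p.1 p.2 := by
  obtain ⟨hx, hy, hxy, z, hz, hzx, hzy, hsp⟩ := h
  have hG := gen_of_pt S hS
  obtain ⟨a, b, ha, hb, rfl⟩ := hG.third hx hy hz hzx hzy hsp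
  have e1 : ∀ {x}, x ∈ S → Bf cf.q1 x x = 0 := fun {x} hx => (Bf_self_zero cf.h1 x).mp (hS x hx).z1
  have e2 : ∀ {x}, x ∈ S → Bf cf.q2 x x = 0 := fun {x} hx => (Bf_self_zero cf.h2 x).mp (hS x hx).z2
  exact ⟨fun a b h => hG.li hx hy hxy a b h, e1 hx, iso_line _ (Bf_symm cf.q1) _ _ a b ha hb (e1 hx) (e1 hy) (e1 hz), e1 hy,
    e2 hx, iso_line _ (Bf_symm cf.q2) _ _ a b ha hb (e2 hx) (e2 hy) (e2 hz), e2 hy⟩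

noncomputable def actp (σ : Ω ≃ₐ[fr.K0] Ω) (p : (Fin 6 → Ω) × (Fin 6 → Ω)) : (Fin 6 → Ω) × (Fin 6 → Ω) := (actv σ p.1, actv σ p.2)

theorem actp_inj (σ : Ω ≃ₐ[fr.K0] Ω) : Function.Injective (actp σ) := by
  rintro ⟨a, b⟩ ⟨c, d⟩ h
  simp only [actp, Prod.mk.injEq] at h
  rw [actv_inj σ h.1, actv_inj σ h.2]

theorem Heavy.act {S : Finset (Fin 6 → Ω)} (σ : Ω ≃ₐ[fr.K0] Ω) (hS : ∀ x ∈ S, actv σ x ∈ S) {p} (h : Heavy S p) : Heavy S (actp σ p) := by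
  obtain ⟨hx, hy, hxy, z, hz, hzx, hzy, hsp⟩ := h
  refine ⟨hS _ hx, hS _ hy, fun h => hxy (actv_inj σ h), actv σ z, hS _ hz, fun h => hzx (actv_inj σ h), fun h => hzy (actv_inj σ h), ?_⟩
  obtain ⟨a, b, rfl⟩ := Submodule.mem_span_pair.mp hsp
  refine Submodule.mem_span_pair.mpr ⟨σ a, σ b, ?_⟩
  ext i; simp [actp, actv]

theorem al_act (q : MvPolynomial (Fin 6) ℂ) (Δ : Derivation ℂ Ω Ω) (σ : Ω ≃ₐ[fr.K0] Ω) (hΔ : ∀ x, σ (Δ x) = Δ (σ x)) (u v : Fin 6 → Ω) :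
    al cf q Δ (actv σ u) (actv σ v) = σ (al cf q Δ u v) := by
  have : dv Δ (actv σ v) = actv σ (dv Δ v) := by ext i; exact (hΔ _).symm
  rw [al, al, map_mul, rhoL_act, this, Bf_act]

theorem sum_al [IsAlgClosed Ω] {S : Finset (Fin 6 → Ω)} (hS : ∀ x, x ∈ S ↔ Pt fr cf x) :
    ∑ p ∈ HS S, al cf cf.q1 fr.ds p.1 p.2 = 0 ∧ ∑ p ∈ HS S, al cf cf.q2 fr.ds p.1 p.2 = 0 := by
  have hst : ∀ σ : Ω ≃ₐ[fr.K0] Ω, ∀ p ∈ HS S, actp σ p ∈ HS S := fun σ p hp =>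
    mem_HS.mpr ((mem_HS.mp hp).act σ fun x hx => (hS _).mpr (((hS x).mp hx).act σ))
  constructor
  · refine trace_zero fr (HS S) _ (fun σ => actp σ) hst actp_inj (fun σ p _ => al_act _ _ σ (fr.gal_ds σ) _ _) ?_
    intro P p hp
    exact (P.al_e ((mem_HS.mp hp).inZ fun x hx => (hS x).mp hx)).1
  · refine trace_zero fr (HS S) _ (fun σ => actp σ) hst actp_inj (fun σ p _ => al_act _ _ σ (fr.gal_ds σ) _ _) ?_
    intro P p hp
    exact (P.al_e ((mem_HS.mp hp).inZ fun x hx => (hS x).mp hx)).2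

theorem sum_al_t [IsAlgClosed Ω] {S : Finset (Fin 6 → Ω)} (hS : ∀ x, x ∈ S ↔ Pt fr cf x) :
    ∑ p ∈ HS S, al cf cf.q1 fr.dt p.1 p.2 = 0 ∧ ∑ p ∈ HS S, al cf cf.q2 fr.dt p.1 p.2 = 0 :=
  sum_al (fr := fr.swap) (cf := cf.swap) (fun x => (hS x).trans ⟨Pt.swap, Pt.unswap⟩)

theorem sum_th [IsAlgClosed Ω] {S : Finset (Fin 6 → Ω)} (hS : ∀ x, x ∈ S ↔ Pt fr cf x) :
    ∑ p ∈ HS S, thL fr cf p.1 p.2 = 0 := by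
  refine trace_zero fr (HS S) _ (fun σ => actp σ) (fun σ p hp =>
    mem_HS.mpr ((mem_HS.mp hp).act σ fun x hx => (hS _).mpr (((hS x).mp hx).act σ))) actp_inj (fun σ p _ => ?_) ?_
  · simp only [thL, actp, al_act _ _ σ (fr.gal_ds σ), al_act _ _ σ (fr.gal_dt σ), map_sub, map_mul]
  · intro P p hp
    exact P.th_e ((mem_HS.mp hp).inZ fun x hx => (hS x).mp hx)

theorem two_class {α : Type} (H : Finset α) (c : α → Prop) (a1 a2 b1 b2 : α → Ω)
    (hc : ∀ p ∈ H, ∀ q ∈ H, (c p ↔ c q) → a1 p = a1 q ∧ a2 p = a2 q ∧ b1 p = b1 q ∧ b2 p = b2 q)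
    (s1 : ∑ p ∈ H, a1 p = 0) (s2 : ∑ p ∈ H, a2 p = 0) (s3 : ∑ p ∈ H, b1 p = 0) (s4 : ∑ p ∈ H, b2 p = 0)
    (s5 : ∑ p ∈ H, (a1 p * b2 p - a2 p * b1 p) = 0) : ∀ p ∈ H, a1 p * b2 p - a2 p * b1 p = 0 := by
  classical
  have hch : CharZero Ω := charZero_of_injective_algebraMap (algebraMap ℂ Ω).injective
  intro p hp
  set A := H.filter (fun q => c q ↔ c p) with hA
  set B := H.filter (fun q => ¬ (c q ↔ c p)) with hB
  have hpA : p ∈ A := by simp [hA, hp]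
  have hA0 : (A.card : Ω) ≠ 0 := by
    rw [Nat.cast_ne_zero]; exact Finset.card_ne_zero_of_mem hpA
  have split : ∀ f : α → Ω, (∀ x ∈ H, ∀ q ∈ H, (c x ↔ c q) → f x = f q) → ∑ q ∈ H, f q = A.card * f p + ∑ q ∈ B, f q := by
    intro f hf
    rw [← Finset.sum_filter_add_sum_filter_not H (fun q => c q ↔ c p)]
    congr 1
    rw [Finset.sum_congr rfl (g := fun _ => f p), Finset.sum_const, nsmul_eq_mul]
    intro q hq
    exact hf q (Finset.mem_filter.mp hq).1 p hp (Finset.mem_filter.mp hq).2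
  rcases B.eq_empty_or_nonempty with hBe | ⟨r, hr⟩
  · rw [split _ (fun x hx q hq h => (hc x hx q hq h).1), hBe] at s1
    rw [split _ (fun x hx q hq h => (hc x hx q hq h).2.1), hBe] at s2
    simp only [Finset.sum_empty, add_zero, mul_eq_zero, hA0, false_or] at s1 s2
    rw [s1, s2]; ring
  have hrH := (Finset.mem_filter.mp hr).1
  have split2 : ∀ f : α → Ω, (∀ x ∈ H, ∀ q ∈ H, (c x ↔ c q) → f x = f q) → ∑ q ∈ H, f q = A.card * f p + B.card * f r := by
    intro f hf
    rw [split f hf]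
    congr 1
    rw [Finset.sum_congr rfl (g := fun _ => f r), Finset.sum_const, nsmul_eq_mul]
    intro q hq
    refine hf q (Finset.mem_filter.mp hq).1 r hrH ?_
    have h1 := (Finset.mem_filter.mp hq).2
    have h2 := (Finset.mem_filter.mp hr).2
    tauto
  rw [split2 _ (fun x hx q hq h => (hc x hx q hq h).1)] at s1
  rw [split2 _ (fun x hx q hq h => (hc x hx q hq h).2.1)] at s2
  rw [split2 _ (fun x hx q hq h => (hc x hx q hq h).2.2.1)] at s3
  rw [split2 _ (fun x hx q hq h => (hc x hx q hq h).2.2.2)] at s4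
  rw [split2 _ (fun x hx q hq h => by obtain ⟨h1, h2, h3, h4⟩ := hc x hx q hq h; rw [h1, h2, h3, h4])] at s5
  have hAB : (A.card : Ω) + B.card ≠ 0 := by
    have : A.card + B.card ≠ 0 := by have := Finset.card_ne_zero_of_mem hpA; omega
    exact_mod_cast this
  have hB0 : (B.card : Ω) ≠ 0 := by
    rw [Nat.cast_ne_zero]; exact Finset.card_ne_zero_of_mem hr
  have : (A.card : Ω) * ((A.card : Ω) + B.card) * (a1 p * b2 p - a2 p * b1 p) = 0 := by
    generalize (A.card : Ω) = m at *
    generalize (B.card : Ω) = n at *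
    linear_combination n * s5 - n * b2 r * s1 + m * a1 p * s4 + n * b1 r * s2 - m * a2 p * s3
  simpa [hA0, hAB] using this
end CI22

namespace CI22
open MvPolynomial Module Matrix
variable {Ω : Type} [Field Ω] [Algebra ℂ Ω] {fr : Frame Ω} {cf : Cfg Ω}

theorem al_span {x y x' y' : Fin 6 → Ω} (h : InZ cf x y) (h' : InZ cf x' y') (hx : x' ∈ Submodule.span Ω {x, y})
    (hy : y' ∈ Submodule.span Ω {x, y}) (Δ : Derivation ℂ Ω Ω) :
    al cf cf.q1 Δ x' y' = al cf cf.q1 Δ x y ∧ al cf cf.q2 Δ x' y' = al cf cf.q2 Δ x y := by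
  obtain ⟨a, b, rfl⟩ := Submodule.mem_span_pair.mp hx
  obtain ⟨c, e, rfl⟩ := Submodule.mem_span_pair.mp hy
  have hD : a * e - b * c ≠ 0 := by
    intro hD
    have k1 := h'.li e (-b) (by
      have : e • (a • x + b • y) + (-b) • (c • x + e • y) = (a * e - b * c) • x := by module
      rw [this, hD, zero_smul])
    have k2 := h'.li (-c) a (by
      have : (-c) • (a • x + b • y) + a • (c • x + e • y) = (a * e - b * c) • y := by module
      rw [this, hD, zero_smul])
    have := h'.li 1 0 (by rw [k2.2, neg_eq_zero.mp k1.2]; simp)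
    exact one_ne_zero this.1
  exact ⟨al_basis1 h Δ a b c e hD, al_basis2 h Δ a b c e hD⟩

theorem Heavy.span {m : ℕ} {S : Finset (Fin 6 → Ω)} (hS : ∀ x ∈ S, Pt fr cf x) {W₁ W₂} (hT : TwoLines m S W₁ W₂) {p} (h : Heavy S p) :
    W₁ = Submodule.span Ω {p.1, p.2} ∨ W₂ = Submodule.span Ω {p.1, p.2} := by
  have hZ := h.inZ hS
  have hG := gen_of_pt S hS
  obtain ⟨hx, hy, hxy, z, hz, hzx, hzy, hsp⟩ := h
  obtain ⟨a, b, ha, hb, hab⟩ := hG.third hx hy hz hzx hzy hsp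
  have key : ∀ W : Submodule Ω (Fin 6 → Ω), finrank Ω W ≤ 2 → (p.1 ∈ W ∧ p.2 ∈ W) ∨ (p.1 ∈ W ∧ z ∈ W) ∨ (p.2 ∈ W ∧ z ∈ W) →
      W = Submodule.span Ω {p.1, p.2} := by
    intro W hW hh
    have : p.1 ∈ W ∧ p.2 ∈ W := by
      rcases hh with hh | ⟨h1, h2⟩ | ⟨h1, h2⟩
      · exact hh
      · refine ⟨h1, ?_⟩
        have : p.2 = b⁻¹ • (z - a • p.1) := by rw [hab]; simp [hb]
        rw [this]; exact W.smul_mem _ (W.sub_mem h2 (W.smul_mem _ h1))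
      · refine ⟨?_, h1⟩
        have : p.1 = a⁻¹ • (z - b • p.2) := by rw [hab]; simp [ha]
        rw [this]; exact W.smul_mem _ (W.sub_mem h2 (W.smul_mem _ h1))
    exact span_pair_eq hW this.1 this.2 hZ.li
  have c1 := hT.cov _ hx
  have c2 := hT.cov _ hy
  have c3 := hT.cov _ hz
  rcases c1 with c1 | c1 <;> rcases c2 with c2 | c2 <;> rcases c3 with c3 | c3
  · exact Or.inl (key W₁ hT.f1 (Or.inl ⟨c1, c2⟩))
  · exact Or.inl (key W₁ hT.f1 (Or.inl ⟨c1, c2⟩))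
  · exact Or.inl (key W₁ hT.f1 (Or.inr (Or.inl ⟨c1, c3⟩)))
  · exact Or.inr (key W₂ hT.f2 (Or.inr (Or.inr ⟨c2, c3⟩)))
  · exact Or.inl (key W₁ hT.f1 (Or.inr (Or.inr ⟨c2, c3⟩)))
  · exact Or.inr (key W₂ hT.f2 (Or.inr (Or.inl ⟨c1, c3⟩)))
  · exact Or.inr (key W₂ hT.f2 (Or.inl ⟨c1, c2⟩))
  · exact Or.inr (key W₂ hT.f2 (Or.inl ⟨c1, c2⟩))

theorem heavy_th [IsAlgClosed Ω] {m : ℕ} {S : Finset (Fin 6 → Ω)} (hS : ∀ x, x ∈ S ↔ Pt fr cf x) {W₁ W₂} (hT : TwoLines m S W₁ W₂) {p} (h : Heavy S p) :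
    thL fr cf p.1 p.2 = 0 := by
  have hS' : ∀ x ∈ S, Pt fr cf x := fun x hx => (hS x).mp hx
  refine two_class (HS S) (fun p => W₁ = Submodule.span Ω {p.1, p.2}) (fun p => al cf cf.q1 fr.ds p.1 p.2) (fun p => al cf cf.q2 fr.ds p.1 p.2)
    (fun p => al cf cf.q1 fr.dt p.1 p.2) (fun p => al cf cf.q2 fr.dt p.1 p.2) ?_ (sum_al hS).1 (sum_al hS).2 (sum_al_t hS).1 (sum_al_t hS).2 (sum_th hS) p (mem_HS.mpr h)
  intro p hp q hq hpq
  have hp := mem_HS.mp hp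
  have hq := mem_HS.mp hq
  have hs : Submodule.span Ω {q.1, q.2} = Submodule.span Ω {p.1, p.2} := by
    by_cases h1 : W₁ = Submodule.span Ω {p.1, p.2}
    · exact (hpq.mp h1).symm.trans h1
    · exact ((hq.span hS' hT).resolve_left (fun h => h1 (hpq.mpr h))).symm.trans ((hp.span hS' hT).resolve_left h1)
  have k := fun Δ => al_span (hq.inZ hS') (hp.inZ hS') (hs ▸ Submodule.subset_span (by simp)) (hs ▸ Submodule.subset_span (by simp)) Δ
  exact ⟨(k _).1, (k _).2, (k _).1, (k _).2⟩

theorem InZ.NL_der {u v : Fin 6 → Ω} (h : InZ cf u v) (Δ : Derivation ℂ Ω Ω) (h1 : Bf cf.q1 u (dv Δ v) = 0) (h2 : Bf cf.q2 u (dv Δ v) = 0) :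
    NL cf u v *ᵥ (dv Δ u) = 0 := by
  rw [NL_mulVec, eta_self cf.q1 Δ u h.a1, eta_self cf.q2 Δ u h.a2, eta_anti cf.q1 Δ u v h.b1, eta_anti cf.q2 Δ u v h.b2, h1, h2]
  ext i; fin_cases i <;> simp

theorem ker_of_rho {u v : Fin 6 → Ω} (h : InZ cf u v) {ρ} (hρ : IsRho e42 (NL cf u v) (UL u v) ρ) (w : Fin 6 → Ω)
    (hw : NL cf u v *ᵥ w = 0) : ∃ a b : Ω, w = a • u + b • v := by
  obtain ⟨f, hf⟩ := exists_left_inv (UL u v) (UL_inj h)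
  have h1 := hρ.2 f
  rw [hf, det_one] at h1
  have hd : (stk e42 (NL cf u v) f).det ≠ 0 := fun h0 => by rw [h0, mul_zero] at h1; exact one_ne_zero h1
  set c := f *ᵥ w with hc
  refine ⟨c 0, c 1, ?_⟩
  have hU : UL u v *ᵥ c = c 0 • u + c 1 • v := by
    ext i
    simp [mulVec, dotProduct, Fin.sum_univ_two, UL, mul_comm]
  rw [← hU, ← sub_eq_zero]
  set w' := w - UL u v *ᵥ c with hw'
  have e1 : NL cf u v *ᵥ w' = 0 := by rw [hw', mulVec_sub, hw, mulVec_mulVec, h.NU, zero_mulVec, sub_zero]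
  have e2 : f *ᵥ w' = 0 := by rw [hw', mulVec_sub, mulVec_mulVec, hf, one_mulVec, sub_self]
  have e3 : stk e42 (NL cf u v) f *ᵥ (w' ∘ e42) = 0 := by
    ext i
    rcases i with i | i
    · refine Eq.trans ?_ (congrFun e1 i)
      exact Equiv.sum_comp e42 (fun j => NL cf u v i j * w' j)
    · refine Eq.trans ?_ (congrFun e2 i)
      exact Equiv.sum_comp e42 (fun j => f i j * w' j)
  have e4 := Matrix.eq_zero_of_mulVec_eq_zero hd e3
  ext i
  have := congrFun e4 (e42.symm i)
  simpa using this

theorem Pt.tan {x : Fin 6 → Ω} (h : Pt fr cf x) (y : Fin 6 → Ω) (a b c : Ω) (hy : y = a • x + b • dv fr.ds x + c • dv fr.dt x) :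
    ∑ i, gr cf.g x i * y i = 0 := by
  have key : ∀ j, ∑ i, gr cf.g x i * UX fr x i j = 0 := fun j => congrFun (congrFun (NX_UX (fr := fr) h.z1 h.z2 h.zg) 2) j
  have k0 : ∑ i, gr cf.g x i * x i = 0 := key 0
  have k1 : ∑ i, gr cf.g x i * fr.ds (x i) = 0 := key 1
  have k2 : ∑ i, gr cf.g x i * fr.dt (x i) = 0 := key 2
  have : ∑ i, gr cf.g x i * y i = a * (∑ i, gr cf.g x i * x i) + b * (∑ i, gr cf.g x i * fr.ds (x i)) + c * ∑ i, gr cf.g x i * fr.dt (x i) := by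
    rw [Finset.mul_sum, Finset.mul_sum, Finset.mul_sum, ← Finset.sum_add_distrib, ← Finset.sum_add_distrib]
    refine Finset.sum_congr rfl fun i _ => ?_
    rw [hy]; simp [dv]; ring
  rw [this, k0, k1, k2]; simp

theorem det_ker (p q r t : Ω) (h : p * t - r * q = 0) : ∃ a b : Ω, (a ≠ 0 ∨ b ≠ 0) ∧ a * p + b * q = 0 ∧ a * r + b * t = 0 := by
  by_cases c1 : p = 0 ∧ q = 0
  · by_cases c2 : r = 0 ∧ t = 0
    · exact ⟨1, 0, Or.inl one_ne_zero, by rw [c1.1]; ring, by rw [c2.1]; ring⟩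
    · refine ⟨t, -r, ?_, by rw [c1.1, c1.2]; ring, by ring⟩
      rw [neg_ne_zero]; tauto
  · refine ⟨q, -p, ?_, by ring, by linear_combination -h⟩
    rw [neg_ne_zero]; tauto

theorem tangent [IsAlgClosed Ω] {x y : Fin 6 → Ω} (hx : Pt fr cf x) (h : InZ cf x y) (hth : thL fr cf x y = 0) :
    ∑ i, gr cf.g x i * y i = 0 := by
  by_cases hρ : ∃ ρ, IsRho e42 (NL cf x y) (UL x y) ρ
  · obtain ⟨ρ, hρ⟩ := hρ
    have hρ0 : ρ ≠ 0 := hρ.ne_zero_of (UL_inj h)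
    obtain ⟨a, b, hab, h1, h2⟩ : ∃ a b : Ω, (a ≠ 0 ∨ b ≠ 0) ∧ a * al cf cf.q1 fr.ds x y + b * al cf cf.q1 fr.dt x y = 0 ∧
        a * al cf cf.q2 fr.ds x y + b * al cf cf.q2 fr.dt x y = 0 := by
      exact det_ker _ _ _ _ hth
    rw [← al_lin, al, rhoL_eq hρ, mul_eq_zero, or_iff_left hρ0] at h1 h2
    obtain ⟨α, β, hαβ⟩ := ker_of_rho h hρ _ (h.NL_der _ h1 h2)
    have hβ : β ≠ 0 := by
      intro hβ
      have := hx.indep (-α) a b (fun i => by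
        have := congrFun hαβ i
        simp [hβ, dv] at this
        linear_combination this)
      exact hab.elim (fun h => h this.2.1) (fun h => h this.2.2)
    refine hx.tan y (-(β⁻¹ * α)) (β⁻¹ * a) (β⁻¹ * b) ?_
    ext i
    have := congrFun hαβ i
    simp [dv] at this ⊢
    field_simp
    linear_combination -this
  · obtain ⟨c, hc, hc0⟩ : ∃ c : Fin 4 → Ω, c ᵥ* NL cf x y = 0 ∧ c ≠ 0 := by
      by_contra! hcon
      obtain ⟨ξ, hξ⟩ := exists_right_inv (NL cf x y) hcon
      exact hρ (IsRho.exists ξ hξ h.NU)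
    have hD : c 0 * c 3 - c 1 * c 2 ≠ 0 := fun h0 => hc0 (h.sm4 c hc (by linear_combination h0))
    have hη : ∀ Δ : Derivation ℂ Ω Ω, Bf cf.q1 x (dv Δ y) = 0 ∧ Bf cf.q2 x (dv Δ y) = 0 := by
      intro Δ
      have k1 := vecMul_NL x y (dv Δ x) c hc
      have k2 := vecMul_NL x y (dv Δ y) c hc
      rw [eta_self cf.q1 Δ x h.a1, eta_self cf.q2 Δ x h.a2, eta_anti cf.q1 Δ x y h.b1, eta_anti cf.q2 Δ x y h.b2] at k1
      rw [eta_self cf.q1 Δ y h.c1, eta_self cf.q2 Δ y h.c2] at k2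
      constructor
      · have : (c 0 * c 3 - c 1 * c 2) * Bf cf.q1 x (dv Δ y) = 0 := by linear_combination c 3 * k2 + c 1 * k1
        exact (mul_eq_zero.mp this).resolve_left hD
      · have : (c 0 * c 3 - c 1 * c 2) * Bf cf.q2 x (dv Δ y) = 0 := by linear_combination -c 2 * k2 - c 0 * k1
        exact (mul_eq_zero.mp this).resolve_left hD
    have m1 := h.NL_der fr.ds (hη fr.ds).1 (hη fr.ds).2
    have m2 := h.NL_der fr.dt (hη fr.dt).1 (hη fr.dt).2
    have mx : NL cf x y *ᵥ x = 0 := by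
      rw [NL_mulVec, h.a1, h.a2, Bf_symm cf.q1 y x, Bf_symm cf.q2 y x, h.b1, h.b2]; ext i; fin_cases i <;> rfl
    have my : NL cf x y *ᵥ y = 0 := by
      rw [NL_mulVec, h.b1, h.b2, h.c1, h.c2]; ext i; fin_cases i <;> rfl
    have hKd : finrank Ω (LinearMap.ker (toLin' (NL cf x y))) ≤ 3 := by
      have r1 := LinearMap.finrank_range_add_finrank_ker (toLin' (NL cf x y))
      have r2 := LinearMap.finrank_range_add_finrank_ker (toLin' (NL cf x y)ᵀ)
      have r3 : finrank Ω (LinearMap.ker (toLin' (NL cf x y)ᵀ)) ≤ 1 := by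
        have hle : LinearMap.ker (toLin' (NL cf x y)ᵀ) ≤ Submodule.span Ω {c} := by
          intro z hz
          rw [LinearMap.mem_ker, toLin'_apply, mulVec_transpose] at hz
          obtain ⟨τ, hτ⟩ := h.ker4 z c hz hc hc0
          exact Submodule.mem_span_singleton.mpr ⟨τ, hτ.symm⟩
        exact (Submodule.finrank_mono hle).trans (finrank_span_singleton hc0).le
      have r4 : finrank Ω (LinearMap.range (toLin' (NL cf x y)ᵀ)) = finrank Ω (LinearMap.range (toLin' (NL cf x y))) := by
        have := Matrix.rank_transpose (NL cf x y)
        exact this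
      rw [r4] at r2
      simp only [finrank_fin_fun] at r1 r2
      omega
    have hli : LinearIndependent Ω ![x, dv fr.ds x, dv fr.dt x] := by
      rw [Fintype.linearIndependent_iff]
      intro gg hgg
      have := hx.indep (gg 0) (gg 1) (gg 2) (fun i => by
        have := congrFun hgg i
        simpa [Fin.sum_univ_three, dv] using this)
      intro i; fin_cases i
      · exact this.1
      · exact this.2.1
      · exact this.2.2
    have hsp : Submodule.span Ω (Set.range ![x, dv fr.ds x, dv fr.dt x]) = LinearMap.ker (toLin' (NL cf x y)) := by
      apply Submodule.eq_of_le_of_finrank_le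
      · rw [Submodule.span_le]
        rintro _ ⟨i, rfl⟩
        fin_cases i
        · exact mx
        · exact m1
        · exact m2
      · rw [finrank_span_eq_card hli]; simpa using hKd
    have hyK : y ∈ LinearMap.ker (toLin' (NL cf x y)) := my
    rw [← hsp, Submodule.mem_span_range_iff_exists_fun] at hyK
    obtain ⟨gg, hgg⟩ := hyK
    refine hx.tan y (gg 0) (gg 1) (gg 2) ?_
    rw [← hgg, Fin.sum_univ_three]; rfl
end CI22

namespace CI22
open MvPolynomial Module Matrix
variable {Ω : Type} [Field Ω] [Algebra ℂ Ω] {fr : Frame Ω} {cf : Cfg Ω}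

/-- restriction of a polynomial to the parametrized line u + τ v -/
noncomputable def hl (u v : Fin 6 → Ω) (p : MvPolynomial (Fin 6) ℂ) : Polynomial Ω :=
  aeval (fun i => Polynomial.C (u i) + Polynomial.X * Polynomial.C (v i)) p

theorem hl_eval (u v : Fin 6 → Ω) (p : MvPolynomial (Fin 6) ℂ) (τ : Ω) : (hl u v p).eval τ = aeval (u + τ • v) p := by
  rw [hl]
  induction p using MvPolynomial.induction_on with
  | C a => simp [Polynomial.algebraMap_apply]
  | add p q hp hq => rw [map_add, Polynomial.eval_add, hp, hq, map_add]
  | mul_X p i hp =>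
    rw [map_mul, map_mul, Polynomial.eval_mul, hp, aeval_X, aeval_X]
    congr 1
    simp only [Polynomial.eval_add, Polynomial.eval_mul, Polynomial.eval_C, Polynomial.eval_X, Pi.add_apply, Pi.smul_apply, smul_eq_mul]

theorem hl_der (u v : Fin 6 → Ω) (p : MvPolynomial (Fin 6) ℂ) (τ : Ω) :
    (Polynomial.derivative (hl u v p)).eval τ = ∑ i, gr p (u + τ • v) i * v i := by
  induction p using MvPolynomial.induction_on with
  | C a => simp [hl, gr, Polynomial.algebraMap_apply]
  | add p q hp hq =>
    have : hl u v (p + q) = hl u v p + hl u v q := by simp [hl]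
    rw [this]
    simp only [map_add, Polynomial.eval_add, hp, hq, gr, ← Finset.sum_add_distrib, add_mul]
  | mul_X p i hp =>
    have : hl u v (p * X i) = hl u v p * (Polynomial.C (u i) + Polynomial.X * Polynomial.C (v i)) := by simp [hl]
    rw [this, Polynomial.derivative_mul, Polynomial.eval_add, Polynomial.eval_mul, Polynomial.eval_mul, hp, hl_eval]
    have h2 : ∀ j, gr (p * X i) (u + τ • v) j = gr p (u + τ • v) j * (u i + τ * v i) + (if j = i then aeval (u + τ • v) p else 0) := by
      intro j
      rw [gr, pderiv_mul, pderiv_X]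
      by_cases h : j = i
      · subst h; simp [gr]
      · simp [gr, h, Pi.single_apply, Ne.symm h]
    simp only [h2, add_mul, Finset.sum_add_distrib, ite_mul, zero_mul, Finset.sum_ite_eq', Finset.mem_univ, if_true]
    simp
    rw [Finset.sum_mul]
    exact Finset.sum_congr rfl fun j _ => by ring

theorem hl_deg (u v : Fin 6 → Ω) {p : MvPolynomial (Fin 6) ℂ} {k : ℕ} (hp : p.IsHomogeneous k) : (hl u v p).natDegree ≤ k := by
  rw [hl, aeval_def, eval₂_eq]
  refine Polynomial.natDegree_sum_le_of_forall_le _ _ fun m hm => ?_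
  have hk : ∑ i, m i = k := by
    have := hp (mem_support_iff.mp hm)
    rw [← this, Finsupp.weight_apply, Finsupp.sum_fintype _ _ (by simp)]; simp
  rw [Polynomial.algebraMap_apply]
  refine (Polynomial.natDegree_C_mul_le _ _).trans ?_
  refine (Polynomial.natDegree_prod_le _ _).trans ?_
  rw [← hk]
  refine (Finset.sum_le_sum (g := fun i => m i) fun i _ => ?_).trans (Finset.sum_le_sum_of_subset (Finset.subset_univ _))
  refine Polynomial.natDegree_pow_le.trans ?_
  have : (Polynomial.C (u i) + Polynomial.X * Polynomial.C (v i)).natDegree ≤ 1 := by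
    rw [add_comm, mul_comm]
    exact Polynomial.natDegree_linear_le
  nlinarith

theorem double_roots (h : Polynomial Ω) (T : Finset Ω) (h0 : h ≠ 0) (hT : ∀ τ ∈ T, h.IsRoot τ ∧ (Polynomial.derivative h).IsRoot τ) :
    2 * T.card ≤ h.natDegree := by
  classical
  refine le_trans ?_ h.card_roots'
  rw [← Multiset.toFinset_sum_count_eq]
  have hsub : T ⊆ h.roots.toFinset := fun τ hτ => by
    rw [Multiset.mem_toFinset, Polynomial.mem_roots h0]; exact (hT τ hτ).1
  refine le_trans ?_ (Finset.sum_le_sum_of_subset hsub)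
  rw [mul_comm, ← smul_eq_mul, ← Finset.sum_const]
  refine Finset.sum_le_sum fun τ hτ => ?_
  rw [Polynomial.count_roots]
  exact (Polynomial.one_lt_rootMultiplicity_iff_isRoot h0).mpr (hT τ hτ)

theorem root_pair {p : MvPolynomial (Fin 6) ℂ} {k : ℕ} (hp : p.IsHomogeneous k) {u v z : Fin 6 → Ω} {τ c : Ω} (e : u + τ • v = c • z)
    (h0 : aeval z p = 0) (h1 : ∑ i, gr p z i * v i = 0) : (hl u v p).IsRoot τ ∧ (Polynomial.derivative (hl u v p)).IsRoot τ := by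
  rw [Polynomial.IsRoot.def, Polynomial.IsRoot.def, hl_eval, hl_der, e]
  refine ⟨by rw [aeval_smul_hom hp, h0, mul_zero], ?_⟩
  rw [gr_smul hp]
  simp only [Pi.smul_apply, smul_eq_mul, mul_assoc]
  rw [← Finset.mul_sum, h1, mul_zero]

/-- the lines of a two-line configuration lie in X -/
theorem line_in_X [IsAlgClosed Ω] {m : ℕ} (hm : cf.d ≤ m + 2) {S : Finset (Fin 6 → Ω)} (hS : ∀ x, x ∈ S ↔ Pt fr cf x) {W₁ W₂} (hT : TwoLines m S W₁ W₂) :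
    ∃ u v, u ∈ S ∧ v ∈ S ∧ InZ cf u v ∧ ∀ τ : Ω, aeval (u + τ • v) cf.g = 0 := by
  classical
  have hS' : ∀ x ∈ S, Pt fr cf x := fun x hx => (hS x).mp hx
  have hG := gen_of_pt S hS'
  have hd := cf.hd
  have hc := hT.c1
  have heavy : ∀ x ∈ ins S W₁, ∀ y ∈ ins S W₁, x ≠ y → Heavy S (x, y) := by
    intro x hx y hy hxy
    rw [mem_ins] at hx hy
    refine ⟨hx.1, hy.1, hxy, ?_⟩
    have : 0 < (((ins S W₁).erase x).erase y).card := by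
      have h1 := Finset.pred_card_le_card_erase (s := ins S W₁) (a := x)
      have h2 := Finset.pred_card_le_card_erase (s := (ins S W₁).erase x) (a := y)
      omega
    obtain ⟨z, hz⟩ := Finset.card_pos.mp this
    rw [Finset.mem_erase, Finset.mem_erase, mem_ins] at hz
    refine ⟨z, hz.2.2.1, hz.2.1, hz.1, ?_⟩
    rw [← span_pair_eq hT.f1 hx.2 hy.2 (hG.li hx.1 hy.1 hxy)]
    exact hz.2.2.2
  obtain ⟨u, hu, v, hv, huv⟩ := Finset.one_lt_card.mp (show 1 < (ins S W₁).card by omega)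
  have hZ : InZ cf u v := (heavy u hu v hv huv).inZ hS'
  have hu' := mem_ins.mp hu
  have hv' := mem_ins.mp hv
  refine ⟨u, v, hu'.1, hv'.1, hZ, ?_⟩
  have hsp := span_pair_eq hT.f1 hu'.2 hv'.2 (hG.li hu'.1 hv'.1 huv)
  have ex : ∀ z : Fin 6 → Ω, ∃ ab : Ω × Ω, z ∈ (ins S W₁).erase v → ab.1 ≠ 0 ∧ z = ab.1 • (u + ab.2 • v) := by
    intro z
    by_cases hz : z ∈ (ins S W₁).erase v
    · rw [Finset.mem_erase, mem_ins] at hz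
      have hzs := hz.2.2
      rw [hsp] at hzs
      obtain ⟨a, b, hab⟩ := Submodule.mem_span_pair.mp hzs
      have ha : a ≠ 0 := by
        rintro rfl
        apply hz.1
        apply hG.2 z hz.2.1 v hv'.1
        rw [← hab]; exact Submodule.mem_span_singleton.mpr ⟨b, by simp⟩
      refine ⟨(a, a⁻¹ * b), fun _ => ⟨ha, ?_⟩⟩
      rw [← hab, smul_add, smul_smul, mul_inv_cancel_left₀ ha]
    · exact ⟨0, fun h => absurd h hz⟩
  choose ab hab using ex
  have hinj : Set.InjOn (fun z => (ab z).2) ((ins S W₁).erase v : Finset (Fin 6 → Ω)) := by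
    intro z hz w hw hzw
    obtain ⟨z1, z2⟩ := hab z hz
    obtain ⟨w1, w2⟩ := hab w hw
    simp only at hzw
    rw [← hzw] at w2
    refine hG.2 z (mem_ins.mp (Finset.mem_erase.mp hz).2).1 w (mem_ins.mp (Finset.mem_erase.mp hw).2).1 ?_
    refine Submodule.mem_span_singleton.mpr ⟨(ab z).1 * (ab w).1⁻¹, ?_⟩
    have w3 := congrArg (fun t => ((ab z).1 * (ab w).1⁻¹) • t) w2
    rw [w3, smul_smul, mul_assoc, inv_mul_cancel₀ w1, mul_one]
    exact z2.symm
  have hroot : ∀ τ ∈ ((ins S W₁).erase v).image (fun z => (ab z).2), (hl u v cf.g).IsRoot τ ∧ (Polynomial.derivative (hl u v cf.g)).IsRoot τ := by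
    intro τ hτ
    obtain ⟨z, hz, hzt⟩ := Finset.mem_image.mp hτ
    obtain ⟨z1, z2⟩ := hab z hz
    have hzI := (Finset.mem_erase.mp hz).2
    have hzS := (mem_ins.mp hzI).1
    have hz' := heavy z hzI v hv (Finset.mem_erase.mp hz).1
    have k1 : InZ cf z v := Heavy.inZ (p := (z, v)) hS' hz'
    have k2 : thL fr cf z v = 0 := heavy_th (p := (z, v)) hS hT hz'
    have ht : ∑ i, gr cf.g z i * v i = 0 := tangent (fr := fr) (hS' z hzS) k1 k2
    have hzg := (hS' z hzS).zg
    replace hzt : (ab z).2 = τ := hzt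
    rw [hzt] at z2
    have e : u + τ • v = (ab z).1⁻¹ • z := by
      have w3 : (ab z).1⁻¹ • z = (ab z).1⁻¹ • ((ab z).1 • (u + τ • v)) := congrArg (fun t => (ab z).1⁻¹ • t) z2
      rw [w3, smul_smul, inv_mul_cancel₀ z1, one_smul]
    exact root_pair cf.hg e hzg ht
  have h0 : hl u v cf.g = 0 := by
    by_contra hne
    have := double_roots (hl u v cf.g) (((ins S W₁).erase v).image (fun z => (ab z).2)) hne hroot
    rw [Finset.card_image_of_injOn hinj, Finset.card_erase_of_mem hv] at this
    have := this.trans (hl_deg u v cf.hg)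
    omega
  intro τ
  rw [← hl_eval, h0, Polynomial.eval_zero]
end CI22

namespace CI22
open MvPolynomial Module Matrix
variable {Ω : Type} [Field Ω] [Algebra ℂ Ω] {fr : Frame Ω} {cf : Cfg Ω}

noncomputable def NXp (cf : Cfg Ω) (u v : Fin 6 → Ω) : Matrix (Fin 3) (Fin 6) (Polynomial Ω) :=
  fun k i => hl u v (pderiv i (![cf.q1, cf.q2, cf.g] k))

noncomputable def pF (cf : Cfg Ω) (u v : Fin 6 → Ω) (f : Matrix (Fin 3) (Fin 6) Ω) : Polynomial Ω :=
  (stk e33 (NXp cf u v) (f.map Polynomial.C)).det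

noncomputable def UL3 (u v w : Fin 6 → Ω) : Matrix (Fin 6) (Fin 3) Ω := fun i => ![u i, v i, w i]

theorem pF_eval (u v : Fin 6 → Ω) (f : Matrix (Fin 3) (Fin 6) Ω) (τ : Ω) :
    (pF cf u v f).eval τ = (stk e33 (NX cf (u + τ • v)) f).det := by
  rw [pF, ← Polynomial.coe_evalRingHom, RingHom.map_det]
  congr 1
  ext i j
  rcases i with i | i
  · simp only [RingHom.mapMatrix_apply, map_apply, stk, submatrix_apply, id, fromRows_apply_inl, NXp, Polynomial.coe_evalRingHom, hl_eval, NX]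
    fin_cases i <;> rfl
  · simp [stk]

theorem UL3_lin (u v a b : Fin 6 → Ω) (f : Matrix (Fin 3) (Fin 6) Ω) (τ : Ω) :
    ((f * UL3 u v (a + τ • b) : Matrix (Fin 3) (Fin 3) Ω)).det =
      (Polynomial.C (f * UL3 u v a : Matrix (Fin 3) (Fin 3) Ω).det + Polynomial.C (f * UL3 u v b : Matrix (Fin 3) (Fin 3) Ω).det * Polynomial.X).eval τ := by
  have e0 : ∀ w i, (f * UL3 u v w : Matrix (Fin 3) (Fin 3) Ω) i 0 = (f *ᵥ u) i := fun w i => rfl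
  have e1 : ∀ w i, (f * UL3 u v w : Matrix (Fin 3) (Fin 3) Ω) i 1 = (f *ᵥ v) i := fun w i => rfl
  have e2 : ∀ w i, (f * UL3 u v w : Matrix (Fin 3) (Fin 3) Ω) i 2 = (f *ᵥ w) i := fun w i => rfl
  simp only [det_fin_three, e0, e1, e2, mulVec_add, mulVec_smul, Pi.add_apply, Pi.smul_apply, smul_eq_mul, Polynomial.eval_add, Polynomial.eval_mul, Polynomial.eval_C, Polynomial.eval_X]
  ring

noncomputable def nF (u v a b : Fin 6 → Ω) (f : Matrix (Fin 3) (Fin 6) Ω) : Polynomial Ω :=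
  Polynomial.C (f * UL3 u v a : Matrix (Fin 3) (Fin 3) Ω).det + Polynomial.C (f * UL3 u v b : Matrix (Fin 3) (Fin 3) Ω).det * Polynomial.X

theorem nF_deg (u v a b : Fin 6 → Ω) (f : Matrix (Fin 3) (Fin 6) Ω) : (nF u v a b f).natDegree ≤ 1 := by
  rw [nF, add_comm]; exact Polynomial.natDegree_linear_le

theorem line_grad [Infinite Ω] {p : MvPolynomial (Fin 6) ℂ} {k : ℕ} (hp : p.IsHomogeneous k) {u v : Fin 6 → Ω} (h0 : ∀ τ : Ω, aeval (u + τ • v) p = 0) (Δ : Derivation ℂ Ω Ω) (τ : Ω) (j : Fin 3) :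
    ∑ i, gr p (u + τ • v) i * UL3 u v ((fun i => Δ (u i)) + τ • (fun i => Δ (v i))) i j = 0 := by
  have hz : hl u v p = 0 := Polynomial.funext fun τ => by rw [hl_eval, h0, Polynomial.eval_zero]
  have kv : ∑ i, gr p (u + τ • v) i * v i = 0 := by
    rw [← hl_der, hz]; simp
  have ku : ∑ i, gr p (u + τ • v) i * u i = 0 := by
    have := euler hp (u + τ • v)
    rw [h0, mul_zero] at this
    simp only [Pi.add_apply, Pi.smul_apply, smul_eq_mul, mul_add, Finset.sum_add_distrib] at this
    have e : ∑ i, gr p (u + τ • v) i * (τ * v i) = τ * ∑ i, gr p (u + τ • v) i * v i := by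
      rw [Finset.mul_sum]; exact Finset.sum_congr rfl fun i _ => by ring
    rw [e, kv] at this
    simpa using this
  fin_cases j
  · exact ku
  · exact kv
  · have := chain Δ p (u + τ • v)
    rw [h0, map_zero] at this
    simp only [Pi.add_apply, Pi.smul_apply, smul_eq_mul, map_add, Derivation.leibniz] at this
    have e : ∑ i, gr p (u + τ • v) i * (v i * Δ τ) = Δ τ * ∑ i, gr p (u + τ • v) i * v i := by
      rw [Finset.mul_sum]; exact Finset.sum_congr rfl fun i _ => by ring
    rw [kv, mul_zero] at e
    simp only [mul_add, Finset.sum_add_distrib, e, add_zero] at this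
    rw [← Finset.sum_add_distrib] at this
    rw [this]
    exact Finset.sum_congr rfl fun i _ => by simp [UL3]; ring

structure LineX (cf : Cfg Ω) (u v : Fin 6 → Ω) : Prop where
  li : LinearIndependent Ω ![u, v]
  z1 : ∀ τ : Ω, aeval (u + τ • v) cf.q1 = 0
  z2 : ∀ τ : Ω, aeval (u + τ • v) cf.q2 = 0
  zg : ∀ τ : Ω, aeval (u + τ • v) cf.g = 0
  v1 : aeval v cf.q1 = 0
  v2 : aeval v cf.q2 = 0
  vg : aeval v cf.g = 0

theorem LineX.ne {u v : Fin 6 → Ω} (h : LineX cf u v) (τ : Ω) : u + τ • v ≠ 0 := by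
  intro h0
  have := LinearIndependent.pair_iff.mp h.li 1 τ (by rw [one_smul]; exact h0)
  exact one_ne_zero this.1

theorem LineX.nv {u v : Fin 6 → Ω} (h : LineX cf u v) : v ≠ 0 := by
  intro h0
  have := LinearIndependent.pair_iff.mp h.li 0 1 (by simp [h0])
  exact one_ne_zero this.2

theorem LineX.cross [Infinite Ω] {u v : Fin 6 → Ω} (h : LineX cf u v) (Δ : Derivation ℂ Ω Ω) (f f' : Matrix (Fin 3) (Fin 6) Ω) :
    nF u v (fun i => Δ (u i)) (fun i => Δ (v i)) f * pF cf u v f' = nF u v (fun i => Δ (u i)) (fun i => Δ (v i)) f' * pF cf u v f := by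
  refine Polynomial.funext fun τ => ?_
  obtain ⟨ξ, hξ⟩ := exists_right_inv (NX cf (u + τ • v)) (NX_rows cf _ (h.ne τ) (h.z1 τ) (h.z2 τ) (h.zg τ))
  have hU : NX cf (u + τ • v) * UL3 u v ((fun i => Δ (u i)) + τ • (fun i => Δ (v i))) = 0 := by
    ext i j
    rw [mul_apply]
    fin_cases i
    · exact line_grad cf.h1 h.z1 Δ τ j
    · exact line_grad cf.h2 h.z2 Δ τ j
    · exact line_grad cf.hg h.zg Δ τ j
  have r1 := ratio e33 _ ξ _ hξ hU f
  have r2 := ratio e33 _ ξ _ hξ hU f'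
  rw [Polynomial.eval_mul, Polynomial.eval_mul, pF_eval, pF_eval, nF, nF, ← UL3_lin, ← UL3_lin]
  erw [r1, r2]
  ring

theorem LineX.top [IsAlgClosed Ω] {u v : Fin 6 → Ω} (h : LineX cf u v) : Ideal.span (Set.range (pF cf u v)) = ⊤ := by
  by_contra hne
  obtain ⟨M, hM, hle⟩ := Ideal.exists_le_maximal _ hne
  obtain ⟨w, rfl⟩ := (IsPrincipalIdealRing.principal M).principal
  have hw : w.degree ≠ 0 := by
    intro h0
    apply hM.ne_top
    have : IsUnit w := Polynomial.isUnit_iff_degree_eq_zero.mpr h0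
    exact Ideal.span_singleton_eq_top.mpr this
  obtain ⟨τ, hτ⟩ := IsAlgClosed.exists_root w hw
  obtain ⟨ξ, hξ⟩ := exists_right_inv (NX cf (u + τ • v)) (NX_rows cf _ (h.ne τ) (h.z1 τ) (h.z2 τ) (h.zg τ))
  obtain ⟨f, hf⟩ := exists_compl e33 _ ξ hξ
  apply hf
  rw [← pF_eval]
  have : pF cf u v f ∈ Ideal.span {w} := hle (Ideal.subset_span ⟨f, rfl⟩)
  obtain ⟨c, hc⟩ := Ideal.mem_span_singleton.mp this
  rw [hc, Polynomial.eval_mul, hτ, zero_mul]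

theorem LineX.dvd [IsAlgClosed Ω] [Infinite Ω] {u v : Fin 6 → Ω} (h : LineX cf u v) (Δ : Derivation ℂ Ω Ω) (f : Matrix (Fin 3) (Fin 6) Ω) :
    pF cf u v f ∣ nF u v (fun i => Δ (u i)) (fun i => Δ (v i)) f := by
  have key : ∀ w ∈ Ideal.span (Set.range (pF cf u v)), pF cf u v f ∣ nF u v (fun i => Δ (u i)) (fun i => Δ (v i)) f * w := by
    intro w hw
    induction hw using Submodule.span_induction with
    | mem x hx =>
      obtain ⟨f', rfl⟩ := hx
      rw [h.cross Δ f f']; exact dvd_mul_left _ _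
    | zero => simp
    | add x y _ _ hx hy => rw [mul_add]; exact dvd_add hx hy
    | smul a x _ hx => rw [smul_eq_mul, mul_left_comm]; exact hx.mul_left _
  have := key 1 (by rw [h.top]; trivial)
  rwa [mul_one] at this

theorem pF_rev (cf : Cfg Ω) (u v : Fin 6 → Ω) (f : Matrix (Fin 3) (Fin 6) Ω) (τ : Ω) (hτ : τ ≠ 0) :
    (pF cf u v f).eval τ⁻¹ * τ ^ (cf.d + 1) = (pF cf v u f).eval τ := by
  have hd := cf.hd
  rw [pF_eval, pF_eval]
  have e : v + τ • u = τ • (u + τ⁻¹ • v) := by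
    rw [smul_add, smul_smul, mul_inv_cancel₀ hτ, one_smul, add_comm]
  rw [e]
  generalize u + τ⁻¹ • v = w
  have : stk e33 (NX cf (τ • w)) f = Matrix.of fun i j => (Sum.elim ![τ, τ, τ ^ (cf.d - 1)] (fun _ => 1) i) * stk e33 (NX cf w) f i j := by
    ext i j
    rcases i with i | i
    · fin_cases i
      · have := congrFun (gr_smul cf.h1 τ w) (e33 j)
        change gr cf.q1 (τ • w) (e33 j) = τ * gr cf.q1 w (e33 j)
        rw [this]; simp
      · have := congrFun (gr_smul cf.h2 τ w) (e33 j)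
        change gr cf.q2 (τ • w) (e33 j) = τ * gr cf.q2 w (e33 j)
        rw [this]; simp
      · have := congrFun (gr_smul cf.hg τ w) (e33 j)
        change gr cf.g (τ • w) (e33 j) = τ ^ (cf.d - 1) * gr cf.g w (e33 j)
        rw [this]; simp
    · simp [stk]
  rw [this, det_mul_column, Fintype.prod_sum_type, Fin.prod_univ_three]
  simp
  rw [show cf.d + 1 = 1 + 1 + (cf.d - 1) by omega, pow_add, pow_add]
  ring

theorem pF_deg (cf : Cfg Ω) [Infinite Ω] (u v : Fin 6 → Ω) (f : Matrix (Fin 3) (Fin 6) Ω) (hf : (stk e33 (NX cf v) f).det ≠ 0) :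
    1 < (pF cf u v f).natDegree := by
  by_contra hlt
  have hd := cf.hd
  obtain ⟨a, b, hab⟩ := Polynomial.exists_eq_X_add_C_of_natDegree_le_one (not_lt.mp hlt)
  have : pF cf v u f = Polynomial.C a * Polynomial.X ^ cf.d + Polynomial.C b * Polynomial.X ^ (cf.d + 1) := by
    refine Polynomial.eq_of_infinite_eval_eq _ _ ((Set.infinite_univ.diff (Set.finite_singleton (0 : Ω))).mono ?_)
    rintro τ ⟨-, hτ⟩
    have hτ : τ ≠ 0 := hτ
    have := pF_rev cf u v f τ hτ
    rw [Set.mem_setOf_eq, ← this, hab]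
    simp
    field_simp
    ring
  have h2 : (pF cf v u f).eval 0 = 0 := by
    rw [this]; simp; omega
  rw [pF_eval, zero_smul, add_zero] at h2
  exact hf h2

theorem LineX.dep [IsAlgClosed Ω] [Infinite Ω] {u v : Fin 6 → Ω} (h : LineX cf u v) (Δ : Derivation ℂ Ω Ω) : ∃ a b : Ω, ∀ i, a * u i + b * v i + Δ (u i) = 0 := by
  obtain ⟨ξ, hξ⟩ := exists_right_inv (NX cf v) (NX_rows cf _ h.nv h.v1 h.v2 h.vg)
  obtain ⟨f, hf⟩ := exists_compl e33 _ ξ hξ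
  have hdeg := pF_deg cf u v f hf
  have hn0 := Polynomial.eq_zero_of_dvd_of_natDegree_lt (h.dvd Δ f) (lt_of_le_of_lt (nF_deg _ _ _ _ _) hdeg)
  have hp0 : pF cf u v f ≠ 0 := by
    intro h0; rw [h0] at hdeg; simp at hdeg
  have hall : ∀ f' : Matrix (Fin 3) (Fin 6) Ω, (f' * UL3 u v (fun i => Δ (u i)) : Matrix (Fin 3) (Fin 3) Ω).det = 0 := by
    intro f'
    have := h.cross Δ f' f
    rw [hn0, zero_mul] at this
    have := congrArg (Polynomial.eval 0) ((mul_eq_zero.mp this).resolve_right hp0)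
    simpa [nF] using this
  by_contra! hcon
  obtain ⟨f', hf'⟩ := exists_left_inv (UL3 u v (fun i => Δ (u i))) (by
    intro c hc
    have hc' : ∀ i, u i * c 0 + v i * c 1 + Δ (u i) * c 2 = 0 := by
      intro i
      have := congrFun hc i
      simpa [mulVec, dotProduct, Fin.sum_univ_three, UL3] using this
    have h2 : c 2 = 0 := by
      by_contra h2
      obtain ⟨i, hi⟩ := hcon ((c 2)⁻¹ * c 0) ((c 2)⁻¹ * c 1)
      apply hi
      have := hc' i
      field_simp
      linear_combination this
    have := LinearIndependent.pair_iff.mp h.li (c 0) (c 1) (by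
      ext i
      have := hc' i
      rw [h2] at this
      simp
      linear_combination this)
    ext i
    fin_cases i
    · exact this.1
    · exact this.2
    · exact h2)
  have := hall f'
  rw [hf', det_one] at this
  exact one_ne_zero this

theorem LineX.absurd [IsAlgClosed Ω] [Infinite Ω] {u v : Fin 6 → Ω} (h : LineX cf u v) (hu : Pt fr cf u) : False := by
  obtain ⟨a, b, hab⟩ := h.dep fr.ds
  obtain ⟨a', b', hab'⟩ := h.dep fr.dt
  have := hu.indep (b' * a - b * a') b' (-b) (fun i => by linear_combination b' * hab i - b * hab' i)
  have hb : b = 0 := by simpa using this.2.2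
  have := hu.indep a 1 0 (fun i => by
    have := hab i
    rw [hb] at this
    linear_combination this)
  exact one_ne_zero this.2.1

theorem no_two_lines [IsAlgClosed Ω] {m : ℕ} (hm : cf.d ≤ m + 2) {S : Finset (Fin 6 → Ω)} (hS : ∀ x, x ∈ S ↔ Pt fr cf x) {W₁ W₂} (hT : TwoLines m S W₁ W₂) : False := by
  have : Infinite Ω := inf_om
  obtain ⟨u, v, hu, hv, hZ, hg⟩ := line_in_X hm hS hT
  have hu := (hS u).mp hu
  have hv := (hS v).mp hv
  have q : ∀ (p : MvPolynomial (Fin 6) ℂ) (hp : p.IsHomogeneous 2) (h1 : Bf p u u = 0) (h2 : Bf p u v = 0) (h3 : Bf p v v = 0) (τ : Ω), aeval (u + τ • v) p = 0 := by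
    intro p hp h1 h2 h3 τ
    rw [Bf_self_zero hp]
    have h4 : Bf p v u = 0 := by rw [Bf_symm]; exact h2
    simp [h1, h2, h3, h4]
  exact LineX.absurd (fr := fr) (cf := cf) (u := u) (v := v) ⟨LinearIndependent.pair_iff.mpr hZ.li, q _ cf.h1 hZ.a1 hZ.b1 hZ.c1, q _ cf.h2 hZ.a2 hZ.b2 hZ.c2, hg, hv.z1, hv.z2, hv.zg⟩ hu
end CI22

namespace CI22
open MvPolynomial Module Matrix
variable {Ω : Type} [Field Ω] [Algebra ℂ Ω] {fr : Frame Ω} {cf : Cfg Ω}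

theorem core [IsAlgClosed Ω] {S : Finset (Fin 6 → Ω)} (hS : ∀ x, x ∈ S ↔ Pt fr cf x) (hne : S.Nonempty) (hc : S.card ≤ 2 * cf.d) :
    2 * cf.d - 2 ≤ S.card ∧ ∃ W p r, SmoothPlane cf S W p r := by
  have hd := cf.hd
  have hS' : ∀ x ∈ S, Pt fr cf x := fun x hx => (hS x).mp hx
  have hG := gen_of_pt S hS'
  have hcb := cb_of_pt S hS
  have hz1 : ∀ x ∈ S, Bf cf.q1 x x = 0 := fun x hx => (Bf_self_zero cf.h1 x).mp (hS' x hx).z1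
  have hz2 : ∀ x ∈ S, Bf cf.q2 x x = 0 := fun x hx => (Bf_self_zero cf.h2 x).mp (hS' x hx).z2
  rcases plane_cases cf (m := cf.d - 2) (by omega) hcb hG (by omega) hne hz1 hz2 with ⟨W₁, W₂, hT⟩ | ⟨W, p, r, hW⟩
  · exact (no_two_lines (by omega) hS hT).elim
  · have := smooth_card (cf := cf) (by omega) hcb hG hne hz1 hz2 hW
    exact ⟨by omega, W, p, r, hW⟩

/-- localization of a subalgebra at a complex point, inside the field -/
theorem loc_ext (B : Subalgebra ℂ Ω) (σ₀ : B →ₐ[ℂ] ℂ) :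
    ∃ (R : Subalgebra ℂ Ω) (σ : R →ₐ[ℂ] ℂ), (∀ x : B, ∃ h : (x : Ω) ∈ R, σ ⟨x, h⟩ = σ₀ x) ∧
      ∀ (c b : B) (x : Ω), σ₀ c ≠ 0 → (c : Ω) * x = b → x ∈ R := by
  classical
  have uniq : ∀ (x : Ω) (c b c' b' : B), (c : Ω) * x = b → (c' : Ω) * x = b' → σ₀ c * σ₀ b' = σ₀ c' * σ₀ b := by
    intro x c b c' b' h h'
    rw [← map_mul, ← map_mul]
    congr 1
    apply Subtype.ext
    push_cast
    rw [← h, ← h']; ring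
  let R : Subalgebra ℂ Ω :=
    { carrier := {x | ∃ c b : B, σ₀ c ≠ 0 ∧ (c : Ω) * x = b}
      mul_mem' := by
        rintro x y ⟨c, b, hc, h⟩ ⟨c', b', hc', h'⟩
        refine ⟨c * c', b * b', by rw [map_mul]; exact mul_ne_zero hc hc', ?_⟩
        push_cast; rw [← h, ← h']; ring
      add_mem' := by
        rintro x y ⟨c, b, hc, h⟩ ⟨c', b', hc', h'⟩
        refine ⟨c * c', b * c' + b' * c, by rw [map_mul]; exact mul_ne_zero hc hc', ?_⟩
        push_cast; rw [← h, ← h']; ring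
      algebraMap_mem' := fun z => ⟨1, algebraMap ℂ B z, by simp, by simp⟩ }
  have hR : ∀ x : R, ∃ c b : B, σ₀ c ≠ 0 ∧ (c : Ω) * x = b := fun x => x.2
  choose c b hc hb using hR
  have val : ∀ (x : R) (c' b' : B), σ₀ c' ≠ 0 → (c' : Ω) * x = b' → σ₀ (b x) / σ₀ (c x) = σ₀ b' / σ₀ c' := by
    intro x c' b' hc' h'
    rw [div_eq_div_iff (hc x) hc']
    have := uniq x _ _ _ _ (hb x) h'
    linear_combination -this
  let σ : R →ₐ[ℂ] ℂ := 
    { toFun := fun x => σ₀ (b x) / σ₀ (c x)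
      map_one' := by rw [val 1 1 1 (by simp) (by simp)]; simp
      map_zero' := by rw [val 0 1 0 (by simp) (by simp)]; simp
      map_mul' := fun x y => by
        rw [val (x * y) (c x * c y) (b x * b y) (by rw [map_mul]; exact mul_ne_zero (hc x) (hc y)) (by push_cast; rw [← hb x, ← hb y]; ring)]
        rw [map_mul, map_mul, mul_div_mul_comm]
      map_add' := fun x y => by
        rw [val (x + y) (c x * c y) (b x * c y + b y * c x) (by rw [map_mul]; exact mul_ne_zero (hc x) (hc y)) (by push_cast; rw [← hb x, ← hb y]; ring)]
        have h1 := hc x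
        have h2 := hc y
        rw [map_mul, map_add, map_mul, map_mul]
        field_simp
      commutes' := fun z => by
        rw [val (algebraMap ℂ R z) 1 (algebraMap ℂ B z) (by simp) (by simp)]; simp }
  refine ⟨R, σ, fun x => ⟨⟨1, x, by simp, by simp⟩, ?_⟩, fun c b x hc h => ⟨c, b, hc, h⟩⟩
  have := val ⟨x, ⟨1, x, by simp, by simp⟩⟩ 1 x (by simp) (by simp)
  refine Eq.trans this ?_
  rw [map_one σ₀, div_one]

/-- specialization data at a point -/
structure Spec (fr : Frame Ω) (a : Fin 2 → ℂ) where
  R : Subalgebra ℂ Ω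
  σ : R →ₐ[ℂ] ℂ
  hs : fr.s ∈ R
  ht : fr.t ∈ R
  σs : σ ⟨fr.s, hs⟩ = a 0
  σt : σ ⟨fr.t, ht⟩ = a 1

theorem spread (fr : Frame Ω) (hI : AlgebraicIndependent ℂ ![fr.s, fr.t]) :
    ∃ den : Ω → MvPolynomial (Fin 2) ℂ, (∀ x, den x ≠ 0) ∧ ∀ a : Fin 2 → ℂ, ∃ P : Spec fr a, ∀ x, eval a (den x) ≠ 0 → x ∈ P.R := by
  classical
  letI : Algebra (MvPolynomial (Fin 2) ℂ) Ω := (aeval ![fr.s, fr.t] : MvPolynomial (Fin 2) ℂ →ₐ[ℂ] Ω).toRingHom.toAlgebra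
  have hmap : ∀ p, algebraMap (MvPolynomial (Fin 2) ℂ) Ω p = aeval ![fr.s, fr.t] p := fun p => rfl
  haveI : IsScalarTower ℂ (MvPolynomial (Fin 2) ℂ) Ω := IsScalarTower.of_algebraMap_eq (fun z => by rw [hmap]; simp)
  have hinj : Function.Injective (algebraMap (MvPolynomial (Fin 2) ℂ) Ω) := hI
  haveI : FaithfulSMul (MvPolynomial (Fin 2) ℂ) Ω := (faithfulSMul_iff_algebraMap_injective _ _).mpr hinj
  have halg : Algebra.IsAlgebraic (MvPolynomial (Fin 2) ℂ) Ω := by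
    let F := IntermediateField.adjoin ℂ {fr.s, fr.t}
    have h1 : Algebra.IsAlgebraic F Ω := fr.alg
    have h2 : Algebra.IsAlgebraic (Algebra.adjoin ℂ {fr.s, fr.t}) Ω := by
      open scoped IntermediateField.algebraAdjoinAdjoin in
      exact IsFractionRing.comap_isAlgebraic_iff (K := F).mpr h1
    have hran : Algebra.adjoin ℂ {fr.s, fr.t} = (aeval ![fr.s, fr.t] : MvPolynomial (Fin 2) ℂ →ₐ[ℂ] Ω).range := by
      rw [← Algebra.adjoin_range_eq_range_aeval]
      congr 1
      ext z; simp [eq_comm, or_comm]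
    rw [hran] at h2
    exact Algebra.IsAlgebraic.of_ringHom_of_comp_eq (aeval ![fr.s, fr.t] : MvPolynomial (Fin 2) ℂ →ₐ[ℂ] Ω).rangeRestrict.toRingHom
      (RingHom.id Ω) (AlgHom.rangeRestrict_surjective _) Function.injective_id (by ext <;> rfl)
  have hden : ∀ x : Ω, ∃ y : MvPolynomial (Fin 2) ℂ, y ≠ 0 ∧ IsIntegral (MvPolynomial (Fin 2) ℂ) (y • x) := fun x => by
    obtain ⟨y, hy, h⟩ := (halg.isAlgebraic x).exists_integral_multiple
    exact ⟨y, hy, h⟩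
  choose den hden hintg using hden
  refine ⟨den, hden, fun a => ?_⟩
  let B := integralClosure (MvPolynomial (Fin 2) ℂ) Ω
  let I : Ideal (MvPolynomial (Fin 2) ℂ) := RingHom.ker (aeval a : MvPolynomial (Fin 2) ℂ →ₐ[ℂ] ℂ)
  have hIm : I.IsMaximal := RingHom.ker_isMaximal_of_surjective _ (fun z => ⟨C z, by simp⟩)
  obtain ⟨P, hP, hPI⟩ := Ideal.exists_ideal_over_maximal_of_isIntegral (S := B) I (by
    have : Function.Injective (algebraMap (MvPolynomial (Fin 2) ℂ) B) := fun x y hxy => hinj (congrArg (Subtype.val) hxy)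
    rw [(RingHom.injective_iff_ker_eq_bot _).mp this]; exact bot_le)
  let B' : Subalgebra ℂ Ω := B.restrictScalars ℂ
  have hi : Algebra.IsIntegral ℂ (B ⧸ P) := by
    constructor
    intro z
    obtain ⟨x, rfl⟩ := Ideal.Quotient.mk_surjective z
    have hx : IsIntegral (MvPolynomial (Fin 2) ℂ) x := Algebra.IsIntegral.isIntegral x
    obtain ⟨f, hf, hfx⟩ := hx
    refine ⟨f.map (aeval a : MvPolynomial (Fin 2) ℂ →ₐ[ℂ] ℂ).toRingHom, hf.map _, ?_⟩
    have hcomp : (algebraMap ℂ (B ⧸ P)).comp (aeval a : MvPolynomial (Fin 2) ℂ →ₐ[ℂ] ℂ).toRingHom = (Ideal.Quotient.mk P).comp (algebraMap (MvPolynomial (Fin 2) ℂ) B) := by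
      ext p
      · simp
        rw [IsScalarTower.algebraMap_apply ℂ (MvPolynomial (Fin 2) ℂ) (B ⧸ P)]; rfl
      · simp only [RingHom.comp_apply]
        have hk : X p - C (a p) ∈ I := by
          rw [RingHom.mem_ker]; simp
        rw [← hPI, Ideal.mem_comap, map_sub] at hk
        have := Ideal.Quotient.eq.mpr hk
        rw [this]
        simp
        rw [IsScalarTower.algebraMap_apply ℂ (MvPolynomial (Fin 2) ℂ) (B ⧸ P)]; rfl
    rw [Polynomial.eval₂_map, hcomp, ← Polynomial.hom_eval₂, hfx, map_zero]
  haveI : IsDomain (B ⧸ P) := Ideal.Quotient.isDomain P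
  have hbij := IsAlgClosed.algebraMap_bijective_of_isIntegral (k := ℂ) (K := B ⧸ P)
  let eqv : ℂ ≃ₐ[ℂ] (B ⧸ P) := AlgEquiv.ofBijective (Algebra.ofId ℂ _) hbij
  let σ₀ : B →ₐ[ℂ] ℂ := eqv.symm.toAlgHom.comp (Ideal.Quotient.mkₐ ℂ P)
  have hX : ∀ i, σ₀ (algebraMap (MvPolynomial (Fin 2) ℂ) B (X i)) = a i := by
    intro i
    have hk : X i - C (a i) ∈ I := by
      rw [RingHom.mem_ker]; simp
    rw [← hPI, Ideal.mem_comap, map_sub] at hk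
    have := Ideal.Quotient.eq.mpr hk
    show eqv.symm (Ideal.Quotient.mk P _) = _
    rw [this, AlgEquiv.symm_apply_eq]
    show _ = algebraMap ℂ (B ⧸ P) (a i)
    rw [IsScalarTower.algebraMap_apply ℂ (MvPolynomial (Fin 2) ℂ) (B ⧸ P)]; rfl
  have hA : ∀ p, σ₀ (algebraMap (MvPolynomial (Fin 2) ℂ) B p) = eval a p := by
    intro p
    have : σ₀.comp (IsScalarTower.toAlgHom ℂ (MvPolynomial (Fin 2) ℂ) B) = aeval a := by
      apply MvPolynomial.algHom_ext
      intro i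
      rw [aeval_X]; exact hX i
    have := AlgHom.congr_fun this p
    rw [← MvPolynomial.coe_aeval_eq_eval]; exact this
  obtain ⟨R, σ, h1, h2⟩ := loc_ext B' σ₀
  obtain ⟨hs, hs'⟩ := h1 (algebraMap (MvPolynomial (Fin 2) ℂ) B (X 0))
  obtain ⟨ht, ht'⟩ := h1 (algebraMap (MvPolynomial (Fin 2) ℂ) B (X 1))
  have es : ((algebraMap (MvPolynomial (Fin 2) ℂ) B (X 0) : B) : Ω) = fr.s := by
    show aeval _ _ = _; simp
  have et : ((algebraMap (MvPolynomial (Fin 2) ℂ) B (X 1) : B) : Ω) = fr.t := by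
    show aeval _ _ = _; simp
  refine ⟨⟨R, σ, es ▸ hs, et ▸ ht, ?_, ?_⟩, ?_⟩
  · refine Eq.trans ?_ (hs'.trans (hX 0))
    congr 1
    exact Subtype.ext es.symm
  · refine Eq.trans ?_ (ht'.trans (hX 1))
    congr 1
    exact Subtype.ext et.symm
  · intro x hx
    refine h2 (algebraMap (MvPolynomial (Fin 2) ℂ) B (den x)) ⟨den x • x, hintg x⟩ x (fun h0 => hx ((hA _).symm.trans h0)) ?_
    exact (Algebra.smul_def (den x) x).symm
end CI22

namespace CI22
open MvPolynomial Module Matrix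
variable {Ω : Type} [Field Ω] [Algebra ℂ Ω] {fr : Frame Ω} {cf : Cfg Ω}

theorem spreadE (fr : Frame Ω) (hI : AlgebraicIndependent ℂ ![fr.s, fr.t]) (E : Finset Ω) :
    ∃ D : MvPolynomial (Fin 2) ℂ, D ≠ 0 ∧ ∀ a : Fin 2 → ℂ, eval a D ≠ 0 → ∃ P : Spec fr a, ∀ x ∈ E, x ∈ P.R := by
  obtain ⟨den, h0, h⟩ := spread fr hI
  refine ⟨∏ x ∈ E, den x, Finset.prod_ne_zero_iff.mpr fun x _ => h0 x, fun a ha => ?_⟩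
  obtain ⟨P, hP⟩ := h a
  refine ⟨P, fun x hx => hP x ?_⟩
  rw [eval_prod] at ha
  exact Finset.prod_ne_zero_iff.mp ha x hx

theorem exists_eval_ne {n : ℕ} {D : MvPolynomial (Fin n) ℂ} (hD : D ≠ 0) : ∃ a, eval a D ≠ 0 := by
  by_contra! h
  exact hD (MvPolynomial.funext fun a => by rw [h, map_zero])

open Classical in
/-- the specialization as a total function -/
noncomputable def Spec.sp {a : Fin 2 → ℂ} (P : Spec fr a) (x : Ω) : ℂ := if h : x ∈ P.R then P.σ ⟨x, h⟩ else 0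

section
variable {a : Fin 2 → ℂ} (P : Spec fr a)

theorem Spec.sp_coe (x : P.R) : P.sp x = P.σ x := by
  rw [Spec.sp, dif_pos x.2]

theorem Spec.sp_mk {x : Ω} (h : x ∈ P.R) : P.sp x = P.σ ⟨x, h⟩ := by
  rw [Spec.sp, dif_pos h]

theorem Spec.sp_add {x y : Ω} (hx : x ∈ P.R) (hy : y ∈ P.R) : P.sp (x + y) = P.sp x + P.sp y := by
  lift x to P.R using hx
  lift y to P.R using hy
  rw [sp_coe, sp_coe, ← map_add, ← sp_coe]; rfl

theorem Spec.sp_sub {x y : Ω} (hx : x ∈ P.R) (hy : y ∈ P.R) : P.sp (x - y) = P.sp x - P.sp y := by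
  lift x to P.R using hx
  lift y to P.R using hy
  rw [sp_coe, sp_coe, ← map_sub, ← sp_coe]; rfl

theorem Spec.sp_mul {x y : Ω} (hx : x ∈ P.R) (hy : y ∈ P.R) : P.sp (x * y) = P.sp x * P.sp y := by
  lift x to P.R using hx
  lift y to P.R using hy
  rw [sp_coe, sp_coe, ← map_mul, ← sp_coe]; rfl

theorem Spec.sp_one : P.sp 1 = 1 := by
  rw [sp_mk P P.R.one_mem]; exact map_one P.σ

theorem Spec.sp_zero : P.sp 0 = 0 := by
  rw [sp_mk P P.R.zero_mem]; exact map_zero P.σ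

theorem Spec.sp_alg (z : ℂ) : P.sp (algebraMap ℂ Ω z) = z := by
  rw [sp_mk P (P.R.algebraMap_mem z)]; exact P.σ.commutes z

theorem Spec.sp_sum {ι : Type*} (s : Finset ι) (f : ι → Ω) (h : ∀ i ∈ s, f i ∈ P.R) : P.sp (∑ i ∈ s, f i) = ∑ i ∈ s, P.sp (f i) := by
  classical
  induction s using Finset.induction_on with
  | empty => simp [sp_zero]
  | insert i s hi ih =>
    rw [Finset.sum_insert hi, Finset.sum_insert hi, sp_add, ih]
    · exact fun j hj => h j (Finset.mem_insert_of_mem hj)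
    · exact h i (Finset.mem_insert_self _ _)
    · exact sum_mem fun j hj => h j (Finset.mem_insert_of_mem hj)

theorem Spec.sp_s : P.sp fr.s = a 0 := by rw [sp_mk P P.hs, P.σs]
theorem Spec.sp_t : P.sp fr.t = a 1 := by rw [sp_mk P P.ht, P.σt]

theorem Spec.sp_ne {x : Ω} (hx : x ∈ P.R) (hx' : x⁻¹ ∈ P.R) (h0 : x ≠ 0) : P.sp x ≠ 0 := by
  intro h
  have := P.sp_mul hx hx'
  rw [mul_inv_cancel₀ h0, h, zero_mul, sp_one] at this
  exact one_ne_zero this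

theorem Spec.sp_aeval {n : ℕ} (p : MvPolynomial (Fin n) ℂ) {x : Fin n → Ω} (hx : ∀ i, x i ∈ P.R) :
    aeval x p ∈ P.R ∧ P.sp (aeval x p) = eval (fun i => P.sp (x i)) p := by
  induction p using MvPolynomial.induction_on with
  | C z => 
    simp only [aeval_C, eval_C]
    exact ⟨P.R.algebraMap_mem z, P.sp_alg z⟩
  | add p q hp hq =>
    simp only [map_add]
    exact ⟨add_mem hp.1 hq.1, by rw [P.sp_add hp.1 hq.1, hp.2, hq.2]⟩
  | mul_X p i hp =>
    simp only [map_mul, aeval_X, eval_X]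
    exact ⟨mul_mem hp.1 (hx i), by rw [P.sp_mul hp.1 (hx i), hp.2]⟩

theorem Spec.sp_det {n : ℕ} (M : Matrix (Fin n) (Fin n) Ω) (h : ∀ i j, M i j ∈ P.R) : P.sp M.det = (Matrix.of fun i j => P.sp (M i j)).det := by
  let M' : Matrix (Fin n) (Fin n) P.R := fun i j => ⟨M i j, h i j⟩
  have e1 : M.det = ((M'.det : P.R) : Ω) := by
    have := RingHom.map_det (P.R.val : P.R →+* Ω) M'
    rw [show ((M'.det : P.R) : Ω) = (P.R.val : P.R →+* Ω) M'.det from rfl, this]; rfl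
  have e2 := RingHom.map_det (P.σ : P.R →+* ℂ) M'
  rw [e1, sp_coe]
  refine Eq.trans e2 ?_
  congr 1
  ext i j
  exact (sp_mk P (h i j)).symm
end

theorem smZ_of (fr : Frame Ω) (hI : AlgebraicIndependent ℂ ![fr.s, fr.t]) {q1 q2 : MvPolynomial (Fin 6) ℂ}
    (hZ : ∀ v : Fin 6 → ℂ, v ≠ 0 → eval v q1 = 0 → eval v q2 = 0 →
    ∀ a b : ℂ, (∀ i, a * eval v (pderiv i q1) + b * eval v (pderiv i q2) = 0) → a = 0 ∧ b = 0) :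
    ∀ v : Fin 6 → Ω, v ≠ 0 → aeval v q1 = 0 → aeval v q2 = 0 → ∀ a b : Ω,
    (∀ i, a * gr q1 v i + b * gr q2 v i = 0) → a = 0 ∧ b = 0 := by
  classical
  intro v hv z1 z2 a b hab
  obtain ⟨D, hD, hs⟩ := spreadE fr hI (({a, b, a⁻¹, b⁻¹} : Finset Ω) ∪ Finset.univ.image v ∪ Finset.univ.image (fun i => (v i)⁻¹))
  obtain ⟨y, hy⟩ := exists_eval_ne hD
  obtain ⟨P, hP⟩ := hs y hy
  have hv1 : ∀ i, v i ∈ P.R := fun i => hP _ (by simp)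
  have hv2 : ∀ i, (v i)⁻¹ ∈ P.R := fun i => hP _ (by simp)
  have ha : a ∈ P.R := hP _ (by simp)
  have hb : b ∈ P.R := hP _ (by simp)
  have ha' : a⁻¹ ∈ P.R := hP _ (by simp)
  have hb' : b⁻¹ ∈ P.R := hP _ (by simp)
  obtain ⟨j, hj⟩ := Function.ne_iff.mp hv
  have hres := hZ (fun i => P.sp (v i)) (Function.ne_iff.mpr ⟨j, P.sp_ne (hv1 j) (hv2 j) hj⟩)
    (by rw [← (P.sp_aeval q1 hv1).2, z1, P.sp_zero]) (by rw [← (P.sp_aeval q2 hv1).2, z2, P.sp_zero]) (P.sp a) (P.sp b) (fun i => by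
      have k1 := P.sp_aeval (pderiv i q1) hv1
      have k2 := P.sp_aeval (pderiv i q2) hv1
      rw [← k1.2, ← k2.2, ← P.sp_mul ha k1.1, ← P.sp_mul hb k2.1, ← P.sp_add (mul_mem ha k1.1) (mul_mem hb k2.1)]
      have := hab i
      rw [gr, gr] at this
      rw [this, P.sp_zero])
  constructor
  · by_contra h; exact P.sp_ne ha ha' h hres.1
  · by_contra h; exact P.sp_ne hb hb' h hres.2

theorem smX_of (fr : Frame Ω) (hI : AlgebraicIndependent ℂ ![fr.s, fr.t]) {q1 q2 g : MvPolynomial (Fin 6) ℂ}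
    (hX : ∀ v : Fin 6 → ℂ, v ≠ 0 → eval v q1 = 0 → eval v q2 = 0 → eval v g = 0 →
    ∀ a b c : ℂ, (∀ i, a * eval v (pderiv i q1) + b * eval v (pderiv i q2) + c * eval v (pderiv i g) = 0) → a = 0 ∧ b = 0 ∧ c = 0) :
    ∀ v : Fin 6 → Ω, v ≠ 0 → aeval v q1 = 0 → aeval v q2 = 0 → aeval v g = 0 → ∀ a b c : Ω,
    (∀ i, a * gr q1 v i + b * gr q2 v i + c * gr g v i = 0) → a = 0 ∧ b = 0 ∧ c = 0 := by
  classical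
  intro v hv z1 z2 zg a b c hab
  obtain ⟨D, hD, hs⟩ := spreadE fr hI (({a, b, c, a⁻¹, b⁻¹, c⁻¹} : Finset Ω) ∪ Finset.univ.image v ∪ Finset.univ.image (fun i => (v i)⁻¹))
  obtain ⟨y, hy⟩ := exists_eval_ne hD
  obtain ⟨P, hP⟩ := hs y hy
  have hv1 : ∀ i, v i ∈ P.R := fun i => hP _ (by simp)
  have hv2 : ∀ i, (v i)⁻¹ ∈ P.R := fun i => hP _ (by simp)
  have ha : a ∈ P.R := hP _ (by simp)
  have hb : b ∈ P.R := hP _ (by simp)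
  have hc : c ∈ P.R := hP _ (by simp)
  have ha' : a⁻¹ ∈ P.R := hP _ (by simp)
  have hb' : b⁻¹ ∈ P.R := hP _ (by simp)
  have hc' : c⁻¹ ∈ P.R := hP _ (by simp)
  obtain ⟨j, hj⟩ := Function.ne_iff.mp hv
  have hres := hX (fun i => P.sp (v i)) (Function.ne_iff.mpr ⟨j, P.sp_ne (hv1 j) (hv2 j) hj⟩)
    (by rw [← (P.sp_aeval q1 hv1).2, z1, P.sp_zero]) (by rw [← (P.sp_aeval q2 hv1).2, z2, P.sp_zero])
    (by rw [← (P.sp_aeval g hv1).2, zg, P.sp_zero]) (P.sp a) (P.sp b) (P.sp c) (fun i => by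
      have k1 := P.sp_aeval (pderiv i q1) hv1
      have k2 := P.sp_aeval (pderiv i q2) hv1
      have k3 := P.sp_aeval (pderiv i g) hv1
      rw [← k1.2, ← k2.2, ← k3.2, ← P.sp_mul ha k1.1, ← P.sp_mul hb k2.1, ← P.sp_mul hc k3.1, ← P.sp_add (mul_mem ha k1.1) (mul_mem hb k2.1),
        ← P.sp_add (add_mem (mul_mem ha k1.1) (mul_mem hb k2.1)) (mul_mem hc k3.1)]
      have := hab i
      rw [gr, gr, gr] at this
      rw [this, P.sp_zero])
  refine ⟨?_, ?_, ?_⟩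
  · by_contra h; exact P.sp_ne ha ha' h hres.1
  · by_contra h; exact P.sp_ne hb hb' h hres.2.1
  · by_contra h; exact P.sp_ne hc hc' h hres.2.2

/-- affine description of the fiber over [1 : a 0 : a 1] -/
structure CPt (cf : Cfg Ω) (a : Fin 2 → ℂ) (x : Fin 6 → ℂ) : Prop where
  z1 : eval x cf.q1 = 0
  z2 : eval x cf.q2 = 0
  zg : eval x cf.g = 0
  f0 : eval x cf.F0 ≠ 0
  f1 : eval x cf.F1 = a 0 * eval x cf.F0
  f2 : eval x cf.F2 = a 1 * eval x cf.F0

/-- finitely many generic points specialize to distinct points -/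
theorem spec_points (fr : Frame Ω) (hI : AlgebraicIndependent ℂ ![fr.s, fr.t]) (T : Finset (Fin 6 → Ω)) (hT : ∀ x ∈ T, Pt fr cf x) :
    ∃ D : MvPolynomial (Fin 2) ℂ, D ≠ 0 ∧ ∀ a : Fin 2 → ℂ, eval a D ≠ 0 →
      ∃ T' : Finset (Fin 6 → ℂ), T'.card = T.card ∧ ∀ x ∈ T', CPt cf a x ∧ ∃ i, x i = 1 ∧ ∀ j < i, x j = 0 := by
  classical
  obtain ⟨D, hD, hs⟩ := spreadE fr hI ((T ×ˢ Finset.univ).image (fun p => p.1 p.2) ∪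
    (T.image (fun x => (aeval x cf.F0)⁻¹)) ∪ ((T ×ˢ T) ×ˢ Finset.univ).image (fun p => (p.1.1 p.2 - p.1.2 p.2)⁻¹))
  refine ⟨D, hD, fun a ha => ?_⟩
  obtain ⟨P, hP⟩ := hs a ha
  have h1 : ∀ x ∈ T, ∀ i, x i ∈ P.R := fun x hx i => hP _ (Finset.mem_union_left _ (Finset.mem_union_left _
    (Finset.mem_image.mpr ⟨(x, i), by simp [hx], rfl⟩)))
  have h2 : ∀ x ∈ T, (aeval x cf.F0)⁻¹ ∈ P.R := fun x hx => hP _ (Finset.mem_union_left _ (Finset.mem_union_right _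
    (Finset.mem_image.mpr ⟨x, hx, rfl⟩)))
  have h3 : ∀ x ∈ T, ∀ y ∈ T, ∀ i, (x i - y i)⁻¹ ∈ P.R := fun x hx y hy i => hP _ (Finset.mem_union_right _
    (Finset.mem_image.mpr ⟨((x, y), i), by simp [hx, hy], rfl⟩))
  refine ⟨T.image (fun x i => P.sp (x i)), Finset.card_image_of_injOn ?_, ?_⟩
  · intro x hx y hy hxy
    by_contra hne
    obtain ⟨i, hi⟩ := Function.ne_iff.mp hne
    have := P.sp_ne (sub_mem (h1 x hx i) (h1 y hy i)) (h3 x hx y hy i) (sub_ne_zero.mpr hi)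
    rw [P.sp_sub (h1 x hx i) (h1 y hy i)] at this
    exact this (sub_eq_zero.mpr (congrFun hxy i))
  · intro z hz
    obtain ⟨x, hx, rfl⟩ := Finset.mem_image.mp hz
    have hp := hT x hx
    have ev := fun p => P.sp_aeval p (h1 x hx)
    refine ⟨⟨?_, ?_, ?_, ?_, ?_, ?_⟩, ?_⟩
    · rw [← (ev _).2, hp.z1, P.sp_zero]
    · rw [← (ev _).2, hp.z2, P.sp_zero]
    · rw [← (ev _).2, hp.zg, P.sp_zero]
    · rw [← (ev _).2]; exact P.sp_ne (ev _).1 (h2 x hx) hp.f0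
    · rw [← (ev _).2, ← (ev _).2, hp.f1, P.sp_mul P.hs (ev _).1, P.sp_s]
    · rw [← (ev _).2, ← (ev _).2, hp.f2, P.sp_mul P.ht (ev _).1, P.sp_t]
    · obtain ⟨i, hi, hj⟩ := hp.norm
      exact ⟨i, by simp only; rw [hi, P.sp_one], fun j hji => by simp only; rw [hj j hji, P.sp_zero]⟩
end CI22

namespace CI22
open MvPolynomial Module Matrix
variable {Ω : Type} [Field Ω] [Algebra ℂ Ω] {fr : Frame Ω} {cf : Cfg Ω}

/-- the equations of the fibre over a ring -/
noncomputable def eqsR (cf : Cfg Ω) (A : Type) [CommRing A] [Algebra ℂ A] (s t : A) : Fin 5 → MvPolynomial (Fin 6) A :=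
  ![map (algebraMap ℂ A) cf.q1, map (algebraMap ℂ A) cf.q2, map (algebraMap ℂ A) cf.g,
    map (algebraMap ℂ A) cf.F1 - C s * map (algebraMap ℂ A) cf.F0, map (algebraMap ℂ A) cf.F2 - C t * map (algebraMap ℂ A) cf.F0]

theorem eqsR_map (cf : Cfg Ω) {A B : Type} [CommRing A] [Algebra ℂ A] [CommRing B] [Algebra ℂ B] (f : A →ₐ[ℂ] B) (s t : A) (k : Fin 5) :
    map (f : A →+* B) (eqsR cf A s t k) = eqsR cf B (f s) (f t) k := by
  have h : (f : A →+* B).comp (algebraMap ℂ A) = algebraMap ℂ B := f.comp_algebraMap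
  fin_cases k <;> simp [eqsR, MvPolynomial.map_map, h]

theorem exists_normal {K : Type*} [Field K] {x : Fin 6 → K} (hx : x ≠ 0) : ∃ (c : K) (y : Fin 6 → K), c ≠ 0 ∧ x = c • y ∧ ∃ i, y i = 1 ∧ ∀ j < i, y j = 0 := by
  classical
  obtain ⟨j, hj⟩ := Function.ne_iff.mp hx
  have hne : (Finset.univ.filter (fun i => x i ≠ 0)).Nonempty := ⟨j, by simpa using hj⟩
  obtain ⟨i, hi, hmin⟩ := Finset.exists_minimal hne
  have hi' : x i ≠ 0 := (Finset.mem_filter.mp hi).2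
  refine ⟨x i, (x i)⁻¹ • x, hi', by rw [smul_smul, mul_inv_cancel₀ hi', one_smul], i, by simp [hi'], fun j hji => ?_⟩
  have : x j = 0 := by
    by_contra h0
    exact absurd (hmin (Finset.mem_filter.mpr ⟨Finset.mem_univ j, h0⟩) hji.le) (not_le.mpr hji)
  simp [this]

theorem null_id [IsAlgClosed Ω] (fr : Frame Ω) (cf : Cfg Ω) (A : Fin 6 → Ω) (hA : ∀ x, Pt fr cf x → ∑ i, A i * x i = 0) :
    ∃ (N : ℕ) (c : Fin 5 → MvPolynomial (Fin 6) Ω),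
      ∑ k, c k * eqsR cf Ω fr.s fr.t k = ((∑ i, C (A i) * X i) * map (algebraMap ℂ Ω) cf.F0) ^ N := by
  let I : Ideal (MvPolynomial (Fin 6) Ω) := Ideal.span (Set.range (eqsR cf Ω fr.s fr.t))
  have key : (∑ i, C (A i) * X i) * map (algebraMap ℂ Ω) cf.F0 ∈ I.radical := by
    rw [← vanishingIdeal_zeroLocus_eq_radical (K := Ω), mem_vanishingIdeal_iff]
    intro x hx
    have hx' : ∀ k, aeval x (eqsR cf Ω fr.s fr.t k) = 0 := fun k => hx _ (Ideal.subset_span ⟨k, rfl⟩)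
    have am : ∀ p : MvPolynomial (Fin 6) ℂ, aeval x (map (algebraMap ℂ Ω) p) = aeval x p := fun p => aeval_map_algebraMap Ω x p
    have z1 : aeval x cf.q1 = 0 := by rw [← am]; exact hx' 0
    have z2 : aeval x cf.q2 = 0 := by rw [← am]; exact hx' 1
    have zg : aeval x cf.g = 0 := by rw [← am]; exact hx' 2
    have f1 : aeval x cf.F1 = fr.s * aeval x cf.F0 := by
      have := hx' 3
      simp only [eqsR, Matrix.cons_val] at this
      rw [map_sub, map_mul, am, am, aeval_C] at this
      exact sub_eq_zero.mp this
    have f2 : aeval x cf.F2 = fr.t * aeval x cf.F0 := by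
      have := hx' 4
      simp only [eqsR, Matrix.cons_val] at this
      rw [map_sub, map_mul, am, am, aeval_C] at this
      exact sub_eq_zero.mp this
    rw [map_mul, am]
    by_cases f0 : aeval x cf.F0 = 0
    · rw [f0, mul_zero]
    suffices h : ∑ i, A i * x i = 0 by
      simp only [map_sum, map_mul, aeval_C, aeval_X, Algebra.algebraMap_self, RingHom.id_apply]
      rw [h, zero_mul]
    by_cases h0 : x = 0
    · simp [h0]
    obtain ⟨c, y, hc, rfl, hn⟩ := exists_normal h0
    have hy : Pt fr cf y := by
      rw [aeval_smul_hom cf.hF0] at f0 f1 f2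
      rw [aeval_smul_hom cf.hF1] at f1
      rw [aeval_smul_hom cf.hF2] at f2
      rw [aeval_smul_hom cf.h1] at z1
      rw [aeval_smul_hom cf.h2] at z2
      rw [aeval_smul_hom cf.hg] at zg
      have pc : ∀ n, c ^ n ≠ 0 := fun n => pow_ne_zero n hc
      refine ⟨hn, (mul_eq_zero.mp z1).resolve_left (pc _), (mul_eq_zero.mp z2).resolve_left (pc _), (mul_eq_zero.mp zg).resolve_left (pc _),
        right_ne_zero_of_mul f0, mul_left_cancel₀ (pc cf.e) ?_, mul_left_cancel₀ (pc cf.e) ?_⟩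
      · linear_combination f1
      · linear_combination f2
    have := hA y hy
    simp only [Pi.smul_apply, smul_eq_mul]
    rw [show ∑ i, A i * (c * y i) = c * ∑ i, A i * y i by
      rw [Finset.mul_sum]; exact Finset.sum_congr rfl fun i _ => by ring, this, mul_zero]
  obtain ⟨N, hN⟩ := key
  obtain ⟨c, hc⟩ := Ideal.mem_span_range_iff_exists_fun.mp hN
  exact ⟨N, c, hc⟩

theorem null_spec [IsAlgClosed Ω] (fr : Frame Ω) (cf : Cfg Ω) (A : Fin 6 → Ω) (hA : ∀ x, Pt fr cf x → ∑ i, A i * x i = 0) :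
    ∃ E : Finset Ω, ∀ (a : Fin 2 → ℂ) (P : Spec fr a), (∀ x ∈ E, x ∈ P.R) → 
      (∀ i, A i ∈ P.R) ∧ ∀ x : Fin 6 → ℂ, CPt cf a x → ∑ i, P.sp (A i) * x i = 0 := by
  classical
  obtain ⟨N, c, hc⟩ := null_id fr cf A hA
  refine ⟨Finset.univ.image A ∪ Finset.univ.biUnion (fun k => (c k).support.image (fun m => coeff m (c k))), fun a P hP => ?_⟩
  have hAR : ∀ i, A i ∈ P.R := fun i => hP _ (Finset.mem_union_left _ (by simp))
  have hcR : ∀ k m, coeff m (c k) ∈ P.R := by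
    intro k m
    by_cases hm : m ∈ (c k).support
    · exact hP _ (Finset.mem_union_right _ (Finset.mem_biUnion.mpr ⟨k, Finset.mem_univ _, Finset.mem_image.mpr ⟨m, hm, rfl⟩⟩))
    · rw [notMem_support_iff.mp hm]; exact zero_mem _
  refine ⟨hAR, fun x hx => ?_⟩
  have hlift : ∀ k, ∃ c' : MvPolynomial (Fin 6) P.R, map (P.R.val : P.R →+* Ω) c' = c k := by
    intro k
    refine ⟨∑ m ∈ (c k).support, monomial m (⟨coeff m (c k), hcR k m⟩ : P.R), ?_⟩
    rw [map_sum]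
    conv_rhs => rw [(c k).as_sum]
    refine Finset.sum_congr rfl fun m _ => ?_
    rw [map_monomial]; rfl
  choose c' hc' using hlift
  have hF0 : map (P.R.val : P.R →+* Ω) (map (algebraMap ℂ P.R) cf.F0) = map (algebraMap ℂ Ω) cf.F0 := by
    rw [MvPolynomial.map_map]; rfl
  have hid : ∑ k, c' k * eqsR cf P.R ⟨fr.s, P.hs⟩ ⟨fr.t, P.ht⟩ k =
      ((∑ i, C (⟨A i, hAR i⟩ : P.R) * X i) * map (algebraMap ℂ P.R) cf.F0) ^ N := by
    apply map_injective (P.R.val : P.R →+* Ω) Subtype.val_injective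
    rw [map_sum, map_pow, map_mul, map_sum, hF0]
    refine Eq.trans (Finset.sum_congr rfl fun k _ => ?_) (hc.trans ?_)
    · rw [map_mul, hc', eqsR_map cf P.R.val]; rfl
    · congr 2
      refine Finset.sum_congr rfl fun i _ => ?_
      rw [map_mul, map_C, map_X]; rfl
  have hev := congrArg (fun p => eval x (map (P.σ : P.R →+* ℂ) p)) hid
  simp only [map_sum, map_mul, map_pow, eqsR_map cf P.σ] at hev
  have hm : map (P.σ : P.R →+* ℂ) (map (algebraMap ℂ P.R) cf.F0) = cf.F0 := by
    rw [MvPolynomial.map_map, show (P.σ : P.R →+* ℂ).comp (algebraMap ℂ P.R) = RingHom.id ℂ from P.σ.comp_algebraMap, MvPolynomial.map_id]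
  have hz : ∀ k, eval x (eqsR cf ℂ (P.σ ⟨fr.s, P.hs⟩) (P.σ ⟨fr.t, P.ht⟩) k) = 0 := by
    intro k
    rw [P.σs, P.σt]
    fin_cases k
    · simp [eqsR, MvPolynomial.map_id, hx.z1]
    · simp [eqsR, MvPolynomial.map_id, hx.z2]
    · simp [eqsR, MvPolynomial.map_id, hx.zg]
    · simp [eqsR, MvPolynomial.map_id, hx.f1]
    · simp [eqsR, MvPolynomial.map_id, hx.f2]
  rw [Finset.sum_eq_zero (fun k _ => by rw [hz, mul_zero]), hm] at hev
  have := eq_zero_of_pow_eq_zero hev.symm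
  have := (mul_eq_zero.mp this).resolve_right hx.f0
  rw [← this]
  refine Finset.sum_congr rfl fun i _ => ?_
  rw [map_C, map_X, eval_C, eval_X, P.sp_mk (hAR i)]; rfl
end CI22

namespace CI22
open MvPolynomial Module Matrix
variable {Ω : Type} [Field Ω] [Algebra ℂ Ω] {fr : Frame Ω} {cf : Cfg Ω}

theorem Bf_mulVec (q : MvPolynomial (Fin 6) ℂ) (b : Fin 3 → Fin 6 → Ω) (c c' : Fin 3 → Ω) :
    Bf q (∑ i, c i • b i) (∑ j, c' j • b j) = ∑ j, (∑ i, c i * Bf q (b i) (b j)) * c' j := by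
  simp only [map_sum, map_smul, LinearMap.sum_apply, LinearMap.smul_apply, smul_eq_mul, Finset.sum_mul, Finset.mul_sum]
  refine Finset.sum_congr rfl fun _ _ => Finset.sum_congr rfl fun _ _ => by ring

theorem sp_Bf {a : Fin 2 → ℂ} (P : Spec fr a) (q : MvPolynomial (Fin 6) ℂ) {u v : Fin 6 → Ω} (hu : ∀ i, u i ∈ P.R) (hv : ∀ i, v i ∈ P.R) :
    Bf q u v ∈ P.R ∧ P.sp (Bf q u v) = Bf (Ω := ℂ) q (fun i => P.sp (u i)) (fun i => P.sp (v i)) := by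
  have hc : ∀ z : ℂ, algebraMap ℂ Ω z ∈ P.R := fun z => P.R.algebraMap_mem z
  have h1 : ∀ j k, algebraMap ℂ Ω (hess q j k) * u k ∈ P.R := fun j k => mul_mem (hc _) (hu _)
  have h2 : ∀ j k, algebraMap ℂ Ω (hess q j k) * u k * v j ∈ P.R := fun j k => mul_mem (h1 _ _) (hv _)
  rw [Bf_apply, Bf_apply]
  refine ⟨sum_mem fun j _ => sum_mem fun k _ => h2 j k, ?_⟩
  rw [P.sp_sum _ _ (fun j _ => sum_mem fun k _ => h2 j k)]
  refine Finset.sum_congr rfl fun j _ => ?_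
  rw [P.sp_sum _ _ (fun k _ => h2 j k)]
  refine Finset.sum_congr rfl fun k _ => ?_
  rw [P.sp_mul (h1 _ _) (hv _), P.sp_mul (hc _) (hu _), P.sp_alg]; rfl

structure ConicData (cf : Cfg Ω) (a : Fin 2 → ℂ) (p r : MvPolynomial (Fin 6) ℂ) (W : Submodule ℂ (Fin 6 → ℂ)) : Prop where
  fW : finrank ℂ W = 3
  sub : ∀ x, CPt cf a x → x ∈ W
  nd : ∀ w ∈ W, w ≠ 0 → ∃ u ∈ W, Bf (Ω := ℂ) p w u ≠ 0
  prop : ∃ c : ℂ, ∀ u ∈ W, Bf (Ω := ℂ) r u u = c * Bf (Ω := ℂ) p u u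

theorem conic_spec [IsAlgClosed Ω] (fr : Frame Ω) (hI : AlgebraicIndependent ℂ ![fr.s, fr.t]) {S : Finset (Fin 6 → Ω)}
    (hS : ∀ x, Pt fr cf x → x ∈ S) {W : Submodule Ω (Fin 6 → Ω)} {p r : MvPolynomial (Fin 6) ℂ} (hW : SmoothPlane cf S W p r) :
    ∃ D : MvPolynomial (Fin 2) ℂ, D ≠ 0 ∧ ∀ a : Fin 2 → ℂ, eval a D ≠ 0 → ∃ W', ConicData cf a p r W' := by
  classical
  let B := Module.finBasisOfFinrankEq Ω W hW.fW
  let b : Fin 3 → Fin 6 → Ω := fun i => (B i : Fin 6 → Ω)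
  have hbW : ∀ i, b i ∈ W := fun i => (B i).2
  have hrep : ∀ x ∈ W, ∃ c : Fin 3 → Ω, x = ∑ i, c i • b i := by
    intro x hx
    refine ⟨fun i => B.repr ⟨x, hx⟩ i, ?_⟩
    have := congrArg Subtype.val (B.sum_repr ⟨x, hx⟩)
    rw [AddSubmonoidClass.coe_finset_sum] at this
    exact this.symm
  have hli : LinearIndependent Ω b := B.linearIndependent.map' W.subtype (Submodule.ker_subtype W)
  let M : Matrix (Fin 6) (Fin 3) Ω := Matrix.of fun i j => b j i
  have hM : ∀ c, M *ᵥ c = ∑ i, c i • b i := by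
    intro c; ext k
    simp [M, mulVec, dotProduct, mul_comm]
  obtain ⟨N, hN⟩ := exists_left_inv M (by
    intro c hc
    rw [hM] at hc
    exact funext (Fintype.linearIndependent_iff.mp hli c hc))
  -- Gram matrix
  let G : Matrix (Fin 3) (Fin 3) Ω := Matrix.of fun i j => Bf p (b i) (b j)
  have hG : G.det ≠ 0 := by
    intro h0
    obtain ⟨c, hc, hcG⟩ := Matrix.exists_vecMul_eq_zero_iff.mpr h0
    have hw : (∑ i, c i • b i) ≠ 0 := fun h => hc (funext (Fintype.linearIndependent_iff.mp hli c h))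
    obtain ⟨u, hu, hne⟩ := hW.nd _ (sum_mem fun i _ => W.smul_mem _ (hbW i)) hw
    obtain ⟨c', rfl⟩ := hrep u hu
    apply hne
    rw [Bf_mulVec]
    refine Finset.sum_eq_zero fun j _ => ?_
    have := congrFun hcG j
    simp only [vecMul, dotProduct, G, of_apply, Pi.zero_apply] at this
    rw [this, zero_mul]
  obtain ⟨α, hα⟩ := hW.prop
  have hpol : ∀ i j, Bf r (b i) (b j) = α * Bf p (b i) (b j) := by
    intro i j
    have h1 := hα _ (hbW i)
    have h2 := hα _ (hbW j)
    have h3 := hα _ (W.add_mem (hbW i) (hbW j))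
    simp only [map_add, LinearMap.add_apply] at h3
    rw [Bf_symm r (b j) (b i), Bf_symm p (b j) (b i)] at h3
    apply mul_left_cancel₀ (two_ne (Ω := Ω))
    linear_combination h3 - h1 - h2
  -- linear equations
  let A : Fin 6 → Fin 6 → Ω := fun k i => (1 : Matrix (Fin 6) (Fin 6) Ω) k i - ∑ j, M k j * N j i
  have hA : ∀ k x, Pt fr cf x → ∑ i, A k i * x i = 0 := by
    intro k x hx
    obtain ⟨c, hc⟩ := hrep x (hW.sub x (hS x hx))
    have hMc : x = M *ᵥ c := by rw [hM]; exact hc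
    have h1 : M *ᵥ (N *ᵥ x) = x := by
      conv_lhs => rw [hMc]
      rw [mulVec_mulVec c N M, hN, one_mulVec, ← hMc]
    have h2 := congrFun h1 k
    have h3 : ∑ i, A k i * x i = ((1 : Matrix (Fin 6) (Fin 6) Ω) *ᵥ x) k - ((M * N : Matrix (Fin 6) (Fin 6) Ω) *ᵥ x) k := by
      simp only [A, mulVec, dotProduct, sub_mul, Finset.sum_sub_distrib, Matrix.mul_apply]
    rw [h3, one_mulVec, ← mulVec_mulVec, h2, sub_self]
  choose E hE using fun k => null_spec fr cf (A k) (hA k)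
  obtain ⟨D, hD, hs⟩ := spreadE fr hI (Finset.univ.biUnion E ∪ Finset.univ.image (fun p : Fin 6 × Fin 3 => M p.1 p.2)
    ∪ Finset.univ.image (fun p : Fin 3 × Fin 6 => N p.1 p.2) ∪ {(G.det)⁻¹, α})
  refine ⟨D, hD, fun a ha => ?_⟩
  obtain ⟨P, hP⟩ := hs a ha
  have hE' : ∀ k, ∀ x ∈ E k, x ∈ P.R := fun k x hx => hP x (by
    simp only [Finset.mem_union, Finset.mem_biUnion]; exact Or.inl (Or.inl (Or.inl ⟨k, Finset.mem_univ _, hx⟩)))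
  have hMR : ∀ i j, M i j ∈ P.R := fun i j => hP _ (by
    simp only [Finset.mem_union, Finset.mem_image]; exact Or.inl (Or.inl (Or.inr ⟨(i, j), Finset.mem_univ _, rfl⟩)))
  have hNR : ∀ i j, N i j ∈ P.R := fun i j => hP _ (by
    simp only [Finset.mem_union, Finset.mem_image]; exact Or.inl (Or.inr ⟨(i, j), Finset.mem_univ _, rfl⟩))
  have hGR : (G.det)⁻¹ ∈ P.R := hP _ (by simp)
  have hαR : α ∈ P.R := hP _ (by simp)
  have hbR : ∀ j i, b j i ∈ P.R := fun j i => hMR i j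
  let b' : Fin 3 → Fin 6 → ℂ := fun j i => P.sp (b j i)
  have hB : ∀ q i j, Bf (Ω := ℂ) q (b' i) (b' j) = P.sp (Bf q (b i) (b j)) := fun q i j => ((sp_Bf P q (hbR i) (hbR j)).2).symm
  have hG' : (Matrix.of fun i j => Bf (Ω := ℂ) p (b' i) (b' j)).det ≠ 0 := by
    have hGm : ∀ i j, G i j ∈ P.R := fun i j => (sp_Bf P p (hbR i) (hbR j)).1
    have hdet : G.det ∈ P.R := by
      rw [det_apply]; exact sum_mem fun _ _ => P.R.toSubring.zsmul_mem (prod_mem fun _ _ => hGm _ _) _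
    have h1 := P.sp_ne hdet hGR hG
    rw [P.sp_det G hGm] at h1
    intro h2; apply h1; rw [← h2]; congr 1; ext i j
    exact (hB p i j).symm
  have hNM : ∀ i j, ∑ k, P.sp (N i k) * b' j k = (1 : Matrix (Fin 3) (Fin 3) ℂ) i j := by
    intro i j
    have h1 : ∑ k, N i k * M k j = (1 : Matrix (Fin 3) (Fin 3) Ω) i j := by rw [← hN, Matrix.mul_apply]
    have h2 := congrArg P.sp h1
    rw [P.sp_sum _ _ (fun k _ => mul_mem (hNR _ _) (hMR _ _))] at h2
    have h3 : P.sp ((1 : Matrix (Fin 3) (Fin 3) Ω) i j) = (1 : Matrix (Fin 3) (Fin 3) ℂ) i j := by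
      by_cases hij : i = j
      · subst hij; rw [one_apply_eq, one_apply_eq, P.sp_one]
      · rw [one_apply_ne hij, one_apply_ne hij, P.sp_zero]
    rw [h3] at h2; rw [← h2]
    exact Finset.sum_congr rfl fun k _ => (P.sp_mul (hNR _ _) (hMR _ _)).symm
  have hli' : LinearIndependent ℂ b' := by
    rw [Fintype.linearIndependent_iff]
    intro c hc i
    have h1 : ∑ k, P.sp (N i k) * (∑ j, c j • b' j) k = c i := by
      calc ∑ k, P.sp (N i k) * (∑ j, c j • b' j) k = ∑ j, c j * ∑ k, P.sp (N i k) * b' j k := by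
            simp only [Finset.sum_apply, Pi.smul_apply, smul_eq_mul, Finset.mul_sum]
            rw [Finset.sum_comm]
            exact Finset.sum_congr rfl fun _ _ => Finset.sum_congr rfl fun _ _ => by ring
        _ = c i := by simp [hNM, Matrix.one_apply]
    rw [hc] at h1; simpa using h1.symm
  refine ⟨Submodule.span ℂ (Set.range b'), ?_, ?_, ?_, ?_⟩
  · rw [finrank_span_eq_card hli']; rfl
  · intro x hx
    have h1 : ∀ k, x k = ∑ j, (∑ i, P.sp (N j i) * x i) * b' j k := by
      intro k
      have h2 := (hE k a P (hE' k)).2 x hx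
      have h3 : ∀ i, P.sp (A k i) = (1 : Matrix (Fin 6) (Fin 6) ℂ) k i - ∑ j, b' j k * P.sp (N j i) := by
        intro i
        have hm : ∀ j ∈ Finset.univ, M k j * N j i ∈ P.R := fun j _ => mul_mem (hMR _ _) (hNR _ _)
        have h1m : (1 : Matrix (Fin 6) (Fin 6) Ω) k i ∈ P.R ∧ P.sp ((1 : Matrix (Fin 6) (Fin 6) Ω) k i) = (1 : Matrix (Fin 6) (Fin 6) ℂ) k i := by
          by_cases hij : k = i
          · subst hij; rw [one_apply_eq, one_apply_eq]; exact ⟨one_mem _, P.sp_one⟩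
          · rw [one_apply_ne hij, one_apply_ne hij]; exact ⟨zero_mem _, P.sp_zero⟩
        rw [P.sp_sub h1m.1 (sum_mem hm), h1m.2, P.sp_sum _ _ hm]
        congr 1
        exact Finset.sum_congr rfl fun j _ => P.sp_mul (hMR _ _) (hNR _ _)
      simp only [h3, sub_mul, Finset.sum_sub_distrib] at h2
      have h4 : ∑ i, (1 : Matrix (Fin 6) (Fin 6) ℂ) k i * x i = x k := by simp [Matrix.one_apply]
      rw [h4, sub_eq_zero] at h2
      rw [h2]
      simp only [Finset.sum_mul]
      rw [Finset.sum_comm]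
      exact Finset.sum_congr rfl fun _ _ => Finset.sum_congr rfl fun _ _ => by ring
    have h5 : x = ∑ j, (∑ i, P.sp (N j i) * x i) • b' j := by
      ext k; rw [h1 k]; simp
    rw [h5]
    exact sum_mem fun j _ => Submodule.smul_mem _ _ (Submodule.subset_span ⟨j, rfl⟩)
  · intro w hw hw0
    obtain ⟨c, rfl⟩ := (Submodule.mem_span_range_iff_exists_fun ℂ).mp hw
    by_contra! hall
    apply hw0
    have hc : c = 0 := by
      apply Matrix.eq_zero_of_vecMul_eq_zero hG'
      ext j
      have := hall (b' j) (Submodule.subset_span ⟨j, rfl⟩)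
      simpa [vecMul, dotProduct, LinearMap.sum_apply] using this
    simp [hc]
  · refine ⟨P.sp α, fun u hu => ?_⟩
    obtain ⟨c, rfl⟩ := (Submodule.mem_span_range_iff_exists_fun ℂ).mp hu
    rw [Bf_mulVec, Bf_mulVec, Finset.mul_sum]
    refine Finset.sum_congr rfl fun j _ => ?_
    rw [← mul_assoc, Finset.mul_sum]
    congr 1
    refine Finset.sum_congr rfl fun i _ => ?_
    rw [hB, hB, hpol, P.sp_mul hαR (sp_Bf P p (hbR i) (hbR j)).1]; ring
end CI22

namespace CI22
open MvPolynomial Module Matrix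
variable {Ω : Type} [Field Ω] [Algebra ℂ Ω] {fr : Frame Ω} {cf : Cfg Ω}

theorem affine_main [IsAlgClosed Ω] (fr : Frame Ω) (hI : AlgebraicIndependent ℂ ![fr.s, fr.t]) (cf : Cfg Ω) {δ : ℕ} (hδ : δ ≤ 2 * cf.d)
    {D0 : MvPolynomial (Fin 2) ℂ} (hD0 : D0 ≠ 0)
    (hne : ∀ a, eval a D0 ≠ 0 → ∃ x, x ≠ 0 ∧ CPt cf a x)
    (hle : ∀ a, eval a D0 ≠ 0 → ∀ T : Finset (Fin 6 → ℂ), (∀ x ∈ T, CPt cf a x ∧ ∃ i, x i = 1 ∧ ∀ j < i, x j = 0) → T.card ≤ δ) :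
    2 * cf.d - 2 ≤ δ ∧ ∃ D : MvPolynomial (Fin 2) ℂ, D ≠ 0 ∧ ∃ p r, ((p = cf.q1 ∧ r = cf.q2) ∨ (p = cf.q2 ∧ r = cf.q1)) ∧
      ∀ a, eval a D ≠ 0 → ∃ W', ConicData cf a p r W' := by
  classical
  have hbound : ∀ T : Finset (Fin 6 → Ω), (∀ x ∈ T, Pt fr cf x) → T.card ≤ δ := by
    intro T hT
    obtain ⟨D, hD, h⟩ := spec_points fr hI T hT
    obtain ⟨a, ha⟩ := exists_eval_ne (mul_ne_zero hD hD0)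
    rw [map_mul] at ha
    obtain ⟨T', hc, hT'⟩ := h a (left_ne_zero_of_mul ha)
    rw [← hc]
    exact hle a (right_ne_zero_of_mul ha) T' hT'
  have hfin : {x | Pt fr cf x}.Finite := by
    by_contra hinf
    obtain ⟨T, hT, hc⟩ := Set.Infinite.exists_subset_card_eq hinf (δ + 1)
    have := hbound T (fun x hx => hT hx)
    omega
  have hS : ∀ x, x ∈ hfin.toFinset ↔ Pt fr cf x := fun x => by simp
  have hSne : hfin.toFinset.Nonempty := by
    by_contra hemp
    rw [Finset.not_nonempty_iff_eq_empty] at hemp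
    have hno : ∀ x, ¬ Pt fr cf x := fun x hx => by
      have := (hS x).mpr hx; rw [hemp] at this; simp at this
    choose E hE using fun k : Fin 6 => null_spec fr cf (Pi.single k 1) (fun x hx => absurd hx (hno x))
    obtain ⟨D, hD, hs⟩ := spreadE fr hI (Finset.univ.biUnion E)
    obtain ⟨a, ha⟩ := exists_eval_ne (mul_ne_zero hD hD0)
    rw [map_mul] at ha
    obtain ⟨P, hP⟩ := hs a (left_ne_zero_of_mul ha)
    obtain ⟨x, hx0, hx⟩ := hne a (right_ne_zero_of_mul ha)
    apply hx0
    ext k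
    have h := (hE k a P (fun y hy => hP y (Finset.mem_biUnion.mpr ⟨k, Finset.mem_univ _, hy⟩))).2 x hx
    rw [Finset.sum_eq_single k] at h
    · rw [Pi.single_eq_same, P.sp_one, one_mul] at h; exact h
    · intro i _ hik; rw [Pi.single_eq_of_ne hik, P.sp_zero, zero_mul]
    · simp
  have hcard := hbound hfin.toFinset (fun x hx => (hS x).mp hx)
  obtain ⟨h1, W, p, r, hW⟩ := core hS hSne (hcard.trans hδ)
  obtain ⟨D, hD, h⟩ := conic_spec fr hI (fun x hx => (hS x).mpr hx) hW
  exact ⟨h1.trans hcard, D, hD, p, r, hW.which, h⟩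
end CI22

namespace CI22
open MvPolynomial Module

theorem ae_ev {n : ℕ} (p : MvPolynomial (Fin n) ℂ) (v : Fin n → ℂ) : aeval v p = eval v p := by
  rw [← MvPolynomial.coe_aeval_eq_eval]; rfl

theorem eval_smul_hom {n d : ℕ} {p : MvPolynomial (Fin n) ℂ} (hp : p.IsHomogeneous d) (c : ℂ) (x : Fin n → ℂ) :
    eval (c • x) p = c ^ d * eval x p := by
  have := aeval_smul_hom (Ω := ℂ) hp c x
  simpa only [ae_ev] using this

theorem pvanish_mk {k n : ℕ} {f : MvPolynomial (Fin k) ℂ} (hf : f.IsHomogeneous n) {v : Fin k → ℂ} (hv : v ≠ 0) :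
    PVanish f (Projectivization.mk ℂ v hv) ↔ eval v f = 0 := by
  constructor
  · intro h; exact h v hv rfl
  · intro h w hw hwv
    obtain ⟨c, hc⟩ := (Projectivization.mk_eq_mk_iff' ℂ w v hw hv).mp hwv
    rw [← hc, eval_smul_hom hf, h, mul_zero]

theorem v3_ne (a : Fin 2 → ℂ) : (![1, a 0, a 1] : Fin 3 → ℂ) ≠ 0 := fun h => by
  have := congrFun h 0; simp at this

theorem homogenize (D : MvPolynomial (Fin 2) ℂ) : ∃ (H : MvPolynomial (Fin 3) ℂ) (n : ℕ), H.IsHomogeneous n ∧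
    (∀ a : Fin 2 → ℂ, eval ![1, a 0, a 1] H = eval a D) ∧ ∀ y : Fin 3 → ℂ, y 0 = 0 → eval y H = 0 := by
  have hle : ∀ m ∈ D.support, m 0 + m 1 ≤ D.totalDegree := by
    intro m hm
    have := le_totalDegree hm
    rwa [Finsupp.sum_fintype _ _ (fun _ => rfl), Fin.sum_univ_two] at this
  refine ⟨∑ m ∈ D.support, C (coeff m D) * (X 0 ^ (D.totalDegree + 1 - (m 0 + m 1)) * (X 1 ^ (m 0) * X 2 ^ (m 1))), D.totalDegree + 1, ?_, ?_, ?_⟩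
  · refine IsHomogeneous.sum _ _ _ fun m hm => ?_
    have h := hle m hm
    have h1 := ((isHomogeneous_X ℂ (0 : Fin 3)).pow (D.totalDegree + 1 - (m 0 + m 1))).mul
      (((isHomogeneous_X ℂ (1 : Fin 3)).pow (m 0)).mul ((isHomogeneous_X ℂ (2 : Fin 3)).pow (m 1)))
    have h2 := (isHomogeneous_C (Fin 3) (coeff m D)).mul h1
    have h3 : 0 + (1 * (D.totalDegree + 1 - (m 0 + m 1)) + (1 * m 0 + 1 * m 1)) = D.totalDegree + 1 := by omega
    rwa [h3] at h2
  · intro a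
    rw [eval_eq' a D, map_sum]
    refine Finset.sum_congr rfl fun m _ => ?_
    simp [Fin.prod_univ_two]
  · intro y hy
    rw [map_sum]
    refine Finset.sum_eq_zero fun m hm => ?_
    have h := hle m hm
    simp only [map_mul, map_pow, eval_X, hy]
    rw [zero_pow (by omega), zero_mul, mul_zero]

theorem dehom {f : MvPolynomial (Fin 3) ℂ} {n : ℕ} (hf : f.IsHomogeneous n) (h0 : f ≠ 0) :
    ∃ D : MvPolynomial (Fin 2) ℂ, D ≠ 0 ∧ ∀ a : Fin 2 → ℂ, eval a D = eval ![1, a 0, a 1] f := by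
  have he : ∀ a : Fin 2 → ℂ, eval a (aeval (![1, X 0, X 1] : Fin 3 → MvPolynomial (Fin 2) ℂ) f) = eval ![1, a 0, a 1] f := by
    intro a
    rw [← MvPolynomial.coe_aeval_eq_eval, ← MvPolynomial.coe_aeval_eq_eval]
    change (aeval a) (aeval _ f) = aeval _ f
    rw [← AlgHom.comp_apply, comp_aeval]
    congr 1
    congr 1
    ext i; fin_cases i <;> simp
  refine ⟨_, ?_, he⟩
  intro hz
  obtain ⟨v, hv⟩ := exists_eval_ne (mul_ne_zero h0 (X_ne_zero (R := ℂ) (0 : Fin 3)))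
  rw [map_mul, eval_X] at hv
  have hv0 := right_ne_zero_of_mul hv
  have h1 := he ![v 1 / v 0, v 2 / v 0]
  rw [hz, map_zero] at h1
  apply left_ne_zero_of_mul hv
  have h2 : v = v 0 • ![1, v 1 / v 0, v 2 / v 0] := by
    ext i; fin_cases i <;> simp [mul_div_cancel₀ _ hv0]
  rw [h2, eval_smul_hom hf]
  simp only [Matrix.cons_val_zero, Matrix.cons_val_one] at h1
  rw [← h1, mul_zero]

variable {Ω : Type} [Field Ω] [Algebra ℂ Ω]

theorem mapsTo_iff (φ : RatMapTo (Fin 6) 2) {v : Fin 6 → ℂ} (hv : v ≠ 0) (a : Fin 2 → ℂ) :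
    φ.mapsTo (Projectivization.mk ℂ v hv) (Projectivization.mk ℂ ![1, a 0, a 1] (v3_ne a)) ↔
      eval v (φ.F 0) ≠ 0 ∧ eval v (φ.F 1) = a 0 * eval v (φ.F 0) ∧ eval v (φ.F 2) = a 1 * eval v (φ.F 0) := by
  constructor
  · intro h
    obtain ⟨hw, hy⟩ := h v hv rfl
    obtain ⟨c, hc⟩ := (Projectivization.mk_eq_mk_iff' ℂ _ _ hw _).mp hy
    have h0 := congrFun hc 0
    have h1 := congrFun hc 1
    have h2 := congrFun hc 2
    simp [RatMapTo.evalVec] at h0 h1 h2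
    refine ⟨fun hz => hw ?_, ?_, ?_⟩
    · rw [← hc, h0, hz, zero_smul]
    · rw [← h1, h0]; ring
    · rw [← h2, h0]; ring
  · rintro ⟨h0, h1, h2⟩ w hw hwv
    obtain ⟨c, rfl⟩ := (Projectivization.mk_eq_mk_iff' ℂ w v hw hv).mp hwv
    have hc : c ≠ 0 := fun h => hw (by rw [h, zero_smul])
    have hev : φ.evalVec (c • v) = (c ^ φ.e * eval v (φ.F 0)) • ![1, a 0, a 1] := by
      ext j
      simp only [RatMapTo.evalVec]
      rw [eval_smul_hom (φ.homog j)]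
      fin_cases j
      · simp
      · simp [h1]; ring
      · simp [h2]; ring
    have hne : φ.evalVec (c • v) ≠ 0 := by
      rw [hev]; exact smul_ne_zero (mul_ne_zero (pow_ne_zero _ hc) h0) (v3_ne a)
    exact ⟨hne, (Projectivization.mk_eq_mk_iff' ℂ _ _ hne _).mpr ⟨_, hev.symm⟩⟩

theorem norm_unique {x y : Fin 6 → ℂ} (hx : ∃ i, x i = 1 ∧ ∀ j < i, x j = 0) (hy : ∃ i, y i = 1 ∧ ∀ j < i, y j = 0)
    {c : ℂ} (h : c • y = x) : x = y := by
  obtain ⟨i, hi, hi'⟩ := hx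
  obtain ⟨k, hk, hk'⟩ := hy
  have hc : c ≠ 0 := fun h0 => by rw [h0, zero_smul] at h; rw [← h] at hi; simp at hi
  have hh : ∀ j, c * y j = x j := fun j => congrFun h j
  have hik : i = k := by
    rcases lt_trichotomy i k with hlt | heq | hgt
    · have := hh i; rw [hk' i hlt, hi] at this; simp at this
    · exact heq
    · have := hh k; rw [hi' k hgt, hk] at this; simp [hc] at this
  subst hik
  have := hh i; rw [hk, hi, mul_one] at this
  rw [← h, this, one_smul]

theorem conic_of {cf : Cfg Ω} {a : Fin 2 → ℂ} {p r : MvPolynomial (Fin 6) ℂ} {W : Submodule ℂ (Fin 6 → ℂ)}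
    (hW : ConicData cf a p r W) (hp : p.IsHomogeneous 2) : IsSmoothConic {x : PPt (Fin 6) | x.submodule ≤ W ∧ PVanish p x} := by
  refine ⟨W, hW.fW, p, hp, rfl, ?_, ?_⟩
  · by_contra! hall
    have hB : ∀ v ∈ W, Bf (Ω := ℂ) p v v = 0 := fun v hv => (Bf_self_zero (Ω := ℂ) hp v).mp (by
      rw [ae_ev]; exact hall v hv)
    have hne : W ≠ ⊥ := fun h => by have := hW.fW; rw [h, finrank_bot] at this; omega
    obtain ⟨w, hw, hw0⟩ := (Submodule.ne_bot_iff W).mp hne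
    obtain ⟨u, hu, hwu⟩ := hW.nd w hw hw0
    have h1 := hB _ (W.add_mem hw hu)
    simp only [map_add, LinearMap.add_apply, hB w hw, hB u hu] at h1
    rw [Bf_symm p u w] at h1
    apply hwu
    linear_combination h1 / 2
  · intro v hv hv0 _
    obtain ⟨u, hu, h⟩ := hW.nd v hv hv0
    refine ⟨u, hu, ?_⟩
    rw [Bf_gr hp] at h
    exact h

end CI22

open CI22

/-- **Lemma 4.6.** Let `Z ⊂ ℙ^5` be a smooth `(2,2)` complete
intersection, `X = Z ∩ {g = 0}` a smooth surface with `d ≥ 8`, and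
`φ : X ⇢ ℙ^2` a dominant rational map with `deg φ ≤ 2d`.  Then
`deg φ ≥ 2d − 2`, and the fiber of `φ` over a general point of `ℙ^2` is
contained in a smooth plane conic `C ⊂ ℙ^5` lying inside `Z`. -/
theorem fibers_on_smooth_conics_in_22_complete_intersection
    (d δ : ℕ) (hd : 8 ≤ d) (hδ : δ ≤ 2 * d)
    (q₁ q₂ g : MvPolynomial (Fin 6) ℂ)
    (h₁ : q₁.IsHomogeneous 2) (h₂ : q₂.IsHomogeneous 2)
    (hZ : IsSmoothCI2 q₁ q₂) (hg : g.IsHomogeneous d)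
    (hX : IsSmoothCI3 q₁ q₂ g)
    (φ : RatMapTo (Fin 6) 2)
    (hφ : φ.DominantOfDegree (ZeroSet q₁ ∩ ZeroSet q₂ ∩ ZeroSet g) δ) :
    2 * d - 2 ≤ δ ∧
    ∃ V : Set (PPt (Fin 3)), ContainsDenseOpenOf Set.univ V ∧
      ∀ y ∈ V, ∃ C : Set (PPt (Fin 6)), IsSmoothConic C ∧
        C ⊆ ZeroSet q₁ ∩ ZeroSet q₂ ∧
        φ.fiber (ZeroSet q₁ ∩ ZeroSet q₂ ∩ ZeroSet g) y ⊆ C := by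
  classical
  obtain ⟨Ω, _, _, _, fr, hI⟩ := exists_frame
  let cf : Cfg Ω := { d := d, e := φ.e, hd := hd, q1 := q₁, q2 := q₂, g := g, F0 := φ.F 0, F1 := φ.F 1, F2 := φ.F 2, h1 := h₁, h2 := h₂, hg := hg, hF0 := φ.homog 0, hF1 := φ.homog 1, hF2 := φ.homog 2, smZ := smZ_of fr hI hZ, smX := smX_of fr hI hX }
  obtain ⟨hδ0, V0, ⟨Y0, ⟨fs, hfs, rfl⟩, hY0, hV0⟩, hfib⟩ := hφ
  obtain ⟨y0, -, hy0⟩ := Set.not_subset.mp hY0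
  simp only [Set.mem_setOf_eq, not_forall] at hy0
  obtain ⟨f, hf, hfy⟩ := hy0
  obtain ⟨n, hfn⟩ := hfs f hf
  have hf0 : f ≠ 0 := fun h => hfy (fun v hv _ => by rw [h, map_zero])
  obtain ⟨D0, hD0, hD0e⟩ := dehom hfn hf0
  -- membership in fibres
  have hmem : ∀ (a : Fin 2 → ℂ) (v : Fin 6 → ℂ) (hv : v ≠ 0),
      Projectivization.mk ℂ v hv ∈ φ.fiber (ZeroSet q₁ ∩ ZeroSet q₂ ∩ ZeroSet g) (Projectivization.mk ℂ ![1, a 0, a 1] (v3_ne a)) ↔ CPt cf a v := by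
    intro a v hv
    have e1 : Projectivization.mk ℂ v hv ∈ ZeroSet q₁ ↔ eval v q₁ = 0 := pvanish_mk h₁ hv
    have e2 : Projectivization.mk ℂ v hv ∈ ZeroSet q₂ ↔ eval v q₂ = 0 := pvanish_mk h₂ hv
    have e3 : Projectivization.mk ℂ v hv ∈ ZeroSet g ↔ eval v g = 0 := pvanish_mk hg hv
    constructor
    · rintro ⟨⟨⟨m1, m2⟩, m3⟩, hm⟩
      obtain ⟨k0, k1, k2⟩ := (mapsTo_iff φ hv a).mp hm
      exact ⟨e1.mp m1, e2.mp m2, e3.mp m3, k0, k1, k2⟩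
    · intro h
      exact ⟨⟨⟨e1.mpr h.z1, e2.mpr h.z2⟩, e3.mpr h.zg⟩, (mapsTo_iff φ hv a).mpr ⟨h.f0, h.f1, h.f2⟩⟩
  have hV : ∀ a, eval a D0 ≠ 0 → Projectivization.mk ℂ ![1, a 0, a 1] (v3_ne a) ∈ V0 := by
    intro a ha
    refine hV0 ⟨Set.mem_univ _, fun h => ha ?_⟩
    rw [hD0e]
    exact h f hf _ (v3_ne a) rfl
  obtain ⟨hlow, D, hD, p, r, hwh, hcon⟩ := affine_main fr hI cf (δ := δ) hδ hD0 (by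
    intro a ha
    obtain ⟨hfin, hcard⟩ := hfib _ (hV a ha)
    obtain ⟨x, hx⟩ := Set.nonempty_of_ncard_ne_zero (by rw [hcard]; omega)
    induction x using Projectivization.ind with
    | h v hv => exact ⟨v, hv, (hmem a v hv).mp hx⟩) (by
    intro a ha T hT
    obtain ⟨hfin, hcard⟩ := hfib _ (hV a ha)
    have hne : ∀ x ∈ T, x ≠ 0 := by
      rintro x hx rfl
      obtain ⟨i, hi, -⟩ := (hT 0 hx).2
      simp at hi
    let G : (Fin 6 → ℂ) → PPt (Fin 6) := fun x => if h : x ≠ 0 then Projectivization.mk ℂ x h else Projectivization.mk ℂ 1 one_ne_zero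
    have hG : ∀ x (hx : x ≠ 0), G x = Projectivization.mk ℂ x hx := fun x hx => dif_pos hx
    rw [← hcard, ← Set.ncard_coe_finset T]
    refine Set.ncard_le_ncard_of_injOn G ?_ ?_ hfin
    · intro x hx
      rw [hG x (hne x hx)]
      exact (hmem a x _).mpr (hT x hx).1
    · intro x hx y hy hxy
      rw [hG x (hne x hx), hG y (hne y hy)] at hxy
      obtain ⟨c, hc⟩ := (Projectivization.mk_eq_mk_iff' ℂ _ _ _ _).mp hxy
      exact norm_unique (hT x hx).2 (hT y hy).2 hc)
  refine ⟨hlow, ?_⟩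
  obtain ⟨H, N, hH, hHD, hH0⟩ := homogenize D
  refine ⟨(ZeroSet H)ᶜ, ⟨ZeroSet H, ⟨{H}, by rintro _ rfl; exact ⟨N, hH⟩, by ext x; simp [ZeroSet]⟩, ?_, fun x hx => hx.2⟩, ?_⟩
  · obtain ⟨a, ha⟩ := exists_eval_ne hD
    intro hsub
    have := hsub (Set.mem_univ (Projectivization.mk ℂ ![1, a 0, a 1] (v3_ne a)))
    rw [ZeroSet, Set.mem_setOf_eq, pvanish_mk hH, hHD] at this
    exact ha this
  · intro y hy
    induction y using Projectivization.ind with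
    | h w hw =>
      have hHw : eval w H ≠ 0 := fun h => hy ((pvanish_mk hH hw).mpr h)
      have hw0 : w 0 ≠ 0 := fun h => hHw (hH0 w h)
      let a : Fin 2 → ℂ := ![w 1 / w 0, w 2 / w 0]
      have hwa : w = w 0 • ![1, a 0, a 1] := by
        ext i; fin_cases i <;> simp [a, mul_div_cancel₀ _ hw0]
      have hya : Projectivization.mk ℂ w hw = Projectivization.mk ℂ ![1, a 0, a 1] (v3_ne a) :=
        (Projectivization.mk_eq_mk_iff' ℂ _ _ _ _).mpr ⟨w 0, hwa.symm⟩
      have haD : eval a D ≠ 0 := by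
        intro h
        apply hHw
        rw [hwa, eval_smul_hom hH, hHD, h, mul_zero]
      obtain ⟨W, hW⟩ := hcon a haD
      have hp : p.IsHomogeneous 2 := by
        rcases hwh with ⟨rfl, -⟩ | ⟨rfl, -⟩
        · exact h₁
        · exact h₂
      have hr : r.IsHomogeneous 2 := by
        rcases hwh with ⟨-, rfl⟩ | ⟨-, rfl⟩
        · exact h₂
        · exact h₁
      have hpr : ∀ v ∈ W, eval v p = 0 → eval v r = 0 := by
        intro v hv hz
        obtain ⟨c, hc⟩ := hW.prop
        have h1 : Bf (Ω := ℂ) p v v = 0 := (Bf_self_zero (Ω := ℂ) hp v).mp (by rw [ae_ev]; exact hz)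
        have h2 := hc v hv
        rw [h1, mul_zero] at h2
        have h3 := (Bf_self_zero (Ω := ℂ) hr v).mpr h2
        rw [ae_ev] at h3
        exact h3
      refine ⟨_, conic_of hW hp, ?_, ?_⟩
      · rintro x ⟨hxW, hxp⟩
        induction x using Projectivization.ind with
        | h v hv =>
          rw [Projectivization.submodule_mk, Submodule.span_singleton_le_iff_mem] at hxW
          have zp := (pvanish_mk hp hv).mp hxp
          have zr := hpr v hxW zp
          rcases hwh with ⟨rfl, rfl⟩ | ⟨rfl, rfl⟩
          · exact ⟨(pvanish_mk h₁ hv).mpr zp, (pvanish_mk h₂ hv).mpr zr⟩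
          · exact ⟨(pvanish_mk h₁ hv).mpr zr, (pvanish_mk h₂ hv).mpr zp⟩
      · intro x hx
        rw [hya] at hx
        induction x using Projectivization.ind with
        | h v hv =>
          have hc := (hmem a v hv).mp hx
          refine ⟨?_, (pvanish_mk hp hv).mpr ?_⟩
          · rw [Projectivization.submodule_mk, Submodule.span_singleton_le_iff_mem]
            exact hW.sub v hc
          · rcases hwh with ⟨rfl, -⟩ | ⟨rfl, -⟩
            · exact hc.z1
            · exact hc.z2
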